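/- Assume dim R = d ≥ 2. Then R is generalized Cohen-Macaulay if and only if the sets Ξ_i(R) = { e_i(q :_R m, R) : q a C-parameter ideal of R } are finite for all i = 1, 2, …, d. -/

import Mathlib

/-! Preliminary definitions: lengths, dimensions, (C-)systems of parameters, Hilbert
coefficients, irreducible multiplicities, local cohomology invariants, stable values,
unmixedness, the unmixed component, and the g-invariant. -/

open CategoryTheory CategoryTheory.Limits Opposite IsLocalRing

universe u

noncomputable section

section Definitions

variable (R : Type u) [CommRing R]

/-- The length of an `R`-module, defined as the Krull dimension of its submodule lattice. -/
def moduleLength (M : Type u) [AddCommGroup M] [Module R M] : WithBot ℕ∞ :=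
  Order.krullDim (Submodule R M)

/-- The Krull dimension of an `R`-module `M`, i.e. `dim (R / Ann M)`. -/
def moduleDim (M : Type u) [AddCommGroup M] [Module R M] : WithBot ℕ∞ :=
  ringKrullDim (R ⧸ Module.annihilator R M)

/-- The colon submodule `(N :_M I) = {x : M | I • x ⊆ N}`. -/
def modColon {M : Type u} [AddCommGroup M] [Module R M] (N : Submodule R M) (I : Ideal R) :
    Submodule R M where
  carrier := {x | ∀ r ∈ I, r • x ∈ N}
  add_mem' := by
    intro a b ha hb r hr
    simpa [smul_add] using N.add_mem (ha r hr) (hb r hr)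
  zero_mem' := by
    intro r hr
    simpa using N.zero_mem
  smul_mem' := by
    intro c a ha r hr
    rw [smul_comm]
    exact N.smul_mem c (ha r hr)

/-- `x : Fin s → R` is a system of parameters of the module `M`:
`s = dim M`, the `x i` are nonunits, and `M/(x)M` has finite length. -/
def IsSOP (M : Type u) [AddCommGroup M] [Module R M] {s : ℕ} (x : Fin s → R) : Prop :=
  moduleDim R M = (s : WithBot ℕ∞) ∧ (∀ i, x i ∈ nonunits R) ∧
    IsFiniteLength R (M ⧸ (Ideal.span (Set.range x) • (⊤ : Submodule R M)))

/-- The ideal `b(M)`: the intersection, over all systems of parameters `x` of `M` and all `i`,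
of `Ann_R ((0) :_{M/(x_1,...,x_{i-1})M} x_i)`. -/
def bIdeal (M : Type u) [AddCommGroup M] [Module R M] : Ideal R :=
  ⨅ (s : ℕ) (x : Fin s → R) (_ : IsSOP R M x) (i : Fin s),
    (Submodule.torsionBy R
      (M ⧸ (Ideal.span (x '' {j | j < i}) • (⊤ : Submodule R M))) (x i)).annihilator

/-- `x` is a C-system of parameters of `M`: a system of parameters such that
`x i ∈ b(M/(x_{i+1},...,x_s)M)^3` for every `i` (for `i = s` the quotient is `M` itself). -/
def IsCSOP (M : Type u) [AddCommGroup M] [Module R M] {s : ℕ} (x : Fin s → R) : Prop :=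
  IsSOP R M x ∧ ∀ i : Fin s,
    x i ∈ (bIdeal R (M ⧸ (Ideal.span (x '' {j | i < j}) • (⊤ : Submodule R M)))) ^ 3

/-- A parameter ideal of `R`. -/
def IsParamIdeal (q : Ideal R) : Prop :=
  ∃ (s : ℕ) (x : Fin s → R), IsSOP R R x ∧ q = Ideal.span (Set.range x)

/-- A C-parameter ideal of `R`: an ideal generated by a C-system of parameters of `R`. -/
def IsCParamIdeal (q : Ideal R) : Prop :=
  ∃ (s : ℕ) (x : Fin s → R), IsCSOP R R x ∧ q = Ideal.span (Set.range x)

/-- A C-parameter ideal of a module `M`. -/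
def IsCParamIdealMod (M : Type u) [AddCommGroup M] [Module R M] (q : Ideal R) : Prop :=
  ∃ (s : ℕ) (x : Fin s → R), IsCSOP R M x ∧ q = Ideal.span (Set.range x)

/-- `e` is the family of Hilbert coefficients of `M` (of dimension `s`) with respect to `I`:
`ℓ(M/I^{n+1}M) = ∑_{i=0}^{s} (-1)^i (e i) binom(n+s-i, s-i)` for all large `n`. -/
def IsHilbCoeffMod (I : Ideal R) (M : Type u) [AddCommGroup M] [Module R M] (s : ℕ)
    (e : ℕ → ℤ) : Prop :=
  ∃ N : ℕ, ∀ n ≥ N, ∃ L : ℕ,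
    moduleLength R (M ⧸ (I ^ (n + 1) • (⊤ : Submodule R M))) = (L : WithBot ℕ∞) ∧
    (L : ℤ) = ∑ i ∈ Finset.range (s + 1),
      (-1) ^ i * e i * ((n + s - i).choose (s - i) : ℤ)

/-- `e` is the family of Hilbert coefficients of `R` (of dimension `d`) with respect to `I`;
`e 1` is the Chern number of `I`. -/
def IsHilbCoeff (I : Ideal R) (d : ℕ) (e : ℕ → ℤ) : Prop :=
  IsHilbCoeffMod R I R d e

variable [IsLocalRing R]

/-- The colon ideal `(q :_R m)`. -/
def colonIdeal (q : Ideal R) : Ideal R :=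
  modColon R q (maximalIdeal R)

/-- The index of reducibility `ir_M(q) = ℓ((qM :_M m)/qM)`. -/
def irMod (M : Type u) [AddCommGroup M] [Module R M] (q : Ideal R) : WithBot ℕ∞ :=
  moduleLength R
    ↥(Submodule.map (q • (⊤ : Submodule R M)).mkQ
      (modColon R (q • (⊤ : Submodule R M)) (maximalIdeal R)))

/-- `NN` is the stable value `𝒩(M)` of `M`: the common index of reducibility of all
C-parameter ideals of `M`. -/
def IsStableValueMod (M : Type u) [AddCommGroup M] [Module R M] (NN : ℕ) : Prop :=
  ∀ q : Ideal R, IsCParamIdealMod R M q → irMod R M q = (NN : WithBot ℕ∞)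

/-- `NN` is the stable value `𝒩(R)` of `R`. -/
def IsStableValue (NN : ℕ) : Prop :=
  ∀ q : Ideal R, IsCParamIdeal R q → irMod R R q = (NN : WithBot ℕ∞)

/-- `f` is the family of coefficients of the polynomial giving the index of reducibility,
`ir_M(I^{n+1}) = ℓ((I^{n+1}M :_M m)/I^{n+1}M) = ∑_{i=0}^{s-1} (-1)^i (f i) binom(n+s-1-i, s-1-i)`
for all large `n`; `f 0` is the irreducible multiplicity of `M` with respect to `I`. -/
def IsIrrCoeffMod (I : Ideal R) (M : Type u) [AddCommGroup M] [Module R M] (s : ℕ)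
    (f : ℕ → ℤ) : Prop :=
  ∃ N : ℕ, ∀ n ≥ N, ∃ L : ℕ,
    irMod R M (I ^ (n + 1)) = (L : WithBot ℕ∞) ∧
    (L : ℤ) = ∑ i ∈ Finset.range s,
      (-1) ^ i * f i * ((n + s - 1 - i).choose (s - 1 - i) : ℤ)

/-- Ring version of `IsIrrCoeffMod`. -/
def IsIrrCoeff (I : Ideal R) (d : ℕ) (f : ℕ → ℤ) : Prop :=
  IsIrrCoeffMod R I R d f

/-- The local cohomology module `H^i_m(M)`. -/
def Hmod (M : Type u) [AddCommGroup M] [Module R M] (i : ℕ) : ModuleCat.{u} R :=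
  (localCohomology (maximalIdeal R) i).obj (ModuleCat.of R M)

/-- `r_i(M) = ℓ((0) :_{H^i_m(M)} m)`, the length of the socle of `H^i_m(M)`. -/
def rLengthMod (M : Type u) [AddCommGroup M] [Module R M] (i : ℕ) : WithBot ℕ∞ :=
  moduleLength R ↥(Submodule.torsionBySet R ↥(Hmod R M i) ((maximalIdeal R : Ideal R) : Set R))

/-- `r_i(R)`. -/
def rLength (i : ℕ) : WithBot ℕ∞ := rLengthMod R R i

/-- `M` is a Cohen-Macaulay `R`-module: `H^i_m(M) = 0` for all `i < dim M`. -/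
def IsCMMod (M : Type u) [AddCommGroup M] [Module R M] : Prop :=
  ∀ i : ℕ, (i : WithBot ℕ∞) < moduleDim R M → Subsingleton ↥(Hmod R M i)

/-- `R` is a Cohen-Macaulay local ring: `H^i_m(R) = 0` for all `i < dim R`. -/
def IsCMLocal : Prop :=
  ∀ i : ℕ, (i : WithBot ℕ∞) < ringKrullDim R → Subsingleton ↥(Hmod R R i)

/-- `R` is a generalized Cohen-Macaulay local ring:
`H^i_m(R)` has finite length for all `i < dim R`. -/
def IsGeneralizedCM : Prop :=
  ∀ i : ℕ, (i : WithBot ℕ∞) < ringKrullDim R → IsFiniteLength R ↥(Hmod R R i)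

/-- `R` is a Gorenstein local ring: Cohen-Macaulay of type `r_d(R) = 1`, `d = dim R`. -/
def IsGorensteinLocal : Prop :=
  IsCMLocal R ∧ ∀ d : ℕ, ringKrullDim R = (d : WithBot ℕ∞) → rLength R d = (1 : WithBot ℕ∞)

/-- `R` is unmixed: `dim R̂/p = dim R̂` for every associated prime `p` of the
`m`-adic completion `R̂` of `R`. -/
def IsUnmixedRing : Prop :=
  ∀ p ∈ associatedPrimes (AdicCompletion (maximalIdeal R) R) (AdicCompletion (maximalIdeal R) R),
    ringKrullDim ((AdicCompletion (maximalIdeal R) R) ⧸ p) =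
      ringKrullDim (AdicCompletion (maximalIdeal R) R)

/-- `M` is unmixed: `dim R̂/p = dim M̂` for every associated prime `p` of the
`m`-adic completion `M̂` of `M`, viewed over `R̂`. -/
def IsUnmixedMod (M : Type u) [AddCommGroup M] [Module R M] : Prop :=
  ∀ p ∈ associatedPrimes (AdicCompletion (maximalIdeal R) R) (AdicCompletion (maximalIdeal R) M),
    ringKrullDim ((AdicCompletion (maximalIdeal R) R) ⧸ p) =
      moduleDim (AdicCompletion (maximalIdeal R) R) (AdicCompletion (maximalIdeal R) M)

/-- `H^0_m(M)`, described as the submodule of elements killed by a power of `m`. -/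
def H0Sub (M : Type u) [AddCommGroup M] [Module R M] : Submodule R M :=
  ⨆ n : ℕ, Submodule.torsionBySet R M (((maximalIdeal R) ^ n : Ideal R) : Set R)

/-- The unmixed component `u = U_R(0)` of `R`: the largest ideal of dimension `< dim R`. -/
def unmixedComponent : Ideal R := sSup {J : Ideal R | moduleDim R ↥J < ringKrullDim R}

end Definitions

section CMImage

/-- `R` is a homomorphic image of a Cohen-Macaulay (Noetherian) local ring. -/
def IsHomImageOfCM (R : Type u) [CommRing R] : Prop :=
  ∃ (A : Type u) (_ : CommRing A) (_ : IsLocalRing A) (_ : IsNoetherianRing A),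
    IsCMLocal A ∧ ∃ f : A →+* R, Function.Surjective f

end CMImage

section GInvariant

variable (R : Type u) [CommRing R] [IsLocalRing R] [IsNoetherianRing R]

/-- The canonical homomorphism from `Ext^p(R/q, R)` (the term of the directed system indexed by
the ideal `q` with `J ≤ rad q`) into the local cohomology module `H^p_J(R)`, given by the
structure of `H^p_J(R)` as an inductive limit. -/
def canonicalToLocalCohomology (J q : Ideal R) (h : J ≤ q.radical) (p : ℕ) :
    ((localCohomology.diagram (localCohomology.selfLERadicalDiagram J) p).obj
        (op (⟨q, h⟩ : localCohomology.SelfLERadical J))).obj (ModuleCat.of R R) ⟶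
      (localCohomology J p).obj (ModuleCat.of R R) :=
  haveI := localCohomology.hasColimitDiagram.{u, u} (localCohomology.selfLERadicalDiagram J) p
  (colimit.ι (localCohomology.diagram (localCohomology.selfLERadicalDiagram J) p)
      (op (⟨q, h⟩ : localCohomology.SelfLERadical J))).app (ModuleCat.of R R) ≫
    (localCohomology.isoSelfLERadical J p).hom.app (ModuleCat.of R R)

/-- A map of `R`-modules is surjective on socles. -/
def SurjectiveOnSocles {A B : ModuleCat.{u} R} (φ : A ⟶ B) : Prop :=
  ∀ y ∈ Submodule.torsionBySet R ↥B ((maximalIdeal R : Ideal R) : Set R),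
    ∃ z ∈ Submodule.torsionBySet R ↥A ((maximalIdeal R : Ideal R) : Set R), φ z = y

/-- The defining property of the g-invariant: for every system of parameters `x` of `R`
contained in `m^(n₀)` and every `p`, the canonical homomorphism into the local cohomology
module `H^p_m(R)` is surjective on the socles. -/
def GProperty (n₀ : ℕ) : Prop :=
  ∀ (s : ℕ) (x : Fin s → R), IsSOP R R x → (∀ i, x i ∈ maximalIdeal R ^ n₀) →
    ∀ (h : maximalIdeal R ≤ (Ideal.span (Set.range x)).radical) (p : ℕ),
      SurjectiveOnSocles R
        (canonicalToLocalCohomology R (maximalIdeal R) (Ideal.span (Set.range x)) h p)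

/-- The g-invariant `g(R)`: the least `n₀` satisfying `GProperty`. -/
def gInvariant : ℕ := sInf {n₀ : ℕ | GProperty R n₀}

end GInvariant

end

namespace CParam

set_option linter.unusedSectionVars false
set_option linter.unusedVariables false

section Length

variable {R : Type u} [CommRing R] {M : Type u} [AddCommGroup M] [Module R M]

/-- The length of `(N + K) / K`. -/
noncomputable def rlen (K N : Submodule R M) : ℕ∞ := Module.length R (N.map K.mkQ)

lemma length_eq_ker_add_range {A B : Type*} [AddCommGroup A] [Module R A] [AddCommGroup B]
    [Module R B] (f : A →ₗ[R] B) :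
    Module.length R A = Module.length R (LinearMap.ker f) + Module.length R (LinearMap.range f) :=
  Module.length_eq_add_of_exact (LinearMap.ker f).subtype f.rangeRestrict
    (Submodule.injective_subtype _) f.surjective_rangeRestrict
    (by
      rw [LinearMap.exact_iff, LinearMap.ker_rangeRestrict, Submodule.range_subtype])

lemma length_range_eq_of_ker_eq {A B B' : Type*} [AddCommGroup A] [Module R A] [AddCommGroup B]
    [Module R B] [AddCommGroup B'] [Module R B'] (f : A →ₗ[R] B) (g : A →ₗ[R] B')
    (h : LinearMap.ker f = LinearMap.ker g) :
    Module.length R (LinearMap.range f) = Module.length R (LinearMap.range g) :=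
  (f.quotKerEquivRange.symm.trans
    ((Submodule.quotEquivOfEq _ _ h).trans g.quotKerEquivRange)).length_eq

lemma rlen_eq_range (K N : Submodule R M) :
    rlen K N = Module.length R (LinearMap.range (K.mkQ ∘ₗ N.subtype)) := by
  rw [LinearMap.range_comp, Submodule.range_subtype, rlen]

lemma rlen_mono {K N N' : Submodule R M} (h : N ≤ N') : rlen K N ≤ rlen K N' :=
  Module.length_le_of_injective (Submodule.inclusion (Submodule.map_mono h))
    (Submodule.inclusion_injective _)

lemma rlen_congr {K N K' : Submodule R M} (h : N ⊓ K = N ⊓ K') : rlen K N = rlen K' N := by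
  rw [rlen_eq_range, rlen_eq_range]
  apply length_range_eq_of_ker_eq
  ext ⟨x, hx⟩
  simpa [hx] using SetLike.ext_iff.1 h x

lemma rlen_sup (K N : Submodule R M) : rlen K (K ⊔ N) = rlen K N := by
  unfold rlen
  congr 2 <;> simp [Submodule.map_sup, Submodule.mkQ_map_self]

lemma rlen_top (K : Submodule R M) : rlen K ⊤ = Module.length R (M ⧸ K) := by
  rw [rlen, Submodule.map_top, Submodule.range_mkQ, Module.length_top]

lemma rlen_self (K : Submodule R M) : rlen K K = 0 := by
  rw [rlen, Submodule.mkQ_map_self, Module.length_bot]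

lemma rlen_eq_zero_of_le {K N : Submodule R M} (h : N ≤ K) : rlen K N = 0 := by
  rw [← nonpos_iff_eq_zero, ← rlen_self K]
  exact rlen_mono h

lemma rlen_add {K N P : Submodule R M} (h₁ : K ≤ N) (h₂ : N ≤ P) :
    rlen K P = rlen K N + rlen N P := by
  let f : P.map K.mkQ →ₗ[R] M ⧸ N := (Submodule.factor h₁) ∘ₗ (P.map K.mkQ).subtype
  rw [rlen, length_eq_ker_add_range f]
  congr 1
  · have e : LinearMap.ker f = (N.map K.mkQ).submoduleOf (P.map K.mkQ) := by
      ext ⟨x, hx⟩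
      obtain ⟨y, rfl⟩ := K.mkQ_surjective x
      change (Submodule.Quotient.mk y : M ⧸ N) = 0 ↔ y ∈ (N.map K.mkQ).comap K.mkQ
      rw [Submodule.Quotient.mk_eq_zero, Submodule.comap_map_mkQ, sup_eq_right.2 h₁]
    rw [e]
    exact (Submodule.submoduleOfEquivOfLe (Submodule.map_mono h₂)).length_eq
  · rw [LinearMap.range_comp, Submodule.range_subtype, ← Submodule.map_comp, rlen]
    congr

lemma length_quot_add {K N : Submodule R M} (h : K ≤ N) :
    Module.length R (M ⧸ K) = rlen K N + Module.length R (M ⧸ N) := by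
  rw [← rlen_top, ← rlen_top, rlen_add h le_top]

lemma rlen_le_of_inf_le {K N K' N' : Submodule R M} (hN : N ≤ N') (hK : N ⊓ K' ≤ K) :
    rlen K N ≤ rlen K' N' := by
  calc rlen K N ≤ rlen (K ⊓ K') N := by
        rw [rlen_eq_range, rlen_eq_range]
        refine Module.length_le_of_surjective
          (LinearMap.codRestrict _ ((Submodule.factor (inf_le_left : K ⊓ K' ≤ K)) ∘ₗ
            (LinearMap.range ((K ⊓ K').mkQ ∘ₗ N.subtype)).subtype) ?_) ?_
        · rintro ⟨_, x, rfl⟩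
          exact ⟨x, rfl⟩
        · rintro ⟨_, x, rfl⟩
          exact ⟨⟨_, x, rfl⟩, rfl⟩
    _ = rlen K' N := by
        apply rlen_congr
        apply le_antisymm
        · exact inf_le_inf_left _ inf_le_right
        · exact le_inf inf_le_left (le_inf hK inf_le_right)
    _ ≤ rlen K' N' := rlen_mono hN

end Length

section Colon

variable {R : Type u} [CommRing R]

/-- The colon ideal `𝔞 : x`. -/
def colon (𝔞 : Ideal R) (x : R) : Ideal R := Submodule.comap (LinearMap.mulLeft R x) 𝔞

lemma mem_colon {𝔞 : Ideal R} {x v : R} : v ∈ colon 𝔞 x ↔ x * v ∈ 𝔞 := Iff.rfl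

lemma le_colon (𝔞 : Ideal R) (x : R) : 𝔞 ≤ colon 𝔞 x := fun _ h => 𝔞.mul_mem_left x h

lemma colon_mono {𝔞 𝔟 : Ideal R} (h : 𝔞 ≤ 𝔟) (x : R) : colon 𝔞 x ≤ colon 𝔟 x := fun _ hv => h hv

lemma le_colonIdeal [IsLocalRing R] (𝔞 : Ideal R) : 𝔞 ≤ colonIdeal R 𝔞 :=
  fun _ hv r _ => 𝔞.mul_mem_left r hv

lemma length_quot_colon (𝔟 : Ideal R) (x : R) :
    Module.length R (R ⧸ 𝔟) =
      Module.length R (R ⧸ 𝔟 ⊔ Ideal.span {x}) + Module.length R (R ⧸ colon 𝔟 x) := by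
  rw [length_quot_add (le_sup_left : 𝔟 ≤ 𝔟 ⊔ Ideal.span {x}), rlen_sup, add_comm]
  congr 1
  have h1 : rlen 𝔟 (Ideal.span {x}) =
      Module.length R (LinearMap.range (𝔟.mkQ ∘ₗ LinearMap.mulLeft R x)) := by
    rw [rlen]
    congr 2 <;>
    · rw [LinearMap.range_comp]
      congr 1
      ext y
      simp [Ideal.mem_span_singleton', mul_comm]
  rw [h1]
  have h2 := length_range_eq_of_ker_eq (𝔟.mkQ ∘ₗ LinearMap.mulLeft R x) (colon 𝔟 x).mkQ
    (by rw [LinearMap.ker_comp, Submodule.ker_mkQ, Submodule.ker_mkQ]; rfl)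
  rw [h2, Submodule.range_mkQ, Module.length_top]

end Colon

section Chains

variable {R : Type u} [CommRing R]

/-- Along the list, the colon ideals meet the total ideal only in the partial sums. -/
def WChain (𝔞 : Ideal R) : List R → Prop
  | [] => True
  | x :: l => colon 𝔞 x ⊓ (𝔞 ⊔ Ideal.ofList (x :: l)) ≤ 𝔞 ∧ WChain (𝔞 ⊔ Ideal.span {x}) l

/-- A `WChain` whose entries are decomposable modulo the annihilators of the colon ideals. -/
def Good [IsLocalRing R] (𝔞 : Ideal R) : List R → Prop
  | [] => True
  | x :: l => colon 𝔞 x ⊓ (𝔞 ⊔ Ideal.ofList (x :: l)) ≤ 𝔞 ∧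
      x ∈ maximalIdeal R * Submodule.colon 𝔞 (colon 𝔞 x : Set R) ∧ Good (𝔞 ⊔ Ideal.span {x}) l

lemma Good.wChain [IsLocalRing R] {l : List R} : ∀ {𝔞 : Ideal R}, Good 𝔞 l → WChain 𝔞 l := by
  induction l with
  | nil => intro _ _; trivial
  | cons x l ih => exact fun h => ⟨h.1, ih h.2.2⟩

lemma sup_ofList_cons (𝔞 : Ideal R) (x : R) (l : List R) :
    𝔞 ⊔ Ideal.ofList (x :: l) = 𝔞 ⊔ Ideal.span {x} ⊔ Ideal.ofList l := by
  rw [Ideal.ofList_cons, sup_assoc]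

/-- A relative valuation property of the powers of `Q`. -/
lemma WChain.inf_pow_le {Q : Ideal R} (l : List R) : ∀ {𝔞 𝔭 : Ideal R},
    WChain (𝔞 ⊔ 𝔭) l → Q = 𝔞 ⊔ 𝔭 ⊔ Ideal.ofList l → ∀ n : ℕ,
    (𝔞 ⊔ 𝔭) ⊓ (Q ^ (n + 1) ⊔ 𝔞) ≤ 𝔭 * Q ^ n ⊔ 𝔞 := by
  induction l with
  | nil =>
    intro 𝔞 𝔭 _ hQ n
    have hQ' : Q = 𝔞 ⊔ 𝔭 := by rw [hQ, Ideal.ofList_nil, sup_bot_eq]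
    refine inf_le_right.trans (sup_le ?_ le_sup_right)
    have h : Q ^ (n + 1) = (𝔞 ⊔ 𝔭) * Q ^ n := by rw [pow_succ', ← hQ']
    rw [h, Ideal.sup_mul]
    exact sup_le (Ideal.mul_le_left.trans le_sup_right) le_sup_left
  | cons y l ih =>
    intro 𝔞 𝔭 hW hQ n
    have hyQ : y ∈ Q := by
      rw [hQ]
      exact Ideal.mem_sup_right (Ideal.subset_span (by simp))
    have key := ih (𝔞 := 𝔞) (𝔭 := 𝔭 ⊔ Ideal.span {y}) (by rw [← sup_assoc]; exact hW.2)
      (by rw [hQ, sup_ofList_cons, sup_assoc 𝔞])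
    induction n with
    | zero =>
      simp only [pow_zero, mul_one]
      exact inf_le_left.trans (by rw [sup_comm])
    | succ n ihn =>
      rintro v ⟨hv1, hv2⟩
      have h3 := key (n + 1) ⟨(sup_le_sup_left le_sup_left 𝔞) hv1, hv2⟩
      rw [Ideal.sup_mul, sup_assoc] at h3
      obtain ⟨p', hp', w, hw, rfl⟩ := Submodule.mem_sup.1 h3
      obtain ⟨u, hu, α, hα, rfl⟩ := Submodule.mem_sup.1 hw
      obtain ⟨c, hc, rfl⟩ := Ideal.mem_span_singleton_mul.1 hu
      have hcQ : c ∈ Q := Ideal.pow_le_self (Nat.succ_ne_zero n) hc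
      have hc1 : c ∈ 𝔞 ⊔ 𝔭 := by
        apply hW.1
        refine ⟨?_, by rw [← hQ]; exact hcQ⟩
        rw [SetLike.mem_coe, mem_colon]
        have : y * c = p' + (y * c + α) - p' - α := by ring
        rw [this]
        exact sub_mem (sub_mem hv1 (Ideal.mem_sup_right (Ideal.mul_le_left hp')))
          (Ideal.mem_sup_left hα)
      have hc2 := ihn ⟨hc1, Ideal.mem_sup_left hc⟩
      obtain ⟨g, hg, β, hβ, rfl⟩ := Submodule.mem_sup.1 hc2
      refine add_mem (Ideal.mem_sup_left hp') (add_mem ?_ (Ideal.mem_sup_right hα))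
      rw [mul_add]
      refine add_mem (Ideal.mem_sup_left ?_) (Ideal.mem_sup_right (𝔞.mul_mem_left _ hβ))
      rw [pow_succ, ← mul_assoc, mul_comm y g]
      exact Ideal.mul_mem_mul hg hyQ

lemma WChain.mem_pow_sup_colon {Q : Ideal R} {𝔞 : Ideal R} {x : R} {l : List R}
    (hW : WChain 𝔞 (x :: l)) (hQ : Q = 𝔞 ⊔ Ideal.ofList (x :: l)) {n : ℕ} {a : R}
    (ha : x * a ∈ Q ^ (n + 1) ⊔ 𝔞) : a ∈ Q ^ n ⊔ colon 𝔞 x := by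
  have h := WChain.inf_pow_le l hW.2 (by rw [hQ, sup_ofList_cons]) n
    ⟨Ideal.mem_sup_right (Ideal.mul_mem_right _ _ (Ideal.mem_span_singleton_self x)), ha⟩
  obtain ⟨u, hu, α, hα, h⟩ := Submodule.mem_sup.1 h
  obtain ⟨c, hc, rfl⟩ := Ideal.mem_span_singleton_mul.1 hu
  have : a = c + (a - c) := by ring
  rw [this]
  refine add_mem (Ideal.mem_sup_left hc) (Ideal.mem_sup_right ?_)
  rw [mem_colon, mul_sub, ← h]
  simpa using hα

lemma pow_succ_eq_pow_mul_of_mul_self {Q I : Ideal R} (h : I * I = Q * I) (n : ℕ) :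
    I ^ (n + 1) = Q ^ n * I := by
  induction n with
  | zero => simp
  | succ n ih => rw [pow_succ, ih, mul_assoc, h, ← mul_assoc, ← pow_succ]

variable [IsLocalRing R]

lemma exists_lift_of_decomposable {𝔞 T : Ideal R} {x h : R} (hT : colon 𝔞 x ⊓ T ≤ 𝔞) (hxT : x ∈ T)
    (hx : x ∈ maximalIdeal R * Submodule.colon 𝔞 (colon 𝔞 x : Set R))
    (hh : ∀ y ∈ maximalIdeal R, y * h ∈ Ideal.span {x} ⊔ colon 𝔞 x) :
    ∃ g, (∀ y ∈ maximalIdeal R, y * g ∈ 𝔞 ⊔ Ideal.span {x}) ∧ h - g ∈ colon 𝔞 x := by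
  have hL : ∀ y : maximalIdeal R, ∃ L, y * h - x * L ∈ colon 𝔞 x := by
    rintro ⟨y, hy⟩
    obtain ⟨u, hu, η, hη, e⟩ := Submodule.mem_sup.1 (hh y hy)
    obtain ⟨L, rfl⟩ := Ideal.mem_span_singleton'.1 hu
    exact ⟨L, by simpa [← e, mul_comm] using hη⟩
  choose L hL using hL
  have hcol : ∀ {t}, x * t ∈ colon 𝔞 x → t ∈ colon 𝔞 x := fun {t} ht =>
    mem_colon.2 (hT ⟨ht, T.mul_mem_right _ hxT⟩)
  have main : ∀ w ∈ maximalIdeal R * Submodule.colon 𝔞 (colon 𝔞 x : Set R),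
      ∃ g, w * h - x * g ∈ 𝔞 ∧ ∀ y : maximalIdeal R, y * g - w * L y ∈ 𝔞 := by
    intro w hw
    refine Submodule.mul_induction_on hw ?_ ?_
    · intro y hy z hz
      have hz' : ∀ t ∈ colon 𝔞 x, z * t ∈ 𝔞 := fun t ht => Submodule.mem_colon.1 hz t ht
      refine ⟨z * L ⟨y, hy⟩, ?_, ?_⟩
      · have := hz' _ (hL ⟨y, hy⟩)
        convert this using 1
        simp only
        ring
      · rintro ⟨y', hy'⟩
        have h1 : y' * L ⟨y, hy⟩ - y * L ⟨y', hy'⟩ ∈ colon 𝔞 x := by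
          apply hcol
          have e : x * (y' * L ⟨y, hy⟩ - y * L ⟨y', hy'⟩) =
              y * (y' * h - x * L ⟨y', hy'⟩) - y' * (y * h - x * L ⟨y, hy⟩) := by ring
          rw [e]
          exact sub_mem (Ideal.mul_mem_left _ _ (hL ⟨y', hy'⟩))
            (Ideal.mul_mem_left _ _ (hL ⟨y, hy⟩))
        have := hz' _ h1
        convert this using 1
        simp only
        ring
    · rintro w w' ⟨g, hg1, hg2⟩ ⟨g', hg1', hg2'⟩
      refine ⟨g + g', ?_, fun y => ?_⟩
      · have := add_mem hg1 hg1'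
        convert this using 1
        ring
      · have := add_mem (hg2 y) (hg2' y)
        convert this using 1
        ring
  obtain ⟨g, hg1, hg2⟩ := main x hx
  refine ⟨g, fun y hy => ?_, ?_⟩
  · have := hg2 ⟨y, hy⟩
    have e : y * g = (y * g - x * L ⟨y, hy⟩) + x * L ⟨y, hy⟩ := by ring
    rw [e]
    exact add_mem (Ideal.mem_sup_left this)
      (Ideal.mem_sup_right (Ideal.mul_mem_right _ _ (Ideal.mem_span_singleton_self x)))
  · rw [mem_colon, mul_sub]
    exact hg1

lemma Good.mem_colonIdeal_sup {Q : Ideal R} (l : List R) : ∀ {𝔞 : Ideal R} {x : R},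
    Good 𝔞 (x :: l) → Q = 𝔞 ⊔ Ideal.ofList (x :: l) → ∀ c,
    (∀ y ∈ maximalIdeal R, y * c ∈ Q ⊔ colon 𝔞 x) → c ∈ colonIdeal R Q ⊔ colon 𝔞 x := by
  have direct : ∀ {l : List R} {𝔞 : Ideal R} {x : R}, Good 𝔞 (x :: l) →
      Q = 𝔞 ⊔ Ideal.ofList (x :: l) → ∀ h,
      (∀ y ∈ maximalIdeal R, y * h ∈ Ideal.span {x} ⊔ colon 𝔞 x) →
      h ∈ colonIdeal R Q ⊔ colon 𝔞 x := by
    intro l 𝔞 x hG hQ h hh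
    obtain ⟨g, hg1, hg2⟩ := exists_lift_of_decomposable hG.1
      (Ideal.mem_sup_right (Ideal.subset_span (by simp))) hG.2.1 hh
    have : h = g + (h - g) := by ring
    rw [this]
    refine add_mem (Ideal.mem_sup_left (fun y hy => ?_)) (Ideal.mem_sup_right hg2)
    rw [hQ, sup_ofList_cons]
    exact Ideal.mem_sup_left (hg1 y hy)
  induction l with
  | nil =>
    intro 𝔞 x hG hQ c hc
    refine direct hG hQ c fun y hy => ?_
    have := hc y hy
    rw [hQ] at this
    simp only [Ideal.ofList_singleton] at this
    rwa [sup_comm 𝔞, sup_assoc, sup_eq_right.2 (le_colon 𝔞 x)] at this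
  | cons x₂ l ih =>
    intro 𝔞 x hG hQ c hc
    have hxQ : ∀ t ∈ x :: x₂ :: l, t ∈ Q := fun t ht => by
      rw [hQ]
      exact Ideal.mem_sup_right (Ideal.subset_span ht)
    have hle : colon 𝔞 x ≤ colon (𝔞 ⊔ Ideal.span {x}) x₂ := by
      intro h hh
      refine Ideal.mem_sup_left (hG.1 ⟨Ideal.mul_mem_left _ _ hh, ?_⟩)
      rw [← hQ]
      exact Q.mul_mem_right _ (hxQ x₂ (by simp))
    have hQ' : Q = 𝔞 ⊔ Ideal.span {x} ⊔ Ideal.ofList (x₂ :: l) := by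
      rw [hQ, sup_ofList_cons]
    have h1 := ih hG.2.2 hQ' c fun y hy => (sup_le_sup_left hle Q) (hc y hy)
    obtain ⟨u, hu, h, hh, rfl⟩ := Submodule.mem_sup.1 h1
    refine add_mem (Ideal.mem_sup_left hu) (direct hG hQ h fun y hy => ?_)
    have h2 := hc y hy
    rw [mul_add] at h2
    have h3 : y * h ∈ Q ⊔ colon 𝔞 x := by
      have := sub_mem h2 (Ideal.mem_sup_left (hu y hy) : y * u ∈ Q ⊔ colon 𝔞 x)
      simpa using this
    obtain ⟨q, hq, η, hη, e⟩ := Submodule.mem_sup.1 h3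
    have hq2 : q ∈ 𝔞 ⊔ Ideal.span {x} := by
      refine hG.2.2.1 ⟨?_, by rw [← hQ']; exact hq⟩
      have : q = y * h - η := by rw [← e]; ring
      rw [this]
      exact sub_mem (Ideal.mul_mem_left _ _ hh) (hle hη)
    rw [← e]
    refine add_mem ?_ (Ideal.mem_sup_right hη)
    exact (sup_le (le_sup_of_le_right (le_colon 𝔞 x)) le_sup_left :
      𝔞 ⊔ Ideal.span {x} ≤ Ideal.span {x} ⊔ colon 𝔞 x) hq2

lemma Good.mem_pow_mul_colonIdeal_sup {Q : Ideal R} (hQm : Q ≤ maximalIdeal R) (l : List R) :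
    ∀ {𝔞 : Ideal R} {x : R}, Good 𝔞 (x :: l) → Q = 𝔞 ⊔ Ideal.ofList (x :: l) → ∀ (n : ℕ) (a : R),
    (∀ y ∈ maximalIdeal R, y * a ∈ Q ^ (n + 1) ⊔ colon 𝔞 x) →
    a ∈ Q ^ n * colonIdeal R Q ⊔ colon 𝔞 x := by
  have common : ∀ {l : List R} {𝔞 : Ideal R} {x : R}, Good 𝔞 (x :: l) →
      Q = 𝔞 ⊔ Ideal.ofList (x :: l) →
      (∀ (n : ℕ) (a : R), a ∈ Q ^ (n + 1) → (∀ y ∈ maximalIdeal R, y * a ∈ Q ^ (n + 1 + 1) ⊔ 𝔞) →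
        a ∈ Q ^ (n + 1) * colonIdeal R Q ⊔ (𝔞 ⊔ Ideal.span {x})) →
      ∀ (n : ℕ) (a : R), (∀ y ∈ maximalIdeal R, y * a ∈ Q ^ (n + 1) ⊔ colon 𝔞 x) →
        a ∈ Q ^ n * colonIdeal R Q ⊔ colon 𝔞 x := by
    intro l 𝔞 x hG hQ hred n
    have hxQ : x ∈ Q := by
      rw [hQ]
      exact Ideal.mem_sup_right (Ideal.subset_span (by simp))
    have hQH : ∀ t ∈ Q, t ∈ colon 𝔞 x → t ∈ 𝔞 := fun t ht hx => hG.1 ⟨hx, by rw [← hQ]; exact ht⟩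
    induction n with
    | zero =>
      intro a ha
      simpa using hG.mem_colonIdeal_sup l hQ a (by simpa using ha)
    | succ n ihn =>
      intro a ha
      have aux : ∀ t ∈ Q, t ∈ Q ^ (n + 1 + 1) ⊔ colon 𝔞 x → t ∈ Q ^ (n + 1 + 1) ⊔ 𝔞 := by
        intro t htQ ht
        obtain ⟨q, hq, η, hη, rfl⟩ := Submodule.mem_sup.1 ht
        refine add_mem (Ideal.mem_sup_left hq) (Ideal.mem_sup_right (hQH η ?_ hη))
        have : η = q + η - q := by ring
        rw [this]
        exact sub_mem htQ (Ideal.pow_le_self (Nat.succ_ne_zero _) hq)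
      have h1 : a ∈ Q ^ (n + 1) ⊔ colon 𝔞 x :=
        hG.wChain.mem_pow_sup_colon hQ (aux _ (Q.mul_mem_right _ hxQ) (ha x (hQm hxQ)))
      obtain ⟨a', ha', η, hη, rfl⟩ := Submodule.mem_sup.1 h1
      refine add_mem ?_ (Ideal.mem_sup_right hη)
      have ha'Q : a' ∈ Q := Ideal.pow_le_self (Nat.succ_ne_zero _) ha'
      have h2 : ∀ y ∈ maximalIdeal R, y * a' ∈ Q ^ (n + 1 + 1) ⊔ 𝔞 := by
        intro y hy
        refine aux _ (Q.mul_mem_left _ ha'Q) ?_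
        have : y * a' = y * (a' + η) - y * η := by ring
        rw [this]
        exact sub_mem (ha y hy) (Ideal.mem_sup_right (Ideal.mul_mem_left _ _ hη))
      obtain ⟨u, hu, v, hv, e⟩ := Submodule.mem_sup.1 (hred n a' ha' h2)
      obtain ⟨α, hα, w, hw, rfl⟩ := Submodule.mem_sup.1 hv
      obtain ⟨c, rfl⟩ := Ideal.mem_span_singleton'.1 hw
      rw [mul_comm c x] at e
      have h3 : c ∈ Q ^ n * colonIdeal R Q ⊔ colon 𝔞 x := by
        refine ihn c fun y hy => hG.wChain.mem_pow_sup_colon hQ ?_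
        have : x * (y * c) = y * a' - y * u - y * α := by rw [← e]; ring
        rw [this]
        refine sub_mem (sub_mem (h2 y hy) (Ideal.mem_sup_left ?_))
          (Ideal.mem_sup_right (𝔞.mul_mem_left _ hα))
        have : Q ^ (n + 1) * colonIdeal R Q ≤ colonIdeal R (Q ^ (n + 1 + 1)) := by
          rw [Ideal.mul_le]
          intro r hr s hs y hy
          rw [pow_succ, smul_eq_mul, mul_left_comm]
          exact Ideal.mul_mem_mul hr (hs y hy)
        exact this hu y hy
      obtain ⟨c', hc', η', hη', rfl⟩ := Submodule.mem_sup.1 h3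
      rw [← e]
      refine add_mem (Ideal.mem_sup_left hu) (add_mem (Ideal.mem_sup_right (le_colon _ _ hα)) ?_)
      rw [mul_add]
      refine add_mem (Ideal.mem_sup_left ?_) (Ideal.mem_sup_right (le_colon _ _ hη'))
      rw [pow_succ', mul_assoc]
      exact Ideal.mul_mem_mul hxQ hc'
  induction l with
  | nil =>
    intro 𝔞 x hG hQ
    refine common hG hQ fun n a ha _ => Ideal.mem_sup_right ?_
    rw [Ideal.ofList_singleton] at hQ
    rw [← hQ]
    exact Ideal.pow_le_self (Nat.succ_ne_zero _) ha
  | cons x₂ l ih =>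
    intro 𝔞 x hG hQ
    refine common hG hQ fun n a ha hya => ?_
    have hQ' : Q = 𝔞 ⊔ Ideal.span {x} ⊔ Ideal.ofList (x₂ :: l) := by
      rw [hQ, sup_ofList_cons]
    have h1 := ih hG.2.2 hQ' (n + 1) a fun y hy =>
      (sup_le_sup_left (le_sup_left.trans (le_colon (𝔞 ⊔ Ideal.span {x}) x₂)) (Q ^ (n + 1 + 1)) :
        Q ^ (n + 1 + 1) ⊔ 𝔞 ≤ Q ^ (n + 1 + 1) ⊔ colon (𝔞 ⊔ Ideal.span {x}) x₂) (hya y hy)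
    obtain ⟨u, hu, h, hh, rfl⟩ := Submodule.mem_sup.1 h1
    refine add_mem (Ideal.mem_sup_left hu) (Ideal.mem_sup_right (hG.2.2.1 ⟨hh, ?_⟩))
    rw [← hQ']
    have : h = u + h - u := by ring
    rw [this]
    refine sub_mem (Ideal.pow_le_self (Nat.succ_ne_zero _) ha)
      (Ideal.pow_le_self (Nat.succ_ne_zero n) (Ideal.mul_le_left hu))

/-- If `I = Q : 𝔪` satisfies `𝔪 I ⊆ 𝔪 Q`, then `I ^ 2 = Q I`. -/
lemma Good.colonIdeal_mul_self {Q : Ideal R} (hQm : Q ≤ maximalIdeal R) {l : List R} {x : R}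
    (hG : Good ⊥ (x :: l)) (hQ : Q = Ideal.ofList (x :: l)) (hI : colonIdeal R Q ≤ maximalIdeal R)
    (hmI : maximalIdeal R * colonIdeal R Q ≤ maximalIdeal R * Q) :
    colonIdeal R Q * colonIdeal R Q = Q * colonIdeal R Q := by
  refine le_antisymm ?_ (Ideal.mul_mono_left (le_colonIdeal Q))
  rw [Ideal.mul_le]
  intro a ha b hb
  have hQ' : Q = ⊥ ⊔ Ideal.ofList (x :: l) := by rw [bot_sup_eq, hQ]
  have h1 : a * b ∈ Q ^ 1 * colonIdeal R Q ⊔ colon ⊥ x := by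
    refine hG.mem_pow_mul_colonIdeal_sup hQm l hQ' 1 _ fun y hy => Ideal.mem_sup_left ?_
    rw [← mul_assoc, pow_succ, pow_one]
    have : y * a ∈ Q * maximalIdeal R := by
      rw [mul_comm Q]
      exact hmI (Ideal.mul_mem_mul hy ha)
    have h := Ideal.mul_mem_mul this hb
    refine (?_ : Q * maximalIdeal R * colonIdeal R Q ≤ Q * Q) h
    rw [mul_assoc]
    refine Ideal.mul_mono_right ?_
    rw [Ideal.mul_le]
    exact fun r hr s hs => hs r hr
  obtain ⟨u, hu, h, hh, e⟩ := Submodule.mem_sup.1 h1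
  rw [pow_one] at hu
  have h0 : h ∈ (⊥ : Ideal R) := by
    refine hG.1 ⟨hh, ?_⟩
    rw [← hQ']
    have : h = a * b - u := by rw [← e]; ring
    rw [this]
    exact sub_mem (hb a (hI ha)) (Ideal.mul_le_left hu)
  rw [Ideal.mem_bot] at h0
  rw [← e, h0, add_zero]
  exact hu

lemma Good.colon_pow_colonIdeal {Q : Ideal R} (hQm : Q ≤ maximalIdeal R) {𝔞 : Ideal R} {x : R}
    {l : List R} (hG : Good 𝔞 (x :: l)) (hQ : Q = 𝔞 ⊔ Ideal.ofList (x :: l))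
    (hI : colonIdeal R Q * colonIdeal R Q = Q * colonIdeal R Q) (n : ℕ) :
    colon (colonIdeal R Q ^ (n + 2) ⊔ 𝔞) x = colonIdeal R Q ^ (n + 1) ⊔ colon 𝔞 x := by
  have hxQ : x ∈ Q := by
    rw [hQ]
    exact Ideal.mem_sup_right (Ideal.subset_span (by simp))
  apply le_antisymm
  · intro a ha
    rw [pow_succ_eq_pow_mul_of_mul_self hI]
    refine hG.mem_pow_mul_colonIdeal_sup hQm l hQ n a fun y hy =>
      hG.wChain.mem_pow_sup_colon hQ ?_
    rw [mul_left_comm]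
    obtain ⟨u, hu, α, hα, e⟩ := Submodule.mem_sup.1 (mem_colon.1 ha)
    rw [← e, mul_add]
    refine add_mem (Ideal.mem_sup_left ?_) (Ideal.mem_sup_right (𝔞.mul_mem_left _ hα))
    rw [pow_succ_eq_pow_mul_of_mul_self hI] at hu
    have : Q ^ (n + 1) * colonIdeal R Q ≤ colonIdeal R (Q ^ (n + 1 + 1)) := by
      rw [Ideal.mul_le]
      intro r hr s hs y hy
      rw [pow_succ, smul_eq_mul, mul_left_comm]
      exact Ideal.mul_mem_mul hr (hs y hy)
    exact this hu y hy
  · refine sup_le ?_ (colon_mono le_sup_right x)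
    intro a ha
    rw [mem_colon]
    refine Ideal.mem_sup_left ?_
    rw [pow_succ']
    exact Ideal.mul_mem_mul (le_colonIdeal Q hxQ) ha

end Chains

section BinomialSums

/-- The integer-valued polynomial with coefficients `c` in the binomial basis. -/
def binSum (c : ℕ → ℤ) (d n : ℕ) : ℤ :=
  ∑ i ∈ Finset.range (d + 1), c i * ((n + d - i).choose (d - i) : ℤ)

lemma binSum_zero (c : ℕ → ℤ) (d : ℕ) : binSum c d 0 = ∑ i ∈ Finset.range (d + 1), c i := by
  refine Finset.sum_congr rfl fun i _ => ?_
  simp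

lemma binSum_succ_succ (c : ℕ → ℤ) (d n : ℕ) :
    binSum c (d + 1) (n + 1) = binSum c (d + 1) n + binSum c d (n + 1) := by
  unfold binSum
  rw [Finset.sum_range_succ, Finset.sum_range_succ _ (d + 1)]
  simp only [Nat.sub_self, Nat.choose_zero_right]
  rw [add_right_comm (Finset.sum _ _) (c (d + 1) * _), ← Finset.sum_add_distrib]
  congr 1
  refine Finset.sum_congr rfl fun i hi => ?_
  have hi : i ≤ d := Nat.lt_succ_iff.1 (Finset.mem_range.1 hi)
  have h1 : d + 1 - i = (d - i) + 1 := by omega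
  have h2 : n + 1 + (d + 1) - i = (n + 1 + d - i) + 1 := by omega
  have h3 : n + (d + 1) - i = n + 1 + d - i := by omega
  rw [h1, h2, h3, Nat.choose_succ_succ]
  push_cast
  ring

lemma binSum_congr {c c' : ℕ → ℤ} {d : ℕ} (h : ∀ i ≤ d, c i = c' i) (n : ℕ) :
    binSum c d n = binSum c' d n := by
  refine Finset.sum_congr rfl fun i hi => ?_
  rw [h i (Nat.lt_succ_iff.1 (Finset.mem_range.1 hi))]

lemma binSum_unique (d : ℕ) : ∀ {c c' : ℕ → ℤ} {N : ℕ},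
    (∀ n ≥ N, binSum c d n = binSum c' d n) → ∀ i ≤ d, c i = c' i := by
  induction d with
  | zero =>
    intro c c' N h i hi
    obtain rfl : i = 0 := by omega
    simpa [binSum] using h N le_rfl
  | succ d ih =>
    intro c c' N h i hi
    have h1 : ∀ i ≤ d, c i = c' i := ih (N := N + 1) fun n hn => by
      obtain ⟨n, rfl⟩ : ∃ m, n = m + 1 := ⟨n - 1, by omega⟩
      have h1 := h (n + 1) (by omega)
      rw [binSum_succ_succ, binSum_succ_succ, h n (by omega)] at h1
      exact add_left_cancel h1
    rcases Nat.lt_or_eq_of_le hi with h2 | rfl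
    · exact h1 i (by omega)
    · have h2 := h N le_rfl
      unfold binSum at h2
      rw [Finset.sum_range_succ, Finset.sum_range_succ _ (d + 1)] at h2
      have h3 := binSum_congr (n := N + 1) h1
      have h4 : ∀ c : ℕ → ℤ, ∑ i ∈ Finset.range (d + 1),
          c i * ((N + (d + 1) - i).choose (d + 1 - i) : ℤ) =
          ∑ i ∈ Finset.range (d + 1), c i * ((N + (d + 1) - i).choose (d + 1 - i) : ℤ) :=
        fun _ => rfl
      have h5 : ∑ i ∈ Finset.range (d + 1), c i * ((N + (d + 1) - i).choose (d + 1 - i) : ℤ) =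
          ∑ i ∈ Finset.range (d + 1), c' i * ((N + (d + 1) - i).choose (d + 1 - i) : ℤ) :=
        Finset.sum_congr rfl fun i hi => by
          rw [h1 i (Nat.lt_succ_iff.1 (Finset.mem_range.1 hi))]
      rw [h5] at h2
      simpa using add_left_cancel h2

end BinomialSums

section HilbertChain

variable {R : Type u} [CommRing R]

/-- The colon ideals along the list behave well with respect to the powers of `I`, and have
length at most `C`. -/
def HilbChain (I : Ideal R) (C : ℕ) (𝔞 : Ideal R) : List R → Prop
  | [] => True
  | x :: l => (∀ n : ℕ, colon (I ^ (n + 2) ⊔ 𝔞) x = I ^ (n + 1) ⊔ colon 𝔞 x) ∧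
      colon 𝔞 x ⊓ (I ^ 2 ⊔ 𝔞) ≤ 𝔞 ∧ rlen 𝔞 (colon 𝔞 x) ≤ C ∧ HilbChain I C (𝔞 ⊔ Ideal.span {x}) l

lemma natCast_of_le {a : ℕ∞} {C : ℕ} (h : a ≤ C) : ∃ n : ℕ, n ≤ C ∧ a = n := by
  lift a to ℕ using ne_top_of_le_ne_top (ENat.natCast_ne_top C) h
  exact ⟨a, by exact_mod_cast h, rfl⟩

/-- One step of the recursion for the Hilbert function. -/
lemma hilbChain_step {I : Ideal R} {𝔞 : Ideal R} {x : R} {h L₀ d C : ℕ} {c' : ℕ → ℤ} (hC : h ≤ C)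
    (h1 : ∀ n : ℕ, colon (I ^ (n + 2) ⊔ 𝔞) x = I ^ (n + 1) ⊔ colon 𝔞 x)
    (h2 : colon 𝔞 x ⊓ (I ^ 2 ⊔ 𝔞) ≤ 𝔞) (hh : rlen 𝔞 (colon 𝔞 x) = h) (h𝔞 : 𝔞 ≤ I)
    (hL₀ : Module.length R (R ⧸ I) = L₀)
    (hf : ∀ n : ℕ, ∃ L : ℕ, Module.length R (R ⧸ (I ^ (n + 2) ⊔ (𝔞 ⊔ Ideal.span {x}))) = L ∧
      (L : ℤ) = binSum c' d (n + 1)) :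
    ∃ s : ℕ, s ≤ C ∧ ∀ c : ℕ → ℤ, (∀ i < d, c i = c' i) → c d = c' d - h →
      c (d + 1) = L₀ + s - ∑ i ∈ Finset.range (d + 1), c i →
      ∀ n : ℕ, ∃ L : ℕ, Module.length R (R ⧸ (I ^ (n + 2) ⊔ 𝔞)) = L ∧
        (L : ℤ) = binSum c (d + 1) (n + 1) := by
  have hstep : ∀ n : ℕ, Module.length R (R ⧸ (I ^ (n + 2) ⊔ 𝔞)) =
      Module.length R (R ⧸ (I ^ (n + 2) ⊔ (𝔞 ⊔ Ideal.span {x}))) +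
        Module.length R (R ⧸ (I ^ (n + 1) ⊔ colon 𝔞 x)) := by
    intro n
    rw [length_quot_colon (I ^ (n + 2) ⊔ 𝔞) x, h1, sup_assoc]
  have hq : ∀ n : ℕ, Module.length R (R ⧸ (I ^ (n + 1) ⊔ 𝔞)) =
      rlen (I ^ (n + 1) ⊔ 𝔞) (colon 𝔞 x) + Module.length R (R ⧸ (I ^ (n + 1) ⊔ colon 𝔞 x)) := by
    intro n
    have := length_quot_add (K := I ^ (n + 1) ⊔ 𝔞) (N := I ^ (n + 1) ⊔ colon 𝔞 x)
      (sup_le_sup_left (le_colon 𝔞 x) _)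
    rw [this]
    congr 1
    rw [← rlen_sup (I ^ (n + 1) ⊔ 𝔞) (colon 𝔞 x), sup_assoc, sup_eq_right.2 (le_colon 𝔞 x)]
  have hr : ∀ n : ℕ, rlen (I ^ (n + 2) ⊔ 𝔞) (colon 𝔞 x) = h := by
    intro n
    rw [← hh]
    refine rlen_congr (le_antisymm ?_ ?_)
    · refine le_inf inf_le_left (le_trans ?_ h2)
      exact inf_le_inf_left _ (sup_le_sup_right (Ideal.pow_le_pow_right (by omega)) _)
    · exact inf_le_inf_left _ le_sup_right
  obtain ⟨t, ht, hte⟩ := natCast_of_le (C := h) (a := rlen (I ^ (0 + 1) ⊔ 𝔞) (colon 𝔞 x)) (by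
    rw [← hh]
    exact rlen_le_of_inf_le le_rfl (inf_le_right.trans le_sup_right))
  refine ⟨h - t, by omega, fun c hc1 hc2 hc3 => ?_⟩
  have key : ∀ n, binSum c (d + 1) (n + 1) = binSum c (d + 1) n + (binSum c' d (n + 1) - h) := by
    intro n
    rw [binSum_succ_succ]
    congr 1
    unfold binSum
    rw [Finset.sum_range_succ, Finset.sum_range_succ _ d, hc2]
    have : ∑ i ∈ Finset.range d, c i * ((n + 1 + d - i).choose (d - i) : ℤ) =
        ∑ i ∈ Finset.range d, c' i * ((n + 1 + d - i).choose (d - i) : ℤ) :=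
      Finset.sum_congr rfl fun i hi => by rw [hc1 i (Finset.mem_range.1 hi)]
    rw [this]
    simp only [Nat.sub_self, Nat.choose_zero_right]
    push_cast
    ring
  have hI : I ^ (0 + 1) ⊔ 𝔞 = I := by simpa using h𝔞
  have h00 : binSum c (d + 1) 0 = L₀ + (h - t : ℕ) := by
    rw [binSum_zero, Finset.sum_range_succ, hc3]
    ring
  intro n
  induction n with
  | zero =>
    obtain ⟨L', hL', hL'e⟩ := hf 0
    have e1 := hq 0
    have hte' := hte
    rw [hI] at hte'
    rw [hI, hL₀, hte'] at e1
    obtain ⟨q, hq1, hq2⟩ := natCast_of_le (C := L₀)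
      (a := Module.length R (R ⧸ (I ^ (0 + 1) ⊔ colon 𝔞 x))) (by rw [e1]; exact le_add_self)
    refine ⟨L' + q, ?_, ?_⟩
    · rw [hstep, hL', hq2]; push_cast; rfl
    · rw [key, h00, ← hL'e]
      rw [hq2] at e1
      have e1 : L₀ = t + q := by exact_mod_cast e1
      push_cast [ht]
      omega
  | succ n ih =>
    obtain ⟨L', hL', hL'e⟩ := hf (n + 1)
    obtain ⟨L, hL, hLe⟩ := ih
    have e1 := hq (n + 1)
    rw [hL, hr n] at e1
    obtain ⟨q, hq1, hq2⟩ := natCast_of_le (C := L)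
      (a := Module.length R (R ⧸ (I ^ (n + 1 + 1) ⊔ colon 𝔞 x))) (by rw [e1]; exact le_add_self)
    refine ⟨L' + q, ?_, ?_⟩
    · rw [hstep, hL', hq2]; push_cast; rfl
    · rw [key, ← hLe, ← hL'e]
      rw [hq2] at e1
      have e1 : L = h + q := by exact_mod_cast e1
      push_cast
      omega

lemma hilbChain_binSum {I Q : Ideal R} {C L₀ LQ b : ℕ} (hIQ : I ^ 2 ≤ Q) (hQI : Q ≤ I)
    (hL₀ : Module.length R (R ⧸ I) = L₀) (hLQ : Module.length R (R ⧸ Q) = LQ) (hb : LQ = L₀ + b)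
    (l : List R) : ∀ {𝔞 : Ideal R} {x : R}, HilbChain I C 𝔞 (l ++ [x]) →
    Q = 𝔞 ⊔ Ideal.ofList (l ++ [x]) →
    ∃ (c : ℕ → ℤ) (h s : ℕ), rlen (𝔞 ⊔ Ideal.ofList l) (colon (𝔞 ⊔ Ideal.ofList l) x) = h ∧
      s ≤ C ∧ c 0 = LQ - h ∧ ∑ i ∈ Finset.range (l.length + 2), c i = L₀ + s ∧
      (∀ i, 1 ≤ i → i ≤ l.length → |c i| ≤ 3 * C + b) ∧ |c (l.length + 1)| ≤ 2 * C + b ∧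
      ∀ n : ℕ, ∃ L : ℕ, Module.length R (R ⧸ (I ^ (n + 2) ⊔ 𝔞)) = L ∧
        (L : ℤ) = binSum c (l.length + 1) (n + 1) := by
  induction l with
  | nil =>
    intro 𝔞 x hc hQ
    obtain ⟨h1, h2, h3, -⟩ := hc
    obtain ⟨h, hhC, hh⟩ := natCast_of_le h3
    have hQ' : Q = 𝔞 ⊔ Ideal.span {x} := by simpa using hQ
    have h𝔞 : 𝔞 ≤ I := le_trans (by rw [hQ']; exact le_sup_left) hQI
    obtain ⟨s, hs, hmain⟩ := hilbChain_step (d := 0) (c' := fun _ => LQ) hhC h1 h2 hh h𝔞 hL₀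
      (fun n => ⟨LQ, by
        rw [← hQ', sup_eq_right.2 ((Ideal.pow_le_pow_right (by omega)).trans hIQ), hLQ],
        by simp [binSum]⟩)
    refine ⟨fun i => if i = 0 then LQ - h else L₀ + s - (LQ - h), h, s, by simpa using hh, hs,
      by simp, ?_, ?_, ?_, ?_⟩
    · simp [Finset.sum_range_succ]
    · intro i hi hi'
      simp at hi'
      omega
    · simp only [List.length_nil]
      rw [if_neg (by omega), abs_le]
      constructor <;> omega
    · refine hmain _ (fun i hi => by omega) (by simp) (by simp)
  | cons y l ih =>
    intro 𝔞 x hc hQ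
    obtain ⟨h1, h2, h3, h4⟩ := hc
    obtain ⟨h, hhC, hh⟩ := natCast_of_le h3
    have hQ' : Q = 𝔞 ⊔ Ideal.span {y} ⊔ Ideal.ofList (l ++ [x]) := by
      rw [hQ, List.cons_append, sup_ofList_cons]
    have h𝔞 : 𝔞 ≤ I := le_trans (by rw [hQ]; exact le_sup_left) hQI
    obtain ⟨c', h', s', hh', hs', hc0, hsum, hbd, hbd', hf⟩ := ih h4 hQ'
    obtain ⟨s, hs, hmain⟩ := hilbChain_step hhC h1 h2 hh h𝔞 hL₀ hf
    have e0 : ∀ i < l.length + 1, (fun i => if i < l.length + 1 then c' i else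
        if i = l.length + 1 then c' i - h else s - s' + h) i = c' i := by
      intro i hi
      simp only [if_pos hi]
    refine ⟨fun i => if i < l.length + 1 then c' i else
        if i = l.length + 1 then c' i - h else s - s' + h, h', s, ?_, hs, ?_, ?_, ?_, ?_, ?_⟩
    · rw [sup_ofList_cons]; exact hh'
    · simp [hc0]
    · simp only [List.length_cons]
      rw [Finset.sum_range_succ, Finset.sum_range_succ, Finset.sum_congr rfl
        (fun i hi => e0 i (Finset.mem_range.1 hi))]
      rw [Finset.sum_range_succ] at hsum
      simp
      linarith
    · intro i hi hi'
      simp only [List.length_cons] at hi'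
      by_cases hi2 : i < l.length + 1
      · rw [e0 i hi2]
        exact hbd i hi (by omega)
      · obtain rfl : i = l.length + 1 := by omega
        simp only [lt_irrefl, if_false, if_true]
        rw [abs_le] at hbd' ⊢
        constructor <;> omega
    · simp only [List.length_cons]
      rw [if_neg (by omega), if_neg (by omega), abs_le]
      constructor <;> omega
    · refine hmain _ e0 (by simp) ?_
      rw [Finset.sum_range_succ, Finset.sum_congr rfl
        (fun i hi => e0 i (Finset.mem_range.1 hi))]
      rw [Finset.sum_range_succ] at hsum
      simp
      linarith

end HilbertChain

section Dimension

variable {R : Type u} [CommRing R]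

/-- The Krull dimension of the quotient by an ideal. -/
noncomputable abbrev qdim (T : Ideal R) : WithBot ℕ∞ := ringKrullDim (R ⧸ T)

lemma qdim_anti {T T' : Ideal R} (h : T ≤ T') : qdim T' ≤ qdim T :=
  ringKrullDim_le_of_surjective (Ideal.Quotient.factor h) (Ideal.Quotient.factor_surjective h)

lemma ofList_le {l : List R} {J : Ideal R} : Ideal.ofList l ≤ J ↔ ∀ a ∈ l, a ∈ J := by
  rw [Ideal.ofList, Ideal.span_le]
  rfl

lemma mem_ofList {l : List R} {a : R} (h : a ∈ l) : a ∈ Ideal.ofList l := Ideal.subset_span h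

lemma ofList_mono {l l' : List R} (h : l ⊆ l') : Ideal.ofList l ≤ Ideal.ofList l' :=
  ofList_le.2 fun _ ha => mem_ofList (h ha)

lemma ofList_perm {l l' : List R} (h : l.Perm l') : Ideal.ofList l = Ideal.ofList l' :=
  le_antisymm (ofList_mono h.subset) (ofList_mono h.symm.subset)

lemma ofList_concat (l : List R) (a : R) :
    Ideal.ofList (l ++ [a]) = Ideal.ofList l ⊔ Ideal.span {a} := by
  rw [Ideal.ofList_append, Ideal.ofList_singleton]

/-- The kernel of the composite of a surjection with the projection modulo an ideal. -/
lemma ker_mkQ_smul_top_comp {M : Type*} [AddCommGroup M] [Module R M] {T : Ideal R}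
    {π : R →ₗ[R] M} (hπ : Function.Surjective π) (hT : LinearMap.ker π = T) (J : Ideal R) :
    LinearMap.ker ((J • (⊤ : Submodule R M)).mkQ ∘ₗ π) = T ⊔ J := by
  have : J • (⊤ : Submodule R M) = Submodule.map π J := by
    rw [← LinearMap.range_eq_top.2 hπ, LinearMap.range_eq_map, ← Submodule.map_smul'']
    congr 1
    rw [smul_eq_mul, Ideal.mul_top]
  rw [LinearMap.ker_comp, Submodule.ker_mkQ, this, Submodule.comap_map_eq, hT, sup_comm]

lemma surjective_mkQ_comp {M : Type*} [AddCommGroup M] [Module R M]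
    {π : R →ₗ[R] M} (hπ : Function.Surjective π) (N : Submodule R M) :
    Function.Surjective (N.mkQ ∘ₗ π) :=
  (Submodule.mkQ_surjective N).comp hπ

variable [IsLocalRing R]

lemma qdim_le_zero {T : Ideal R} (h : maximalIdeal R ≤ T.radical) : qdim T ≤ 0 := by
  rw [qdim, ringKrullDim_quotient]
  have : Subsingleton (PrimeSpectrum.zeroLocus (R := R) T) := by
    have key : ∀ P : PrimeSpectrum.zeroLocus (R := R) T, P.1.asIdeal = maximalIdeal R := by
      intro P
      have h1 : T ≤ P.1.asIdeal := P.2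
      exact ((maximalIdeal.isMaximal R).eq_of_le P.1.2.ne_top
        (h.trans (P.1.2.radical_le_iff.2 h1))).symm
    exact ⟨fun P P' => Subtype.ext (PrimeSpectrum.ext ((key P).trans (key P').symm))⟩
  exact Order.krullDim_nonpos_of_subsingleton

variable [IsNoetherianRing R]

lemma qdim_le_add_one (T : Ideal R) {x : R} (hx : x ∈ maximalIdeal R) :
    qdim T ≤ qdim (T ⊔ Ideal.span {x}) + 1 := by
  have h := Module.supportDim_le_supportDim_quotSMulTop_succ (M := R ⧸ T) hx
  rw [Module.supportDim_quotient_eq_ringKrullDim] at h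
  have e : QuotSMulTop x (R ⧸ T) ≃ₗ[R] R ⧸ (T ⊔ Ideal.span {x}) := by
    refine Submodule.quotEquivOfEq _ (Ideal.span {x} • ⊤) ?_ ≪≫ₗ ?_
    · rw [Submodule.ideal_span_singleton_smul]
    · have hk := ker_mkQ_smul_top_comp (π := T.mkQ) (Submodule.mkQ_surjective T)
        (Submodule.ker_mkQ T) (Ideal.span {x})
      exact ((Submodule.quotEquivOfEq _ _ hk.symm) ≪≫ₗ LinearMap.quotKerEquivOfSurjective _
        (surjective_mkQ_comp (Submodule.mkQ_surjective T) _)).symm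
  rw [Module.supportDim_eq_of_equiv e, Module.supportDim_quotient_eq_ringKrullDim] at h
  exact h

lemma qdim_le_add_length (l : List R) : ∀ (T : Ideal R), (∀ a ∈ l, a ∈ maximalIdeal R) →
    qdim T ≤ qdim (T ⊔ Ideal.ofList l) + l.length := by
  induction l with
  | nil =>
    intro T _
    rw [Ideal.ofList_nil, sup_bot_eq]
    simp
  | cons x l ih =>
    intro T h
    refine (qdim_le_add_one T (h x (by simp))).trans ?_
    rw [sup_ofList_cons]
    refine (add_le_add_left (ih (T ⊔ Ideal.span {x}) fun a ha => h a (by simp [ha])) 1).trans ?_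
    rw [add_assoc]
    simp

lemma qdim_le_length {T : Ideal R} {l : List R} (hl : ∀ a ∈ l, a ∈ maximalIdeal R)
    (h : maximalIdeal R ≤ (T ⊔ Ideal.ofList l).radical) : qdim T ≤ l.length := by
  refine (qdim_le_add_length l T hl).trans ?_
  calc _ ≤ (0 : WithBot ℕ∞) + l.length := add_le_add_left (qdim_le_zero h) _
    _ = l.length := zero_add _

/-- If `x` avoids the primes of maximal dimension, the dimension drops. -/
lemma qdim_sup_span_le {T : Ideal R} {s : ℕ} {x : R}
    (hx : ∀ P : Ideal R, P.IsPrime → T ≤ P → (s + 1 : ℕ) ≤ qdim P → x ∉ P) :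
    qdim (T ⊔ Ideal.span {x}) ≤ s := by
  rw [qdim, ringKrullDim_quotient]
  refine iSup_le fun q => ?_
  by_contra hlt
  have hlt : s + 1 ≤ q.length := by
    have : ¬ q.length ≤ s := fun h => hlt (by exact_mod_cast h)
    omega
  have hq : T ⊔ Ideal.span {x} ≤ q.head.1.asIdeal := q.head.2
  refine hx q.head.1.asIdeal q.head.1.2 (le_sup_left.trans hq) ?_
    (hq (Ideal.mem_sup_right (Ideal.mem_span_singleton_self x)))
  rw [qdim, ringKrullDim_quotient]
  let q' : LTSeries (PrimeSpectrum.zeroLocus (R := R) q.head.1.asIdeal) :=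
    { length := q.length
      toFun := fun i => ⟨(q i).1, by
        have : q.head ≤ q i := q.monotone (Fin.zero_le i)
        exact this⟩
      step := fun i => q.step i }
  refine le_trans ?_ (Order.LTSeries.length_le_krullDim q')
  exact_mod_cast hlt

lemma mem_minimalPrimes_of_qdim {T P : Ideal R} {s : ℕ} (hs : qdim T ≤ s) (hP : P.IsPrime)
    (hTP : T ≤ P) (hdim : (s : WithBot ℕ∞) ≤ qdim P) : P ∈ T.minimalPrimes := by
  refine ⟨⟨hP, hTP⟩, ?_⟩
  rintro P' ⟨hP', hTP'⟩ hle
  by_contra hnot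
  have hlt : P' < P := lt_of_le_not_ge hle hnot
  rw [qdim, ringKrullDim_quotient] at hdim hs
  have : Nonempty (PrimeSpectrum.zeroLocus (R := R) P) := ⟨⟨⟨P, hP⟩, le_refl P⟩⟩
  obtain ⟨q, hq⟩ := Order.le_krullDim_iff.1 hdim
  let q' : LTSeries (PrimeSpectrum.zeroLocus (R := R) T) :=
    { length := q.length
      toFun := fun i => ⟨(q i).1, hTP.trans (q i).2⟩
      step := fun i => q.step i }
  let q'' := q'.cons ⟨⟨P', hP'⟩, hTP'⟩ (lt_of_lt_of_le hlt q.head.2 : P' < q.head.1.asIdeal)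
  have := (Order.LTSeries.length_le_krullDim q'').trans hs
  have h2 : q''.length = s + 1 := by
    rw [← hq]
    exact RelSeries.cons_length _ _ _
  rw [h2] at this
  have : s + 1 ≤ s := by exact_mod_cast this
  omega

lemma finite_primes_of_qdim {T : Ideal R} {s : ℕ} (hs : qdim T ≤ s) :
    {P : Ideal R | P.IsPrime ∧ T ≤ P ∧ (s : WithBot ℕ∞) ≤ qdim P}.Finite :=
  (Ideal.finite_minimalPrimes_of_isNoetherianRing R T).subset
    fun _ ⟨hP, hTP, hdim⟩ => mem_minimalPrimes_of_qdim hs hP hTP hdim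

/-- `y` is a system of parameters of `R ⧸ T`. -/
structure PSys (T : Ideal R) (y : List R) : Prop where
  dim : qdim T = y.length
  mem : ∀ a ∈ y, a ∈ maximalIdeal R
  rad : maximalIdeal R ≤ (T ⊔ Ideal.ofList y).radical

lemma PSys.of_rad {T : Ideal R} {y y' : List R} (h : PSys T y) (hl : y'.length = y.length)
    (hm : ∀ a ∈ y', a ∈ maximalIdeal R) (hr : T ⊔ Ideal.ofList y ≤ (T ⊔ Ideal.ofList y').radical) :
    PSys T y' where
  dim := by rw [h.dim, hl]
  mem := hm
  rad := h.rad.trans (by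
    rw [← Ideal.radical_idem (T ⊔ Ideal.ofList y')]
    exact Ideal.radical_mono hr)

lemma PSys.perm {T : Ideal R} {y y' : List R} (h : PSys T y) (hp : y.Perm y') : PSys T y' :=
  h.of_rad hp.length_eq.symm (fun a ha => h.mem a (hp.symm.subset ha))
    (by rw [ofList_perm hp]; exact Ideal.le_radical)

lemma PSys.left {T : Ideal R} {p q : List R} (h : PSys T (p ++ q)) : PSys (T ⊔ Ideal.ofList q) p := by
  have hr : maximalIdeal R ≤ (T ⊔ Ideal.ofList q ⊔ Ideal.ofList p).radical := by
    rw [sup_assoc, sup_comm (Ideal.ofList q), ← Ideal.ofList_append]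
    exact h.rad
  have hm : ∀ a ∈ p, a ∈ maximalIdeal R := fun a ha => h.mem a (by simp [ha])
  refine ⟨le_antisymm (qdim_le_length hm hr) ?_, hm, hr⟩
  have h1 := qdim_le_add_length q T fun a ha => h.mem a (by simp [ha])
  rw [h.dim, List.length_append] at h1
  push_cast at h1
  generalize qdim (T ⊔ Ideal.ofList q) = D at h1
  induction D using WithBot.recBotCoe with
  | bot =>
    rw [WithBot.bot_add] at h1
    exact absurd (le_bot_iff.1 h1) (by
      rw [show (p.length : WithBot ℕ∞) + q.length =
        (((p.length + q.length : ℕ) : ℕ∞) : WithBot ℕ∞) by push_cast; rfl]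
      exact WithBot.coe_ne_bot)
  | coe d =>
    have h2 : ((p.length : ℕ∞) + (q.length : ℕ∞)) ≤ d + (q.length : ℕ∞) := by
      rw [← WithBot.coe_le_coe]
      exact h1
    have h3 : (p.length : ℕ∞) ≤ d := (ENat.add_le_add_iff_right (ENat.natCast_ne_top _)).1 h2
    exact WithBot.coe_le_coe.2 h3

lemma PSys.right {T : Ideal R} {p q : List R} (h : PSys T (p ++ q)) : PSys (T ⊔ Ideal.ofList p) q :=
  (h.perm List.perm_append_comm).left

end Dimension

section CLists

variable {R : Type u} [CommRing R] [IsLocalRing R]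

/-- The ideal `b(R ⧸ T)`, in terms of lists. -/
def bT (T : Ideal R) : Ideal R where
  carrier := {c | ∀ (p : List R) (a : R) (s : List R), PSys T (p ++ a :: s) →
    ∀ v, a * v ∈ T ⊔ Ideal.ofList p → c * v ∈ T ⊔ Ideal.ofList p}
  add_mem' := by
    intro c c' h h' p a s hP v hv
    rw [add_mul]
    exact add_mem (h p a s hP v hv) (h' p a s hP v hv)
  zero_mem' := by
    intro p a s hP v hv
    rw [zero_mul]
    exact zero_mem _
  smul_mem' := by
    intro r c h p a s hP v hv
    rw [smul_eq_mul, mul_assoc]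
    exact Ideal.mul_mem_left _ _ (h p a s hP v hv)

lemma bT_apply {T : Ideal R} {c : R} (h : c ∈ bT T) {p : List R} {a : R} {s : List R}
    (hP : PSys T (p ++ a :: s)) {v : R} (hv : a * v ∈ T ⊔ Ideal.ofList p) :
    c * v ∈ T ⊔ Ideal.ofList p := h p a s hP v hv

/-- Each entry of the list lies in the cube of `b` of the quotient by the later entries. -/
def CTail : List R → Prop
  | [] => True
  | x :: s => x ∈ bT (Ideal.ofList s) ^ 3 ∧ CTail s

lemma CTail.mem {p : List R} {x : R} {s : List R} (h : CTail (p ++ x :: s)) :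
    x ∈ bT (Ideal.ofList s) ^ 3 := by
  induction p with
  | nil => exact h.1
  | cons y p ih => exact ih h.2

lemma CTail.tail {p s : List R} (h : CTail (p ++ s)) : CTail s := by
  induction p with
  | nil => exact h
  | cons y p ih => exact ih h.2

lemma CTail.mem' {p : List R} {x : R} {s : List R} (h : CTail (p ++ x :: s)) :
    x ∈ bT (Ideal.ofList s) := Ideal.pow_le_self (by norm_num) h.mem

lemma cTail_iff {l : List R} :
    CTail l ↔ ∀ p x s, l = p ++ x :: s → x ∈ bT (Ideal.ofList s) ^ 3 := by
  constructor
  · rintro h p x s rfl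
    exact h.mem
  · intro h
    induction l with
    | nil => trivial
    | cons y l ih =>
      refine ⟨h [] y l rfl, ih fun p x s e => h (y :: p) x s (by rw [e]; rfl)⟩

variable [IsNoetherianRing R]

lemma PSys.tail {p q : List R} (h : PSys (⊥ : Ideal R) (p ++ q)) : PSys (Ideal.ofList q) p := by
  simpa using h.left

lemma CTail.cancel (p : List R) (x : R) (mid : List R) : ∀ {s : List R},
    PSys (⊥ : Ideal R) (p ++ x :: (mid ++ s)) → CTail (p ++ x :: (mid ++ s)) → ∀ {v : R},
    v ∈ Ideal.ofList s ⊔ Ideal.ofList (p ++ x :: mid) → x * v ∈ Ideal.ofList s ⊔ Ideal.ofList p →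
    v ∈ Ideal.ofList s ⊔ Ideal.ofList p := by
  have strip : ∀ {s q : List R} {x y : R}, y ∈ bT (Ideal.ofList s) →
      PSys (Ideal.ofList s) (p ++ x * y :: q) → ∀ {v : R},
      v ∈ Ideal.ofList s ⊔ Ideal.ofList (p ++ [y]) → x * v ∈ Ideal.ofList s ⊔ Ideal.ofList p →
      v ∈ Ideal.ofList s ⊔ Ideal.ofList p := by
    intro s q x y hy hP v hv hxv
    rw [ofList_concat, ← sup_assoc] at hv
    obtain ⟨u, hu, w, hw, rfl⟩ := Submodule.mem_sup.1 hv
    obtain ⟨c, rfl⟩ := Ideal.mem_span_singleton'.1 hw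
    refine add_mem hu ?_
    rw [mul_comm]
    refine bT_apply hy hP ?_
    have : x * y * c = x * (u + c * y) - x * u := by ring
    rw [this]
    exact sub_mem hxv (Ideal.mul_mem_left _ _ hu)
  induction mid using List.reverseRecOn with
  | nil =>
    intro s hP hC v hv hxv
    have hP1 : PSys (Ideal.ofList s) (p ++ [x]) := PSys.tail (by simpa using hP)
    refine strip (q := []) (hC.mem' (s := s)) (hP1.of_rad (by simp) ?_ ?_) hv hxv
    · intro a ha
      rcases List.mem_append.1 ha with ha | ha
      · exact hP1.mem a (by simp [ha])
      · rw [List.mem_singleton.1 ha]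
        exact Ideal.mul_mem_left _ _ (hP1.mem x (by simp))
    · refine sup_le (le_sup_left.trans Ideal.le_radical) (ofList_le.2 fun a ha => ?_)
      rcases List.mem_append.1 ha with ha | ha
      · exact Ideal.le_radical (Ideal.mem_sup_right (mem_ofList (by simp [ha])))
      · rw [List.mem_singleton.1 ha]
        refine ⟨2, Ideal.mem_sup_right (mem_ofList ?_)⟩
        simp [pow_two]
  | append_singleton mid y ih =>
    intro s hP hC v hv hxv
    have e : mid ++ [y] ++ s = mid ++ (y :: s) := by simp
    rw [e] at hP hC
    have e2 : ∀ q : List R, Ideal.ofList (y :: s) ⊔ Ideal.ofList q =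
        Ideal.ofList s ⊔ Ideal.ofList (q ++ [y]) := by
      intro q
      rw [Ideal.ofList_cons, ofList_concat, sup_comm (Ideal.span {y}), sup_assoc,
        sup_comm (Ideal.span {y})]
    have h1 : v ∈ Ideal.ofList (y :: s) ⊔ Ideal.ofList p := by
      refine ih hP hC ?_ ?_
      · rw [e2]
        simpa [List.append_assoc] using hv
      · rw [e2]
        exact (sup_le_sup_left (ofList_mono (List.subset_append_left p [y])) (Ideal.ofList s) :
          _ ≤ Ideal.ofList s ⊔ Ideal.ofList (p ++ [y])) hxv
    rw [e2] at h1
    have hP1 : PSys (Ideal.ofList s) (p ++ x :: (mid ++ [y])) := PSys.tail (by simpa using hP)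
    have hxm := hP1.mem x (by simp)
    have hym := hP1.mem y (by simp)
    have hC' : y ∈ bT (Ideal.ofList s) := CTail.mem' (p := p ++ x :: mid) (by simpa using hC)
    refine strip (q := mid ++ [x + y]) hC' (hP1.of_rad (by simp) ?_ ?_) h1 hxv
    · intro a ha
      simp only [List.mem_append, List.mem_cons, List.not_mem_nil, or_false] at ha
      rcases ha with ha | rfl | ha | rfl
      · exact hP1.mem a (by simp [ha])
      · exact Ideal.mul_mem_left _ _ hym
      · exact hP1.mem a (by simp [ha])
      · exact add_mem hxm hym
    · set J := Ideal.ofList s ⊔ Ideal.ofList (p ++ x * y :: (mid ++ [x + y])) with hJ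
      have hin : ∀ a ∈ p ++ x * y :: (mid ++ [x + y]), a ∈ J := fun a ha =>
        Ideal.mem_sup_right (mem_ofList ha)
      have hxr : x ∈ J.radical := by
        refine ⟨2, ?_⟩
        have : x ^ 2 = x * (x + y) - x * y := by ring
        rw [this]
        exact sub_mem (Ideal.mul_mem_left _ _ (hin _ (by simp))) (hin _ (by simp))
      have hyr : y ∈ J.radical := by
        have : y = (x + y) - x := by ring
        rw [this]
        exact sub_mem (Ideal.le_radical (hin _ (by simp))) hxr
      refine sup_le (le_sup_left.trans Ideal.le_radical) (ofList_le.2 fun a ha => ?_)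
      simp only [List.mem_append, List.mem_cons, List.not_mem_nil, or_false] at ha
      rcases ha with ha | rfl | ha | rfl
      · exact Ideal.le_radical (hin a (by simp [ha]))
      · exact hxr
      · exact Ideal.le_radical (hin a (by simp [ha]))
      · exact hyr

/-- A list which is a C-system of parameters of `R`. -/
structure CSys (l : List R) : Prop where
  sys : PSys (⊥ : Ideal R) l
  tail : CTail l

lemma CSys.good {l : List R} (h : CSys l) : Good ⊥ l := by
  have key : ∀ (q p : List R), l = p ++ q → Good (Ideal.ofList p) q := by
    intro q
    induction q with
    | nil => intro p _; trivial
    | cons x s ih =>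
      rintro p rfl
      have hV : colon (Ideal.ofList p) x ⊓ (Ideal.ofList p ⊔ Ideal.ofList (x :: s)) ≤
          Ideal.ofList p := by
        rintro v ⟨hv1, hv2⟩
        have := CTail.cancel p x s (s := []) (v := v) (by simpa using h.sys) (by simpa using h.tail)
        simp only [Ideal.ofList_nil, bot_sup_eq] at this
        refine this ?_ hv1
        rw [Ideal.ofList_append]
        exact hv2
      refine ⟨hV, ?_, ?_⟩
      · have hb : bT (Ideal.ofList s) ≤
            Submodule.colon (Ideal.ofList p) (colon (Ideal.ofList p) x : Set R) := by
          intro c hc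
          refine Submodule.mem_colon.2 fun t ht => hV ⟨?_, ?_⟩
          · rw [smul_eq_mul]
            exact Ideal.mul_mem_left _ _ ht
          · have hP1 : PSys (Ideal.ofList s) (p ++ [x]) := PSys.tail (by simpa using h.sys)
            have := bT_apply hc hP1 (Ideal.mem_sup_right ht)
            refine (sup_le ?_ le_sup_left : Ideal.ofList s ⊔ Ideal.ofList p ≤ _) this
            exact (ofList_mono (by simp)).trans le_sup_right
        have hx3 : x ∈ bT (Ideal.ofList s) ^ 3 := h.tail.mem
        have hxm : x ∈ maximalIdeal R := h.sys.mem x (by simp)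
        refine Ideal.mul_mono_right hb ?_
        by_cases htop : bT (Ideal.ofList s) = ⊤
        · rw [htop, Ideal.mul_top]
          exact hxm
        · have hle := le_maximalIdeal htop
          refine (?_ : bT (Ideal.ofList s) ^ 3 ≤ _) hx3
          rw [pow_succ']
          exact Ideal.mul_mono hle (Ideal.pow_le_self (by norm_num))
      · rw [← ofList_concat]
        exact ih (p ++ [x]) (by simp)
  simpa using key l [] rfl

lemma rlen_colon_swap {𝔠 : Ideal R} {x z : R} (h₁ : colon 𝔠 x ≤ colon 𝔠 z)
    (h₂ : colon 𝔠 x ⊓ (𝔠 ⊔ Ideal.span {x} ⊔ Ideal.span {z}) ≤ 𝔠) :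
    rlen (𝔠 ⊔ Ideal.span {z}) (colon (𝔠 ⊔ Ideal.span {z}) x) ≤
      rlen (𝔠 ⊔ Ideal.span {x}) (colon (𝔠 ⊔ Ideal.span {x}) z) := by
  have hcol : ∀ a b : R, 𝔠 ⊔ Ideal.span {a} ≤ 𝔠 ⊔ Ideal.span {a} ⊔ colon 𝔠 b ∧
      𝔠 ⊔ Ideal.span {a} ⊔ colon 𝔠 b ≤ colon (𝔠 ⊔ Ideal.span {a}) b := fun a b =>
    ⟨le_sup_left, sup_le (le_colon _ _) (colon_mono le_sup_left b)⟩
  rw [rlen_add (hcol z x).1 (hcol z x).2, rlen_add (hcol x z).1 (hcol x z).2]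
  refine add_le_add ?_ (le_of_eq ?_)
  · rw [rlen_sup, rlen_sup]
    calc rlen (𝔠 ⊔ Ideal.span {z}) (colon 𝔠 x) ≤ rlen 𝔠 (colon 𝔠 x) :=
          rlen_le_of_inf_le le_rfl (inf_le_right.trans le_sup_left)
      _ ≤ rlen (𝔠 ⊔ Ideal.span {x}) (colon 𝔠 z) :=
          rlen_le_of_inf_le h₁ ((inf_le_inf_left _ le_sup_left).trans h₂)
  · let G : Submodule R (R × R) := Submodule.comap
      (x • LinearMap.fst R R R - z • LinearMap.snd R R R) 𝔠
    have hG : ∀ g : R × R, g ∈ G ↔ x * g.1 - z * g.2 ∈ 𝔠 := fun g => by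
      simp [G]
    let f : ∀ K : Ideal R, G →ₗ[R] R ⧸ K := fun K => K.mkQ ∘ₗ LinearMap.fst R R R ∘ₗ G.subtype
    let f' : ∀ K : Ideal R, G →ₗ[R] R ⧸ K := fun K => K.mkQ ∘ₗ LinearMap.snd R R R ∘ₗ G.subtype
    have key : Module.length R (LinearMap.range (f (𝔠 ⊔ Ideal.span {z} ⊔ colon 𝔠 x))) =
        Module.length R (LinearMap.range (f' (𝔠 ⊔ Ideal.span {x} ⊔ colon 𝔠 z))) := by
      apply length_range_eq_of_ker_eq
      ext ⟨⟨a, c⟩, hac⟩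
      rw [hG] at hac
      simp only at hac
      simp only [LinearMap.mem_ker, f, f', LinearMap.comp_apply, Submodule.subtype_apply,
        LinearMap.fst_apply, LinearMap.snd_apply, Submodule.mkQ_apply,
        Submodule.Quotient.mk_eq_zero]
      have aux : ∀ {x z a c : R}, x * a - z * c ∈ 𝔠 → a ∈ 𝔠 ⊔ Ideal.span {z} ⊔ colon 𝔠 x →
          c ∈ 𝔠 ⊔ Ideal.span {x} ⊔ colon 𝔠 z := by
        intro x z a c hac ha
        obtain ⟨u, hu, e, he, rfl⟩ := Submodule.mem_sup.1 ha
        obtain ⟨α, hα, w, hw, rfl⟩ := Submodule.mem_sup.1 hu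
        obtain ⟨r, rfl⟩ := Ideal.mem_span_singleton'.1 hw
        have : c = r * x + (c - r * x) := by ring
        rw [this]
        refine add_mem (Ideal.mem_sup_left (Ideal.mem_sup_right
          (Ideal.mul_mem_left _ _ (Ideal.mem_span_singleton_self x)))) (Ideal.mem_sup_right ?_)
        rw [mem_colon]
        have : z * (c - r * x) = x * α + x * e - (x * (α + r * z + e) - z * c) := by ring
        rw [this]
        exact sub_mem (add_mem (𝔠.mul_mem_left _ hα) he) hac
      refine ⟨aux hac, aux (x := z) (z := x) (a := c) (c := a) ?_⟩
      have : z * c - x * a = -(x * a - z * c) := by ring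
      rw [this]
      exact neg_mem hac
    have e1 : LinearMap.range (f (𝔠 ⊔ Ideal.span {z} ⊔ colon 𝔠 x)) =
        Submodule.map (𝔠 ⊔ Ideal.span {z} ⊔ colon 𝔠 x).mkQ (colon (𝔠 ⊔ Ideal.span {z}) x) := by
      rw [LinearMap.range_comp]
      congr 1
      ext a
      simp only [LinearMap.mem_range, LinearMap.comp_apply, Submodule.subtype_apply,
        LinearMap.fst_apply, Subtype.exists, Prod.exists, exists_prop]
      constructor
      · rintro ⟨a', c, hac, rfl⟩
        rw [hG] at hac
        rw [mem_colon]
        have : x * a' = (x * a' - z * c) + c * z := by ring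
        rw [this]
        exact add_mem (Ideal.mem_sup_left hac) (Ideal.mem_sup_right
          (Ideal.mul_mem_left _ _ (Ideal.mem_span_singleton_self z)))
      · intro ha
        obtain ⟨u, hu, w, hw, e⟩ := Submodule.mem_sup.1 (mem_colon.1 ha)
        obtain ⟨r, rfl⟩ := Ideal.mem_span_singleton'.1 hw
        refine ⟨a, r, (hG _).2 ?_, rfl⟩
        simp only
        rw [← e]
        convert hu using 1
        ring
    have e2 : LinearMap.range (f' (𝔠 ⊔ Ideal.span {x} ⊔ colon 𝔠 z)) =
        Submodule.map (𝔠 ⊔ Ideal.span {x} ⊔ colon 𝔠 z).mkQ (colon (𝔠 ⊔ Ideal.span {x}) z) := by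
      rw [LinearMap.range_comp]
      congr 1
      ext c
      simp only [LinearMap.mem_range, LinearMap.comp_apply, Submodule.subtype_apply,
        LinearMap.snd_apply, Subtype.exists, Prod.exists, exists_prop]
      constructor
      · rintro ⟨a, c', hac, rfl⟩
        rw [hG] at hac
        rw [mem_colon]
        have : z * c' = -(x * a - z * c') + a * x := by ring
        rw [this]
        exact add_mem (Ideal.mem_sup_left (neg_mem hac)) (Ideal.mem_sup_right
          (Ideal.mul_mem_left _ _ (Ideal.mem_span_singleton_self x)))
      · intro hc
        obtain ⟨u, hu, w, hw, e⟩ := Submodule.mem_sup.1 (mem_colon.1 hc)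
        obtain ⟨r, rfl⟩ := Ideal.mem_span_singleton'.1 hw
        refine ⟨r, c, (hG _).2 ?_, rfl⟩
        simp only
        rw [← e]
        convert neg_mem hu using 1
        ring
    rw [e1, e2] at key
    exact key

/-- The length of the colon ideal of an entry modulo all the other entries. -/
noncomputable def hLen (p : List R) (x : R) (s : List R) : ℕ∞ :=
  rlen (Ideal.ofList (p ++ s)) (colon (Ideal.ofList (p ++ s)) x)

lemma CSys.hLen_le {p : List R} {x z : R} {s : List R} (h : CSys (p ++ x :: z :: s)) :
    hLen p x (z :: s) ≤ hLen (p ++ [x]) z s := by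
  set 𝔠 := Ideal.ofList s ⊔ Ideal.ofList p with h𝔠
  have e1 : Ideal.ofList (p ++ z :: s) = 𝔠 ⊔ Ideal.span {z} := by
    rw [h𝔠, Ideal.ofList_append, Ideal.ofList_cons, sup_comm (Ideal.ofList s), sup_assoc,
      sup_comm (Ideal.span {z})]
  have e2 : Ideal.ofList (p ++ [x] ++ s) = 𝔠 ⊔ Ideal.span {x} := by
    rw [h𝔠, Ideal.ofList_append, ofList_concat, sup_comm, sup_assoc]
  unfold hLen
  rw [e1, e2]
  have hP1 : PSys (Ideal.ofList s) (p ++ [x, z]) := PSys.tail (by simpa using h.sys)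
  apply rlen_colon_swap
  · intro v hv
    exact bT_apply (CTail.mem' (p := p ++ [x]) (by simpa using h.tail)) hP1 hv
  · rintro v ⟨hv1, hv2⟩
    refine CTail.cancel p x [z] (s := s) (by simpa using h.sys) (by simpa using h.tail) ?_ hv1
    have : Ideal.ofList (p ++ [x, z]) = Ideal.ofList p ⊔ Ideal.span {x} ⊔ Ideal.span {z} := by
      rw [Ideal.ofList_append, Ideal.ofList_cons, Ideal.ofList_singleton, sup_assoc]
    rw [this, ← sup_assoc, ← sup_assoc]
    exact hv2

lemma CSys.hLen_le_last (s : List R) : ∀ {p : List R} {x : R}, CSys (p ++ x :: s) →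
    ∃ p' x', p ++ x :: s = p' ++ [x'] ∧ hLen p x s ≤ hLen p' x' [] := by
  induction s with
  | nil => exact fun {p x} _ => ⟨p, x, rfl, le_rfl⟩
  | cons z s ih =>
    intro p x h
    obtain ⟨p', x', e, hle⟩ := ih (p := p ++ [x]) (x := z) (by simpa using h)
    exact ⟨p', x', by rw [← e]; simp, h.hLen_le.trans hle⟩

lemma CSys.pow {x : R} {s : List R} (h : CSys (x :: s)) {n : ℕ} (hn : n ≠ 0) :
    CSys (x ^ n :: s) := by
  refine ⟨h.sys.of_rad (by simp) ?_ ?_, Ideal.pow_mem_of_mem _ h.tail.1 n (Nat.pos_of_ne_zero hn),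
    h.tail.2⟩
  · intro a ha
    rcases List.mem_cons.1 ha with rfl | ha
    · exact Ideal.pow_mem_of_mem _ (h.sys.mem x (by simp)) n (Nat.pos_of_ne_zero hn)
    · exact h.sys.mem a (by simp [ha])
  · rw [bot_sup_eq, bot_sup_eq]
    refine ofList_le.2 fun a ha => ?_
    rcases List.mem_cons.1 ha with rfl | ha
    · exact ⟨n, mem_ofList (by simp)⟩
    · exact Ideal.le_radical (mem_ofList (by simp [ha]))

end CLists

section OldExt

variable {R : Type u} [CommRing R]

/-- The map of Hom complexes induced by a map of chain complexes. -/
noncomputable def yonedaMap {K L : ChainComplex (ModuleCat.{u} R) ℕ} (φ : K ⟶ L)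
    (Y : ModuleCat.{u} R) : L.linearYonedaObj R Y ⟶ K.linearYonedaObj R Y :=
  (HomologicalComplex.unopFunctor _ _).map
    ((((((linearYoneda R (ModuleCat.{u} R)).obj Y).rightOp.mapHomologicalComplex _).map φ)).op)

lemma naturality_aux {C : Type*} [Category C] {E E' K K' H H' : C} {A : E ⟶ E'} (a : E ≅ K)
    (a' : E' ≅ K') {ν : K ⟶ K'} (b : H ≅ K) (b' : H' ≅ K') {μ : H ⟶ H'}
    (h₁ : A ≫ a'.hom = a.hom ≫ ν) (h₂ : b.hom ≫ ν = μ ≫ b'.hom) :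
    A ≫ (a' ≪≫ b'.symm).hom = (a ≪≫ b.symm).hom ≫ μ := by
  simp only [Iso.trans_hom, Iso.symm_hom, Category.assoc]
  rw [reassoc_of% h₁, ← cancel_mono b'.hom]
  simp only [Category.assoc, Iso.inv_hom_id, Category.comp_id]
  rw [← h₂, Iso.inv_hom_id_assoc]

lemma isoExt_naturality {X X' : ModuleCat.{u} R} {P : ProjectiveResolution X}
    {P' : ProjectiveResolution X'} {g : X' ⟶ X} (φ : ProjectiveResolution.Hom P' P g) (n : ℕ)
    (Y : ModuleCat.{u} R) :
    ((Ext R (ModuleCat.{u} R) n).map g.op).app Y ≫ (P'.isoExt n Y).hom =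
      (P.isoExt (R := R) n Y).hom ≫ HomologicalComplex.homologyMap (yonedaMap φ.hom Y) n := by
  have h1 := ProjectiveResolution.isoLeftDerivedObj_inv_naturality g P' P φ.hom
    (by simpa using φ.hom_f_zero_comp_π_f_zero)
    ((linearYoneda R (ModuleCat.{u} R)).obj Y).rightOp n
  have h2 := HomologicalComplex.homologyOp_hom_naturality (yonedaMap φ.hom Y) n
  exact naturality_aux (P.isoLeftDerivedObj ((linearYoneda R (ModuleCat.{u} R)).obj Y).rightOp n).unop.symm
    (P'.isoLeftDerivedObj ((linearYoneda R (ModuleCat.{u} R)).obj Y).rightOp n).unop.symm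
    (HomologicalComplex.homologyUnop _ n) (HomologicalComplex.homologyUnop _ n)
    (congrArg Quiver.Hom.unop h1) (congrArg Quiver.Hom.unop h2)

lemma extMk_zero_degree {X Y : ModuleCat.{u} R} (P : ProjectiveResolution X)
    (f : P.complex.X 0 ⟶ Y) (hf : P.complex.d 1 0 ≫ f = 0) :
    P.extMk f 1 rfl hf = 0 ↔ f = 0 := by
  constructor
  · intro h
    simp only [← P.extEquivCohomologyClass.apply_eq_iff_eq,
      ProjectiveResolution.extEquivCohomologyClass_extMk,
      ProjectiveResolution.extEquivCohomologyClass_zero,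
      CochainComplex.HomComplex.CohomologyClass.mk_eq_zero_iff] at h
    rw [CochainComplex.HomComplex.Cocycle.toSingleMk_mem_coboundaries_iff _ _ _ _ _ 1 (by lia)] at h
    obtain ⟨g, hg⟩ := h
    have hz : IsZero (P.cochainComplex.X 1) :=
      CochainComplex.isZero_of_isStrictlyLE _ 0 _ (by norm_num)
    rw [hz.eq_of_src g 0, comp_zero] at hg
    rw [← cancel_epi (P.cochainComplexXIso (-(0 : ℕ)) 0 rfl).hom, ← hg, comp_zero]
  · rintro rfl
    exact P.extMk_zero 1 rfl

/-- Cocycles of the Hom complex, as morphisms. -/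
noncomputable def cocycleHom {X : ModuleCat.{u} R} (P : ProjectiveResolution X)
    (Y : ModuleCat.{u} R) (n : ℕ) :
    (P.complex.linearYonedaObj R Y).cycles n →ₗ[R] (P.complex.X n ⟶ Y) :=
  ((P.complex.linearYonedaObj R Y).iCycles n).hom

lemma d_cocycleHom {X : ModuleCat.{u} R} (P : ProjectiveResolution X)
    (Y : ModuleCat.{u} R) (n : ℕ) (z) : P.complex.d (n + 1) n ≫ cocycleHom P Y n z = 0 :=
  ConcreteCategory.congr_hom ((P.complex.linearYonedaObj R Y).iCycles_d n (n + 1)) z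

lemma cocycleHom_injective {X : ModuleCat.{u} R} (P : ProjectiveResolution X)
    (Y : ModuleCat.{u} R) (n : ℕ) : Function.Injective (cocycleHom P Y n) :=
  (ModuleCat.mono_iff_injective ((P.complex.linearYonedaObj R Y).iCycles n)).1 inferInstance

lemma exists_cocycleHom {X : ModuleCat.{u} R} (P : ProjectiveResolution X)
    (Y : ModuleCat.{u} R) (n : ℕ) (f : P.complex.X n ⟶ Y) (hf : P.complex.d (n + 1) n ≫ f = 0) :
    ∃ z, cocycleHom P Y n z = f := by
  have hS : (ShortComplex.mk _ _ ((P.complex.linearYonedaObj R Y).iCycles_d n (n + 1))).Exact :=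
    ShortComplex.exact_of_f_is_kernel _
      ((P.complex.linearYonedaObj R Y).cyclesIsKernel n (n + 1) (by simp))
  exact (ShortComplex.moduleCat_exact_iff _).1 hS f hf

lemma homologyπ_eq_zero_iff {X : ModuleCat.{u} R} (P : ProjectiveResolution X)
    (Y : ModuleCat.{u} R) (n p : ℕ) (hp : (ComplexShape.up ℕ).prev n = p) (z) :
    (P.complex.linearYonedaObj R Y).homologyπ n z = 0 ↔
      ∃ g : P.complex.X p ⟶ Y, P.complex.d n p ≫ g = cocycleHom P Y n z := by
  have hS : (ShortComplex.mk _ _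
      ((P.complex.linearYonedaObj R Y).toCycles_comp_homologyπ p n)).Exact :=
    ShortComplex.exact_of_g_is_cokernel _
      ((P.complex.linearYonedaObj R Y).homologyIsCokernel p n hp)
  have key : ∀ g : P.complex.X p ⟶ Y, cocycleHom P Y n
      ((P.complex.linearYonedaObj R Y).toCycles p n g) = P.complex.d n p ≫ g := fun g =>
    ConcreteCategory.congr_hom ((P.complex.linearYonedaObj R Y).toCycles_i p n) g
  constructor
  · intro h
    obtain ⟨g, hg⟩ := (ShortComplex.moduleCat_exact_iff _).1 hS z h
    exact ⟨g, (key g).symm.trans (congrArg (cocycleHom P Y n) hg)⟩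
  · rintro ⟨g, hg⟩
    rw [← key] at hg
    rw [← cocycleHom_injective P Y n hg]
    exact ConcreteCategory.congr_hom
      ((P.complex.linearYonedaObj R Y).toCycles_comp_homologyπ p n) g

/-- Cocycles of the Hom complex, as classes in `Ext`. -/
noncomputable def cyclesToExt {X : ModuleCat.{u} R} (P : ProjectiveResolution X)
    (Y : ModuleCat.{u} R) (n : ℕ) :
    (P.complex.linearYonedaObj R Y).cycles n →ₗ[R] Abelian.Ext.{u} X Y n where
  toFun z := P.extMk (cocycleHom P Y n z) (n + 1) rfl (d_cocycleHom P Y n z)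
  map_add' a b := by
    rw [ProjectiveResolution.add_extMk]
    congr 1
    exact map_add _ a b
  map_smul' r a := by
    rw [RingHom.id_apply, Abelian.Ext.smul_eq_comp_mk₀, ProjectiveResolution.extMk_comp_mk₀]
    congr 1
    rw [map_smul]
    simp

lemma cyclesToExt_apply {X : ModuleCat.{u} R} (P : ProjectiveResolution X)
    (Y : ModuleCat.{u} R) (n : ℕ) (z) : cyclesToExt P Y n z =
      P.extMk (cocycleHom P Y n z) (n + 1) rfl (d_cocycleHom P Y n z) := rfl

lemma cyclesToExt_surjective {X : ModuleCat.{u} R} (P : ProjectiveResolution X)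
    (Y : ModuleCat.{u} R) (n : ℕ) : Function.Surjective (cyclesToExt P Y n) := by
  intro α
  obtain ⟨f, hf, rfl⟩ := P.extMk_surjective α (n + 1) rfl
  obtain ⟨z, rfl⟩ := exists_cocycleHom P Y n f hf
  exact ⟨z, rfl⟩

lemma ker_cyclesToExt {X : ModuleCat.{u} R} (P : ProjectiveResolution X)
    (Y : ModuleCat.{u} R) (n : ℕ) : LinearMap.ker (cyclesToExt P Y n) =
      LinearMap.ker ((P.complex.linearYonedaObj R Y).homologyπ n).hom := by
  ext z
  rw [LinearMap.mem_ker, LinearMap.mem_ker, cyclesToExt_apply]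
  cases n with
  | zero =>
    refine Iff.trans ?_ (homologyπ_eq_zero_iff P Y 0 0 (by simp) z).symm
    rw [extMk_zero_degree]
    constructor
    · intro h
      exact ⟨0, by rw [comp_zero, h]⟩
    · rintro ⟨g, hg⟩
      rw [← hg, P.complex.shape _ _ (by simp), zero_comp]
  | succ n =>
    refine Iff.trans ?_ (homologyπ_eq_zero_iff P Y (n + 1) n (by simp) z).symm
    exact P.extMk_eq_zero_iff _ _ _ _ n rfl

/-- Homology of the Hom complex is `Ext`. -/
noncomputable def homologyEquivExt {X : ModuleCat.{u} R} (P : ProjectiveResolution X)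
    (Y : ModuleCat.{u} R) (n : ℕ) :
    (P.complex.linearYonedaObj R Y).homology n ≃ₗ[R] Abelian.Ext.{u} X Y n :=
  (LinearMap.quotKerEquivOfSurjective ((P.complex.linearYonedaObj R Y).homologyπ n).hom
    ((ModuleCat.epi_iff_surjective _).1 inferInstance)).symm ≪≫ₗ
  Submodule.quotEquivOfEq _ _ (ker_cyclesToExt P Y n).symm ≪≫ₗ
  LinearMap.quotKerEquivOfSurjective _ (cyclesToExt_surjective P Y n)

lemma homologyEquivExt_π {X : ModuleCat.{u} R} (P : ProjectiveResolution X)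
    (Y : ModuleCat.{u} R) (n : ℕ) (z) :
    homologyEquivExt P Y n ((P.complex.linearYonedaObj R Y).homologyπ n z) =
      cyclesToExt P Y n z := by
  simp only [homologyEquivExt, LinearEquiv.trans_apply]
  have : (LinearMap.quotKerEquivOfSurjective ((P.complex.linearYonedaObj R Y).homologyπ n).hom
    ((ModuleCat.epi_iff_surjective _).1 inferInstance)).symm
      ((P.complex.linearYonedaObj R Y).homologyπ n z) = Submodule.Quotient.mk z := by
    rw [LinearEquiv.symm_apply_eq]
    rfl
  rw [this]
  rfl

lemma homologyEquivExt_naturality {X X' : ModuleCat.{u} R} {P : ProjectiveResolution X}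
    {P' : ProjectiveResolution X'} {g : X' ⟶ X} (φ : ProjectiveResolution.Hom P' P g) (n : ℕ)
    (Y : ModuleCat.{u} R) (w : (P.complex.linearYonedaObj R Y).homology n) :
    homologyEquivExt P' Y n (HomologicalComplex.homologyMap (yonedaMap φ.hom Y) n w) =
      (Abelian.Ext.mk₀ g).comp (homologyEquivExt P Y n w) (zero_add n) := by
  obtain ⟨z, rfl⟩ := (ModuleCat.epi_iff_surjective
    ((P.complex.linearYonedaObj R Y).homologyπ n)).1 inferInstance w
  have h := ConcreteCategory.congr_hom
    (HomologicalComplex.homologyπ_naturality (yonedaMap φ.hom Y) n) z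
  have h' : HomologicalComplex.homologyMap (yonedaMap φ.hom Y) n
      ((P.complex.linearYonedaObj R Y).homologyπ n z) =
      (P'.complex.linearYonedaObj R Y).homologyπ n
        (HomologicalComplex.cyclesMap (yonedaMap φ.hom Y) n z) := h
  rw [h', homologyEquivExt_π, homologyEquivExt_π, cyclesToExt_apply, cyclesToExt_apply,
    ProjectiveResolution.mk₀_comp_extMk _ _ _ _ φ]
  congr 1
  exact ConcreteCategory.congr_hom
    (HomologicalComplex.cyclesMap_i (yonedaMap φ.hom Y) n) z

/-- The two definitions of `Ext` agree. -/
noncomputable def extEquiv (X Y : ModuleCat.{u} R) (n : ℕ) :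
    ((Ext R (ModuleCat.{u} R) n).obj (op X)).obj Y ≃ₗ[R] Abelian.Ext.{u} X Y n :=
  ((projectiveResolution X).isoExt (R := R) n Y).toLinearEquiv ≪≫ₗ
    homologyEquivExt (projectiveResolution X) Y n

lemma extEquiv_naturality {X X' : ModuleCat.{u} R} (g : X' ⟶ X) (Y : ModuleCat.{u} R) (n : ℕ)
    (w : ((Ext R (ModuleCat.{u} R) n).obj (op X)).obj Y) :
    extEquiv X' Y n (((Ext R (ModuleCat.{u} R) n).map g.op).app Y w) =
      (Abelian.Ext.mk₀ g).comp (extEquiv X Y n w) (zero_add n) := by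
  let φ : ProjectiveResolution.Hom (projectiveResolution X') (projectiveResolution X) g :=
    ⟨ProjectiveResolution.lift g _ _, by
      have := ProjectiveResolution.lift_commutes_zero g (projectiveResolution X')
        (projectiveResolution X)
      simpa using this⟩
  have h := ConcreteCategory.congr_hom (isoExt_naturality φ n Y) w
  have h' : ((projectiveResolution X').isoExt (R := R) n Y).hom
      (((Ext R (ModuleCat.{u} R) n).map g.op).app Y w) =
      HomologicalComplex.homologyMap (yonedaMap φ.hom Y) n
        (((projectiveResolution X).isoExt (R := R) n Y).hom w) := h
  exact (congrArg (homologyEquivExt _ Y n) h').trans (homologyEquivExt_naturality φ n Y _)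

end OldExt

section LocalCohom

open CategoryTheory.Abelian

variable {R : Type u} [CommRing R] (J : Ideal R)

/-- `R ⧸ J ^ t` as an object of the category of modules. -/
abbrev powQuot (t : ℕ) : ModuleCat.{u} R := ModuleCat.of R (R ⧸ J ^ t)

/-- The projection `R ⧸ J ^ t → R ⧸ J ^ s`. -/
noncomputable def powProj {s t : ℕ} (h : s ≤ t) : powQuot J t ⟶ powQuot J s :=
  ModuleCat.ofHom (Submodule.mapQ (J ^ t) (J ^ s) LinearMap.id (Ideal.pow_le_pow_right h))

lemma powProj_self (t : ℕ) : powProj J (le_refl t) = 𝟙 _ := by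
  ext
  rfl

lemma powProj_comp {r s t : ℕ} (h : r ≤ s) (h' : s ≤ t) :
    powProj J h' ≫ powProj J h = powProj J (h.trans h') := by
  ext
  rfl

/-- The transition maps of the direct system defining local cohomology. -/
noncomputable def extTrans (M : ModuleCat.{u} R) (i : ℕ) (s t : ℕ) (h : s ≤ t) :
    Ext.{u} (powQuot J s) M i →ₗ[R] Ext.{u} (powQuot J t) M i :=
  (Ext.mk₀ (powProj J h)).precompOfLinear R M (zero_add i)

lemma extTrans_apply (M : ModuleCat.{u} R) (i : ℕ) {s t : ℕ} (h : s ≤ t)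
    (a : Ext.{u} (powQuot J s) M i) :
    extTrans J M i s t h a = (Ext.mk₀ (powProj J h)).comp a (zero_add i) := rfl

instance (M : ModuleCat.{u} R) (i : ℕ) :
    DirectedSystem (fun t => Ext.{u} (powQuot J t) M i) (extTrans J M i · · ·) where
  map_self t x := by
    rw [extTrans_apply, powProj_self, Ext.mk₀_id_comp]
  map_map r s t h h' x := by
    rw [extTrans_apply, extTrans_apply, extTrans_apply, Ext.mk₀_comp_mk₀_assoc, powProj_comp]

/-- Local cohomology, as a direct limit of modules of extensions. -/
abbrev LC (M : ModuleCat.{u} R) (i : ℕ) : Type u :=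
  Module.DirectLimit (fun t => Ext.{u} (powQuot J t) M i) (extTrans J M i)

/-- The canonical map from a module of extensions to local cohomology. -/
noncomputable def LC.of (M : ModuleCat.{u} R) (i t : ℕ) : Ext.{u} (powQuot J t) M i →ₗ[R] LC J M i :=
  Module.DirectLimit.of R ℕ _ (extTrans J M i) t

variable {J}

lemma LC.of_trans {M : ModuleCat.{u} R} {i s t : ℕ} (h : s ≤ t) (a : Ext.{u} (powQuot J s) M i) :
    LC.of J M i t ((Ext.mk₀ (powProj J h)).comp a (zero_add i)) = LC.of J M i s a :=
  Module.DirectLimit.of_f (f := extTrans J M i) (hij := h)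

lemma LC.exists_of {M : ModuleCat.{u} R} {i : ℕ} (z : LC J M i) : ∃ t a, LC.of J M i t a = z :=
  Module.DirectLimit.exists_of z

lemma LC.of_eq_zero {M : ModuleCat.{u} R} {i s : ℕ} {a : Ext.{u} (powQuot J s) M i}
    (h : LC.of J M i s a = 0) :
    ∃ (t : ℕ) (h : s ≤ t), (Ext.mk₀ (powProj J h)).comp a (zero_add i) = 0 :=
  Module.DirectLimit.of.zero_exact h

/-- A class of extensions induces a map in local cohomology. -/
noncomputable def LC.comp {M N : ModuleCat.{u} R} {n : ℕ} (β : Ext.{u} M N n) {i j : ℕ}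
    (h : i + n = j) : LC J M i →ₗ[R] LC J N j :=
  Module.DirectLimit.map (fun t => β.postcompOfLinear R (powQuot J t) h) (by
    intro s t hst
    refine LinearMap.ext fun a => ?_
    change ((Ext.mk₀ (powProj J hst)).comp a (zero_add i)).comp β h =
      (Ext.mk₀ (powProj J hst)).comp (a.comp β h) (zero_add j)
    rw [Ext.comp_assoc _ _ _ _ _ (by omega)])

lemma LC.comp_of {M N : ModuleCat.{u} R} {n : ℕ} (β : Ext.{u} M N n) {i j : ℕ}
    (h : i + n = j) (t : ℕ) (a : Ext.{u} (powQuot J t) M i) :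
    LC.comp β h (LC.of J M i t a) = LC.of J N j t (a.comp β h) :=
  Module.DirectLimit.map_apply_of _ _ _

lemma LC.comp_comp {M N P : ModuleCat.{u} R} {n p q : ℕ} (β : Ext.{u} M N n) (γ : Ext.{u} N P p)
    {i j l : ℕ} (h : i + n = j) (h' : j + p = l) (hq : n + p = q) (z : LC J M i) :
    LC.comp γ h' (LC.comp β h z) = LC.comp (β.comp γ hq) (by omega : i + q = l) z := by
  obtain ⟨t, a, rfl⟩ := LC.exists_of z
  rw [LC.comp_of, LC.comp_of, LC.comp_of, Ext.comp_assoc _ _ _ _ _ (by omega)]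

/-- The map in local cohomology induced by a linear map. -/
noncomputable abbrev LC.map {M N : ModuleCat.{u} R} (f : M ⟶ N) (i : ℕ) : LC J M i →ₗ[R] LC J N i :=
  LC.comp (Ext.mk₀ f) (add_zero i)

lemma LC.map_map {M N P : ModuleCat.{u} R} (f : M ⟶ N) (g : N ⟶ P) {i : ℕ} (z : LC J M i) :
    LC.map g i (LC.map f i z) = LC.map (f ≫ g) i z := by
  rw [LC.map, LC.map, LC.comp_comp _ _ _ _ (zero_add 0), Ext.mk₀_comp_mk₀]

lemma LC.map_smul_id {M : ModuleCat.{u} R} (r : R) {i : ℕ} (z : LC J M i) :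
    LC.map (r • 𝟙 M) i z = r • z := by
  obtain ⟨t, a, rfl⟩ := LC.exists_of z
  rw [LC.comp_of, ← Ext.smul_eq_comp_mk₀, map_smul]

lemma LC.map_id {M : ModuleCat.{u} R} {i : ℕ} (z : LC J M i) : LC.map (𝟙 M) i z = z := by
  have := LC.map_smul_id (1 : R) z
  rwa [one_smul, one_smul] at this

variable {S : ShortComplex (ModuleCat.{u} R)}

lemma LC.exact₂ (hS : S.ShortExact) {i : ℕ} (z : LC J S.X₂ i) (hz : LC.map S.g i z = 0) :
    ∃ y : LC J S.X₁ i, LC.map S.f i y = z := by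
  obtain ⟨s, a, rfl⟩ := LC.exists_of z
  rw [LC.comp_of] at hz
  obtain ⟨t, h, ha⟩ := LC.of_eq_zero hz
  rw [← Ext.comp_assoc _ _ _ (zero_add i) _ (by omega)] at ha
  obtain ⟨b, hb⟩ := Ext.covariant_sequence_exact₂ _ hS _ ha
  refine ⟨LC.of J _ _ t b, ?_⟩
  rw [LC.comp_of, hb, LC.of_trans]

lemma LC.exact₃ (hS : S.ShortExact) {i : ℕ} (z : LC J S.X₃ i) (hz : LC.comp hS.extClass (rfl : i + 1 = i + 1) z = 0) :
    ∃ y : LC J S.X₂ i, LC.map S.g i y = z := by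
  obtain ⟨s, a, rfl⟩ := LC.exists_of z
  rw [LC.comp_of] at hz
  obtain ⟨t, h, ha⟩ := LC.of_eq_zero hz
  rw [← Ext.comp_assoc _ _ _ (zero_add i) _ (by omega)] at ha
  obtain ⟨b, hb⟩ := Ext.covariant_sequence_exact₃ _ hS _ rfl ha
  refine ⟨LC.of J _ _ t b, ?_⟩
  rw [LC.comp_of, hb, LC.of_trans]

lemma LC.exact₁ (hS : S.ShortExact) {i : ℕ} (z : LC J S.X₁ (i + 1)) (hz : LC.map S.f (i + 1) z = 0) :
    ∃ y : LC J S.X₃ i, LC.comp hS.extClass rfl y = z := by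
  obtain ⟨s, a, rfl⟩ := LC.exists_of z
  rw [LC.comp_of] at hz
  obtain ⟨t, h, ha⟩ := LC.of_eq_zero hz
  rw [← Ext.comp_assoc _ _ _ (zero_add _) _ (by omega)] at ha
  obtain ⟨b, hb⟩ := Ext.covariant_sequence_exact₁ _ hS _ ha rfl
  refine ⟨LC.of J _ _ t b, ?_⟩
  rw [LC.comp_of, hb, LC.of_trans]

lemma LC.injective_zero (hS : S.ShortExact) (z : LC J S.X₁ 0) (hz : LC.map S.f 0 z = 0) : z = 0 := by
  obtain ⟨s, a, rfl⟩ := LC.exists_of z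
  rw [LC.comp_of] at hz
  obtain ⟨t, h, ha⟩ := LC.of_eq_zero hz
  rw [← Ext.comp_assoc _ _ _ (zero_add _) _ (by omega)] at ha
  have := hS.mono_f
  have h0 : (Ext.mk₀ (powProj J h)).comp a (zero_add 0) = 0 :=
    Ext.postcomp_mk₀_injective_of_mono (powQuot J t) S.f (by rw [map_zero]; exact ha)
  rw [← LC.of_trans h, h0, map_zero]

end LocalCohom

section Compare

open CategoryTheory.Abelian

variable {R : Type u} [CommRing R] (J : Ideal R) (i : ℕ) (M : ModuleCat.{u} R)

/-- The direct system defining `localCohomology`, evaluated at `M`. -/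
noncomputable def lcDiag : ℕᵒᵖᵒᵖ ⥤ ModuleCat.{u} R :=
  localCohomology.diagram (localCohomology.idealPowersDiagram J) i ⋙ (evaluation _ _).obj M

/-- The evaluation of the colimit is the colimit of the evaluations. -/
noncomputable def lcIso : (localCohomology J i).obj M ≅ colimit (lcDiag J i M) :=
  haveI := localCohomology.hasColimitDiagram.{u, 0} (localCohomology.idealPowersDiagram J) i
  colimitObjIsoColimitCompEvaluation
    (localCohomology.diagram (localCohomology.idealPowersDiagram J) i) M

/-- The canonical map from a module of extensions to the colimit. -/
noncomputable def lcIn (t : ℕ) : Ext.{u} (powQuot J t) M i →ₗ[R] ↥(colimit (lcDiag J i M)) :=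
  (colimit.ι (lcDiag J i M) (op (op t))).hom ∘ₗ
    (extEquiv (powQuot J t) M i).symm.toLinearMap

lemma lcIn_apply (t : ℕ) (w : ((Ext R (ModuleCat.{u} R) i).obj (op (powQuot J t))).obj M) :
    lcIn J i M t (extEquiv (powQuot J t) M i w) =
      (colimit.ι (lcDiag J i M) (op (op t))).hom w := by
  exact congrArg _ (LinearEquiv.symm_apply_apply _ _)

/-- The arrow of `ℕᵒᵖᵒᵖ` attached to an inequality. -/
def opOpHom {s t : ℕ} (h : s ≤ t) : (op (op s) : ℕᵒᵖᵒᵖ) ⟶ op (op t) := (homOfLE h).op.op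

lemma extEquiv_lcDiag {s t : ℕ} (h : s ≤ t)
    (w : ((Ext R (ModuleCat.{u} R) i).obj (op (powQuot J s))).obj M) :
    extEquiv (powQuot J t) M i ((lcDiag J i M).map (opOpHom h) w) =
      (Ext.mk₀ (powProj J h)).comp (extEquiv (powQuot J s) M i w) (zero_add i) :=
  extEquiv_naturality (powProj J h) M i w

lemma lcIn_trans {s t : ℕ} (h : s ≤ t) (a : Ext.{u} (powQuot J s) M i) :
    lcIn J i M t ((Ext.mk₀ (powProj J h)).comp a (zero_add i)) = lcIn J i M s a := by
  obtain ⟨w, rfl⟩ := (extEquiv (powQuot J s) M i).surjective a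
  rw [← extEquiv_lcDiag]
  refine (lcIn_apply J i M t _).trans (Eq.trans ?_ (lcIn_apply J i M s w).symm)
  exact ConcreteCategory.congr_hom (colimit.w (lcDiag J i M) (opOpHom h)) w

/-- The comparison map of the two descriptions of local cohomology. -/
noncomputable def lcCompare : LC J M i →ₗ[R] ↥(colimit (lcDiag J i M)) :=
  Module.DirectLimit.lift R ℕ _ _ (lcIn J i M) (fun s t h a => lcIn_trans J i M h a)

lemma lcCompare_of (t : ℕ) (a : Ext.{u} (powQuot J t) M i) :
    lcCompare J i M (LC.of J M i t a) = lcIn J i M t a :=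
  Module.DirectLimit.lift_of _ _ _

instance : PreservesColimit (lcDiag J i M) (forget (ModuleCat.{u} R)) := by
  have := preservesFilteredColimitsOfSize_shrink.{0, u, 0, u} (forget (ModuleCat.{u} R))
  have : PreservesColimitsOfShape ℕᵒᵖᵒᵖ (forget (ModuleCat.{u} R)) :=
    PreservesFilteredColimitsOfSize.preserves_filtered_colimits _
  infer_instance

lemma lcCompare_bijective : Function.Bijective (lcCompare J i M) := by
  constructor
  · rw [injective_iff_map_eq_zero]
    intro z hz
    obtain ⟨s, a, rfl⟩ := LC.exists_of z
    obtain ⟨w, rfl⟩ := (extEquiv (powQuot J s) M i).surjective a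
    rw [lcCompare_of] at hz
    have hz' := (lcIn_apply J i M s w).symm.trans hz
    obtain ⟨j, f, hf⟩ := Concrete.colimit_rep_eq_zero R (lcDiag J i M) (op (op s)) w hz'
    obtain ⟨h⟩ : Nonempty (s ≤ j.unop.unop) := ⟨leOfHom f.unop.unop⟩
    have hf' : (lcDiag J i M).map (opOpHom h) w = 0 := hf
    rw [← LC.of_trans h, ← extEquiv_lcDiag, hf']
    exact (congrArg _ (map_zero _)).trans (map_zero _)
  · intro y
    obtain ⟨j, w, rfl⟩ := Concrete.colimit_exists_rep (lcDiag J i M) y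
    refine ⟨LC.of J M i j.unop.unop (extEquiv (powQuot J j.unop.unop) M i w), ?_⟩
    rw [lcCompare_of]
    exact lcIn_apply J i M _ w

/-- The two descriptions of local cohomology agree. -/
noncomputable def lcEquiv : LC J M i ≃ₗ[R] ((localCohomology J i).obj M : ModuleCat.{u} R) :=
  LinearEquiv.ofBijective _ (lcCompare_bijective J i M) ≪≫ₗ (lcIso J i M).symm.toLinearEquiv

end Compare

/-- The comparison isomorphism for the local cohomology of a module over a local ring. -/
noncomputable def hmodEquiv {R : Type u} [CommRing R] [IsLocalRing R] (M : Type u) [AddCommGroup M]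
    [Module R M] (i : ℕ) : LC (maximalIdeal R) (ModuleCat.of R M) i ≃ₗ[R] Hmod R M i :=
  lcEquiv _ _ _

section LocalCohomTools

open CategoryTheory.Abelian

variable {R : Type u} [CommRing R]

lemma smul_id_eq_zero {X : ModuleCat.{u} R} {r : R} (h : ∀ x : X, r • x = 0) : r • 𝟙 X = 0 := by
  ext x
  exact h x

lemma ext_smul_eq_zero_left {X Y : ModuleCat.{u} R} {n : ℕ} {r : R} (h : ∀ x : X, r • x = 0)
    (a : Ext.{u} X Y n) : r • a = 0 := by
  rw [← Ext.mk₀_id_comp a, ← Ext.smul_comp, ← Ext.mk₀_smul, smul_id_eq_zero h, Ext.mk₀_zero,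
    Ext.zero_comp]

lemma ext_smul_eq_zero_right {X Y : ModuleCat.{u} R} {n : ℕ} {r : R} (h : ∀ y : Y, r • y = 0)
    (a : Ext.{u} X Y n) : r • a = 0 := by
  rw [Ext.smul_eq_comp_mk₀, smul_id_eq_zero h, Ext.mk₀_zero, Ext.comp_zero]

variable {J : Ideal R}

lemma LC.torsion {M : ModuleCat.{u} R} {i : ℕ} (z : LC J M i) : ∃ t, ∀ r ∈ J ^ t, r • z = 0 := by
  obtain ⟨t, a, rfl⟩ := LC.exists_of z
  refine ⟨t, fun r hr => ?_⟩
  rw [← map_smul, ext_smul_eq_zero_left, map_zero]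
  intro x
  obtain ⟨x, rfl⟩ := Submodule.mkQ_surjective _ x
  rw [← map_smul, Submodule.mkQ_apply, Submodule.Quotient.mk_eq_zero]
  exact Ideal.mul_mem_right _ _ hr

lemma LC.smul_eq_zero {M : ModuleCat.{u} R} {i : ℕ} {r : R} (h : ∀ y : M, r • y = 0)
    (z : LC J M i) : r • z = 0 := by
  obtain ⟨t, a, rfl⟩ := LC.exists_of z
  rw [← map_smul, ext_smul_eq_zero_right h, map_zero]

/-- Extensions of a finite module by a module killed by a power of `J` vanish on submodules deep
in the `J`-adic filtration. -/
lemma ext_restrict_eq_zero [IsNoetherianRing R] {N : ModuleCat.{u} R} {n : ℕ}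
    (hN : ∀ r ∈ J ^ n, ∀ y : N, r • y = 0) (j : ℕ) : ∀ (X : Type u) [AddCommGroup X] [Module R X]
    [Module.Finite R X], ∃ s, ∀ (Y : Type u) [AddCommGroup Y] [Module R Y] (g : Y →ₗ[R] X),
      (∀ y, g y ∈ (J ^ s • ⊤ : Submodule R X)) → ∀ a : Ext.{u} (ModuleCat.of R X) N j,
        (Ext.mk₀ (ModuleCat.ofHom g)).comp a (zero_add j) = 0 := by
  induction j with
  | zero =>
    intro X _ _ _
    refine ⟨n, fun Y _ _ g hg a => ?_⟩
    obtain ⟨f, rfl⟩ := (Ext.mk₀_bijective _ _).2 a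
    rw [Ext.mk₀_comp_mk₀]
    have : ∀ x ∈ (J ^ n • ⊤ : Submodule R X), f.hom x = 0 := by
      intro x hx
      refine Submodule.smul_induction_on hx (fun r hr v _ => ?_) (fun v w hv hw => ?_)
      · rw [map_smul]
        exact hN r hr _
      · rw [map_add, hv, hw, add_zero]
    have h0 : ModuleCat.ofHom g ≫ f = 0 := by
      apply ModuleCat.hom_ext
      exact LinearMap.ext fun y => this _ (hg y)
    rw [h0, Ext.mk₀_zero]
  | succ j ih =>
    intro X _ _ _
    obtain ⟨m, π, hπ⟩ := Module.Finite.exists_fin' R X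
    let F : Type u := Fin m → R
    have hπS := LinearMap.shortExact_shortComplexKer (f := (π : F →ₗ[R] X)) hπ
    obtain ⟨s₀, hs₀⟩ := ih (LinearMap.ker (π : F →ₗ[R] X))
    obtain ⟨c, hc⟩ := Ideal.exists_pow_inf_eq_pow_smul J (LinearMap.ker (π : F →ₗ[R] X))
    refine ⟨s₀ + c, fun Y _ _ g hg a => ?_⟩
    have hproj : Projective (ModuleCat.of R F) :=
      (IsProjective.iff_projective (R := R) F).1 inferInstance
    obtain ⟨b, rfl⟩ := Ext.contravariant_sequence_exact₃ hπS N a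
      (Ext.eq_zero_of_projective _) (by omega : 1 + j = j + 1)
    have hlift : ∀ y : Y, ∃ v ∈ (J ^ (s₀ + c) • ⊤ : Submodule R F), π v = g y := by
      intro y
      have := hg y
      rw [← LinearMap.range_eq_top.2 hπ, ← Submodule.map_top, ← Submodule.map_smul''] at this
      obtain ⟨v, hv, h⟩ := this
      exact ⟨v, hv, h⟩
    choose v hv hvg using hlift
    obtain ⟨P, _, _, Φ, ρ, hρ, hΦρ, hΦ⟩ : ∃ (P : Type u) (_ : AddCommGroup P) (_ : Module R P)
        (Φ : P →ₗ[R] F) (ρ : P →ₗ[R] Y), Function.Surjective ρ ∧ (∀ w, π (Φ w) = g (ρ w)) ∧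
        ∀ w, Φ w ∈ (J ^ (s₀ + c) • ⊤ : Submodule R F) := by
      refine ⟨Y →₀ R, inferInstance, inferInstance, Finsupp.linearCombination R v,
        Finsupp.linearCombination R id, Finsupp.linearCombination_id_surjective R Y, ?_, ?_⟩
      · intro w
        have : (π : F →ₗ[R] X) ∘ₗ Finsupp.linearCombination R v =
            g ∘ₗ Finsupp.linearCombination R id := by
          ext y
          simp [hvg]
        exact LinearMap.congr_fun this w
      · intro w
        rw [Finsupp.linearCombination_apply]
        exact Submodule.sum_mem _ fun y _ => Submodule.smul_mem _ _ (hv y)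
    have hκ : ∀ w : LinearMap.ker ρ, Φ w ∈ LinearMap.ker (π : F →ₗ[R] X) := by
      intro w
      rw [LinearMap.mem_ker, hΦρ, LinearMap.mem_ker.1 w.2, map_zero]
    let κ : LinearMap.ker ρ →ₗ[R] LinearMap.ker (π : F →ₗ[R] X) :=
      (Φ ∘ₗ (LinearMap.ker ρ).subtype).codRestrict _ hκ
    have hρS := LinearMap.shortExact_shortComplexKer (f := ρ) hρ
    let φ : ρ.shortComplexKer ⟶ (π : F →ₗ[R] X).shortComplexKer :=
      { τ₁ := ModuleCat.ofHom κ
        τ₂ := ModuleCat.ofHom Φ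
        τ₃ := ModuleCat.ofHom g
        comm₁₂ := by ext w; rfl
        comm₂₃ := by
          apply ModuleCat.hom_ext
          refine LinearMap.ext fun w => ?_
          exact hΦρ w }
    have hnat := ShortComplex.ShortExact.extClass_naturality hρS hπS φ
    have hκ0 : (Ext.mk₀ (ModuleCat.ofHom κ)).comp b (zero_add j) = 0 := by
      refine hs₀ _ κ (fun w => ?_) b
      have h1 : Φ w ∈ J ^ (s₀ + c) • (⊤ : Submodule R F) ⊓ LinearMap.ker (π : F →ₗ[R] X) :=
        ⟨hΦ _, hκ w⟩
      rw [hc _ (by omega), Nat.add_sub_cancel] at h1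
      have h2 : Φ w ∈ J ^ s₀ • LinearMap.ker (π : F →ₗ[R] X) :=
        Submodule.smul_mono le_rfl inf_le_right h1
      have h3 : J ^ s₀ • LinearMap.ker (π : F →ₗ[R] X) =
          (J ^ s₀ • ⊤ : Submodule R (LinearMap.ker (π : F →ₗ[R] X))).map
            (LinearMap.ker (π : F →ₗ[R] X)).subtype := by
        rw [Submodule.map_smul'', Submodule.map_subtype_top]
      rw [h3] at h2
      obtain ⟨u, hu, hu'⟩ := h2
      have : κ w = u := Subtype.ext hu'.symm
      rwa [this]
    have hnat' : hρS.extClass.comp (Ext.mk₀ (ModuleCat.ofHom κ)) (add_zero 1) =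
      (Ext.mk₀ (ModuleCat.ofHom g)).comp hπS.extClass (zero_add 1) := hnat
    rw [← Ext.comp_assoc _ _ _ (zero_add 1) _ (by omega)]
    refine (congrArg (fun e => Ext.comp e b (by omega : 1 + j = j + 1)) hnat'.symm).trans ?_
    change (hρS.extClass.comp (Ext.mk₀ (ModuleCat.ofHom κ)) (add_zero 1)).comp b _ = 0
    rw [Ext.comp_assoc _ _ _ _ (zero_add j) (by omega), hκ0, Ext.comp_zero]

/-- Local cohomology of a module killed by a power of the ideal vanishes in positive degrees. -/
lemma LC.eq_zero_of_pow_smul [IsNoetherianRing R] {N : ModuleCat.{u} R} {n : ℕ}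
    (hN : ∀ r ∈ J ^ n, ∀ y : N, r • y = 0) {j : ℕ} (z : LC J N (j + 1)) : z = 0 := by
  obtain ⟨t, a, rfl⟩ := LC.exists_of z
  have hS : ∀ t, (J ^ t).mkQ.shortComplexKer.ShortExact := fun t =>
    LinearMap.shortExact_shortComplexKer (f := (J ^ t).mkQ) (Submodule.mkQ_surjective _)
  have hproj : Projective (ModuleCat.of R R) :=
    (IsProjective.iff_projective (R := R) R).1 inferInstance
  obtain ⟨b, rfl⟩ := Ext.contravariant_sequence_exact₃ (hS t) N a
    (Ext.eq_zero_of_projective _) (by omega : 1 + j = j + 1)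
  obtain ⟨s, hs⟩ := ext_restrict_eq_zero hN j (LinearMap.ker (J ^ t).mkQ)
  have hle : LinearMap.ker (J ^ (s + t)).mkQ ≤ LinearMap.ker (J ^ t).mkQ := by
    rw [Submodule.ker_mkQ, Submodule.ker_mkQ]
    exact Ideal.pow_le_pow_right (by omega)
  let κ := Submodule.inclusion hle
  let φ : (J ^ (s + t)).mkQ.shortComplexKer ⟶ (J ^ t).mkQ.shortComplexKer :=
    { τ₁ := ModuleCat.ofHom κ
      τ₂ := 𝟙 _
      τ₃ := powProj J (by omega : t ≤ s + t)
      comm₁₂ := by ext w; rfl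
      comm₂₃ := by
        apply ModuleCat.hom_ext
        refine LinearMap.ext fun w => ?_
        rfl }
  have hnat : (hS (s + t)).extClass.comp (Ext.mk₀ (ModuleCat.ofHom κ)) (add_zero 1) =
      (Ext.mk₀ (powProj J (by omega : t ≤ s + t))).comp (hS t).extClass (zero_add 1) :=
    ShortComplex.ShortExact.extClass_naturality (hS (s + t)) (hS t) φ
  have hκ0 : (Ext.mk₀ (ModuleCat.ofHom κ)).comp b (zero_add j) = 0 := by
    refine hs _ κ (fun w => ?_) b
    have hw : (w : R) ∈ J ^ s * J ^ t := by
      rw [← pow_add]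
      have := LinearMap.mem_ker.1 w.2
      rwa [Submodule.mkQ_apply, Submodule.Quotient.mk_eq_zero] at this
    have h3 : (J ^ s * J ^ t : Ideal R) =
        (J ^ s • ⊤ : Submodule R (LinearMap.ker (J ^ t).mkQ)).map
          (LinearMap.ker (J ^ t).mkQ).subtype := by
      rw [Submodule.map_smul'', Submodule.map_subtype_top, Submodule.ker_mkQ]
      rfl
    rw [h3] at hw
    obtain ⟨u, hu, hu'⟩ := hw
    have : κ w = u := Subtype.ext hu'.symm
    rwa [this]
  rw [← LC.of_trans (by omega : t ≤ s + t)]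
  convert map_zero (LC.of J N (j + 1) (s + t)) using 2
  rw [← Ext.comp_assoc _ _ _ (zero_add 1) _ (by omega)]
  refine (congrArg (fun e => Ext.comp e b (by omega : 1 + j = j + 1)) hnat.symm).trans ?_
  change ((hS (s + t)).extClass.comp (Ext.mk₀ (ModuleCat.ofHom κ)) (add_zero 1)).comp b _ = 0
  rw [Ext.comp_assoc _ _ _ _ (zero_add j) (by omega), hκ0, Ext.comp_zero]

end LocalCohomTools

section Lengths

variable {R : Type u} [CommRing R]

lemma length_le_of_exact {A B C : Type*} [AddCommGroup A] [AddCommGroup B] [AddCommGroup C]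
    [Module R A] [Module R B] [Module R C] (f : A →ₗ[R] B) (g : B →ₗ[R] C)
    (h : ∀ b, g b = 0 → ∃ a, f a = b) :
    Module.length R B ≤ Module.length R A + Module.length R C := by
  rw [length_eq_ker_add_range g]
  refine add_le_add ?_ (Module.length_le_of_injective (LinearMap.range g).subtype
    (Submodule.injective_subtype _))
  have hle : LinearMap.ker g ≤ LinearMap.range f := fun b hb => h b hb
  exact (Module.length_le_of_injective _ (Submodule.inclusion_injective hle)).trans
    (Module.length_le_of_surjective _ (LinearMap.surjective_rangeRestrict f))

lemma length_ne_top_of_pow_smul [IsLocalRing R] [IsNoetherianRing R] (N : Type*) [AddCommGroup N]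
    [Module R N] (hN : Module.Finite R N) {t : ℕ}
    (h : ∀ r ∈ maximalIdeal R ^ t, ∀ y : N, r • y = 0) : Module.length R N ≠ ⊤ := by
  induction hN using IsNoetherianRing.induction_on_isQuotientEquivQuotientPrime R with
  | subsingleton N => rw [Module.length_eq_zero]; exact ENat.zero_ne_top
  | quotient N p f =>
    have hp : p.1 = maximalIdeal R := by
      refine le_antisymm (le_maximalIdeal p.2.ne_top) ?_
      have : maximalIdeal R ^ t ≤ p.1 := by
        intro r hr
        rw [← Ideal.Quotient.eq_zero_iff_mem]
        have h1 := h r hr (f.symm 1)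
        rw [← map_smul, LinearEquiv.map_eq_zero_iff, Algebra.smul_def, mul_one] at h1
        exact h1
      exact p.2.le_of_pow_le this
    rw [f.length_eq, hp]
    have : IsSimpleModule R (R ⧸ maximalIdeal R) :=
      isSimpleModule_iff_isCoatom.2 (maximalIdeal.isMaximal R).1
    rw [Module.length_eq_one]
    exact ENat.one_ne_top
  | exact N₁ N₂ N₃ f g hf hg hfg h₁ h₃ =>
    have h1 := h₁ fun r hr y => hf (by rw [map_smul, h r hr, map_zero])
    have h3 := h₃ fun r hr y => by
      obtain ⟨y, rfl⟩ := hg y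
      rw [← map_smul, h r hr, map_zero]
    have := length_le_of_exact f g fun b hb => (hfg b).1 hb
    exact ne_top_of_le_ne_top (WithTop.add_ne_top.2 ⟨h1, h3⟩) this

lemma pow_smul_of_length_le [IsLocalRing R] (N : Type*) [AddCommGroup N]
    [Module R N] {t : ℕ} (h : Module.length R N ≤ t) :
    ∀ r ∈ maximalIdeal R ^ t, ∀ y : N, r • y = 0 := by
  induction t generalizing N with
  | zero =>
    have : Subsingleton N := (Module.length_eq_zero_iff (R := R)).1 (by simpa using h)
    intro r _ y
    exact Subsingleton.elim _ _
  | succ t ih =>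
    rcases subsingleton_or_nontrivial N with hN | hN
    · intro r _ y
      exact Subsingleton.elim _ _
    have hfl : IsFiniteLength R N := Module.length_ne_top_iff.1
      (ne_top_of_le_ne_top (ENat.natCast_ne_top _) h)
    have hfin : Module.Finite R N := by
      have := (isFiniteLength_iff_isNoetherian_isArtinian.1 hfl).1
      infer_instance
    set N' : Submodule R N := maximalIdeal R • (⊤ : Submodule R N) with hN'
    have hne : N' ≠ ⊤ := by
      intro he
      have := Submodule.eq_bot_of_le_smul_of_le_jacobson_bot (maximalIdeal R) ⊤ hfin.1
        (by rw [← hN', he]) (maximalIdeal_le_jacobson ⊥)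
      exact (bot_ne_top this.symm : False)
    have hadd := Module.length_eq_add_of_exact N'.subtype N'.mkQ N'.subtype_injective
      N'.mkQ_surjective (LinearMap.exact_subtype_mkQ N')
    have hq : Module.length R (N ⧸ N') ≠ 0 := by
      rw [Ne, Module.length_eq_zero_iff, Submodule.Quotient.subsingleton_iff]
      exact hne
    have hle : Module.length R N' ≤ t := by
      have h1 : Module.length R N' + 1 ≤ (t : ℕ∞) + 1 :=
        (add_le_add le_rfl (Order.one_le_iff_ne_zero.2 hq)).trans
          (hadd ▸ h.trans (by push_cast; rfl))
      exact (ENat.add_le_add_iff_right ENat.one_ne_top).1 h1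
    have hk := ih N' hle
    intro r hr y
    rw [pow_succ] at hr
    induction hr using Submodule.mul_induction_on' with
    | mem_mul_mem a ha b hb =>
      have := hk a ha ⟨b • y, Submodule.smul_mem_smul hb trivial⟩
      rw [mul_smul]
      exact congrArg Subtype.val this
    | add a _ b _ h1 h2 => rw [add_smul, h1, h2, add_zero]

end Lengths

section LocalCohomLengths

open CategoryTheory.Abelian

variable {R : Type u} [CommRing R] {J : Ideal R} {M : ModuleCat.{u} R}

/-- The value at `1` of a homomorphism from `R ⧸ J ^ t`. -/
noncomputable def extEval (t : ℕ) : Ext.{u} (powQuot J t) M 0 →ₗ[R] M :=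
  LinearMap.applyₗ (1 : R ⧸ J ^ t) ∘ₗ ModuleCat.homLinearEquiv.toLinearMap ∘ₗ
    (Ext.linearEquiv₀ (R := R)).toLinearMap

lemma extEval_mk₀ (t : ℕ) (f : powQuot J t ⟶ M) :
    extEval t (Ext.mk₀ f) = f.hom (1 : R ⧸ J ^ t) := by
  have : Ext.linearEquiv₀ (R := R) (Ext.mk₀ f) = f :=
    (Ext.linearEquiv₀ (R := R)).apply_symm_apply f
  simp only [extEval, LinearMap.comp_apply, LinearEquiv.coe_coe, this]
  rfl

/-- The natural map from the zeroth local cohomology module. -/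
noncomputable def LC.toModule : LC J M 0 →ₗ[R] M :=
  Module.DirectLimit.lift R ℕ _ _ extEval (by
    intro s t h a
    obtain ⟨f, rfl⟩ := (Ext.mk₀_bijective _ _).2 a
    rw [extTrans_apply, Ext.mk₀_comp_mk₀, extEval_mk₀, extEval_mk₀]
    rfl)

lemma LC.toModule_of (t : ℕ) (f : powQuot J t ⟶ M) :
    LC.toModule (LC.of J M 0 t (Ext.mk₀ f)) = f.hom (1 : R ⧸ J ^ t) :=
  (Module.DirectLimit.lift_of _ _ _).trans (extEval_mk₀ t f)

lemma LC.toModule_injective : Function.Injective (LC.toModule (J := J) (M := M)) := by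
  rw [injective_iff_map_eq_zero]
  intro z hz
  obtain ⟨t, a, rfl⟩ := LC.exists_of z
  obtain ⟨f, rfl⟩ := (Ext.mk₀_bijective _ _).2 a
  rw [LC.toModule_of] at hz
  have : f = 0 := by
    apply ModuleCat.hom_ext
    refine LinearMap.ext fun x => ?_
    obtain ⟨x, rfl⟩ := Submodule.mkQ_surjective _ x
    have h1 : (J ^ t).mkQ x = x • (1 : R ⧸ J ^ t) := by
      rw [Algebra.smul_def, mul_one]; rfl
    rw [h1, map_smul, hz, smul_zero]
    rfl
  rw [this, Ext.mk₀_zero, map_zero]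

lemma LC.mem_range_toModule {t : ℕ} {u : M} (h : ∀ r ∈ J ^ t, r • u = 0) :
    u ∈ LinearMap.range (LC.toModule (J := J) (M := M)) := by
  refine ⟨LC.of J M 0 t (Ext.mk₀ (ModuleCat.ofHom
    ((J ^ t).liftQ (LinearMap.toSpanSingleton R M u) fun r hr => h r hr))), ?_⟩
  rw [LC.toModule_of]
  exact one_smul R u

lemma LC.length_zero_ne_top [IsLocalRing R] [IsNoetherianRing R] [Module.Finite R M] :
    Module.length R (LC (maximalIdeal R) M 0) ≠ ⊤ := by
  let N := LinearMap.range (LC.toModule (J := maximalIdeal R) (M := M))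
  have e : LC (maximalIdeal R) M 0 ≃ₗ[R] N := LinearEquiv.ofInjective _ LC.toModule_injective
  rw [e.length_eq]
  obtain ⟨S, hS⟩ : N.FG := IsNoetherian.noetherian N
  have hm : ∀ v ∈ N, ∃ t, ∀ r ∈ maximalIdeal R ^ t, r • v = 0 := by
    rintro _ ⟨z, rfl⟩
    obtain ⟨t, ht⟩ := z.torsion
    exact ⟨t, fun r hr => by rw [← map_smul, ht r hr, map_zero]⟩
  have hbd : ∃ t, ∀ v ∈ S, ∀ r ∈ maximalIdeal R ^ t, r • v = 0 := by
    have : ∀ v ∈ S, ∃ t, ∀ r ∈ maximalIdeal R ^ t, r • v = 0 := fun v hv =>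
      hm v (hS ▸ Submodule.subset_span hv)
    choose! τ hτ using this
    exact ⟨S.sup τ, fun v hv r hr => hτ v hv r (Ideal.pow_le_pow_right (Finset.le_sup hv) hr)⟩
  obtain ⟨t, ht⟩ := hbd
  refine length_ne_top_of_pow_smul N inferInstance (t := t) fun r hr y => ?_
  have hle : N ≤ LinearMap.ker (LinearMap.lsmul R M r) := by
    rw [← hS, Submodule.span_le]
    exact fun v hv => ht v hv r hr
  exact Subtype.ext (hle y.2)

lemma length_le_length_LC {U : Submodule R M} {t : ℕ} (h : ∀ u ∈ U, ∀ r ∈ J ^ t, r • u = 0) :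
    Module.length R U ≤ Module.length R (LC J M 0) := by
  rw [(LinearEquiv.ofInjective _ (LC.toModule_injective (J := J) (M := M))).length_eq]
  have hle : U ≤ LinearMap.range (LC.toModule (J := J) (M := M)) :=
    fun u hu => LC.mem_range_toModule (h u hu)
  exact Module.length_le_of_injective _ (Submodule.inclusion_injective hle)

end LocalCohomLengths

section Conversions

lemma ofFn_split {α : Type*} {s : ℕ} (x : Fin s → α) (i : Fin s) {p q : List α} {a : α}
    (h : List.ofFn x = p ++ a :: q) (hi : p.length = i) :
    a = x i ∧ x '' {j | j < i} = {b | b ∈ p} ∧ x '' {j | i < j} = {b | b ∈ q} := by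
  have hlen : s = p.length + (q.length + 1) := by
    have := congrArg List.length h
    simpa using this
  have hget : ∀ (j : ℕ) (hj : j < s), x ⟨j, hj⟩ = (p ++ a :: q)[j]'(by simp; omega) := by
    intro j hj
    simp [← h]
  refine ⟨?_, ?_, ?_⟩
  · have h1 := hget i i.2
    rw [List.getElem_append_right hi.le] at h1
    simpa [hi] using h1.symm
  · ext b
    simp only [Set.mem_image, Set.mem_ofPred_eq]
    constructor
    · rintro ⟨j, hj, rfl⟩
      have h1 := hget j j.2
      have hj' : (j : ℕ) < p.length := hi ▸ hj
      rw [List.getElem_append_left hj'] at h1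
      exact h1 ▸ List.getElem_mem _
    · intro hb
      obtain ⟨j, hj, rfl⟩ := List.getElem_of_mem hb
      refine ⟨⟨j, by omega⟩, (by rw [Fin.lt_def]; simpa [← hi] using hj), ?_⟩
      rw [hget, List.getElem_append_left hj]
  · ext b
    simp only [Set.mem_image, Set.mem_ofPred_eq]
    constructor
    · rintro ⟨j, hj, rfl⟩
      have h1 := hget j j.2
      have hj' : p.length < (j : ℕ) := hi ▸ hj
      rw [List.getElem_append_right hj'.le] at h1
      obtain ⟨k, hk⟩ : ∃ k, (j : ℕ) - p.length = k + 1 := ⟨j - p.length - 1, by omega⟩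
      simp only [hk, List.getElem_cons_succ] at h1
      exact h1 ▸ List.getElem_mem _
    · intro hb
      obtain ⟨j, hj, rfl⟩ := List.getElem_of_mem hb
      refine ⟨⟨p.length + (j + 1), by omega⟩, (by rw [Fin.lt_def]; simp [← hi]), ?_⟩
      rw [hget, List.getElem_append_right (by omega)]
      simp

lemma exists_ofFn_split {α : Type*} {s : ℕ} (x : Fin s → α) (i : Fin s) :
    ∃ p q, List.ofFn x = p ++ x i :: q ∧ p.length = i := by
  refine ⟨(List.ofFn x).take i, (List.ofFn x).drop (i + 1), ?_, by simp⟩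
  have h : (i : ℕ) < (List.ofFn x).length := by simp
  conv_lhs => rw [← List.take_append_drop i (List.ofFn x), List.drop_eq_getElem_cons h]
  simp

variable {R : Type u} [CommRing R] [IsLocalRing R] [IsNoetherianRing R]

lemma length_quot_ne_top {J : Ideal R} (h : maximalIdeal R ≤ J.radical) :
    Module.length R (R ⧸ J) ≠ ⊤ := by
  obtain ⟨t, ht⟩ := Ideal.exists_pow_le_of_le_radical_of_fg h (IsNoetherian.noetherian _)
  refine length_ne_top_of_pow_smul _ inferInstance (t := t) fun r hr y => ?_
  obtain ⟨y, rfl⟩ := Submodule.mkQ_surjective _ y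
  rw [← map_smul, Submodule.mkQ_apply, Submodule.Quotient.mk_eq_zero]
  exact J.mul_mem_right _ (ht hr)

lemma isFiniteLength_quot_iff {J : Ideal R} :
    IsFiniteLength R (R ⧸ J) ↔ maximalIdeal R ≤ J.radical := by
  rw [← Module.length_ne_top_iff]
  refine ⟨fun h => ?_, length_quot_ne_top⟩
  obtain ⟨t, ht⟩ := ENat.ne_top_iff_exists.1 h
  have := pow_smul_of_length_le (R ⧸ J) ht.symm.le
  intro r hr
  refine ⟨t, ?_⟩
  have h1 := this (r ^ t) (Ideal.pow_mem_pow hr t) (J.mkQ 1)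
  rw [← map_smul, smul_eq_mul, mul_one, Submodule.mkQ_apply, Submodule.Quotient.mk_eq_zero] at h1
  exact h1

variable {M : Type u} [AddCommGroup M] [Module R M] {T : Ideal R} {π : R →ₗ[R] M}

lemma moduleDim_eq (hπ : Function.Surjective π) (hT : LinearMap.ker π = T) :
    moduleDim R M = qdim T := by
  have e := π.quotKerEquivOfSurjective hπ
  rw [hT] at e
  rw [moduleDim, qdim, ← e.annihilator_eq, Ideal.annihilator_quotient]

/-- Quotients of a cyclic module. -/
noncomputable def quotSmulEquiv (hπ : Function.Surjective π) (hT : LinearMap.ker π = T)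
    (J : Ideal R) : (R ⧸ (T ⊔ J)) ≃ₗ[R] (M ⧸ (J • (⊤ : Submodule R M))) :=
  (Submodule.quotEquivOfEq _ _ (ker_mkQ_smul_top_comp hπ hT J).symm).trans
    (((J • (⊤ : Submodule R M)).mkQ ∘ₗ π).quotKerEquivOfSurjective (surjective_mkQ_comp hπ _))

lemma isSOP_iff (hπ : Function.Surjective π) (hT : LinearMap.ker π = T) {s : ℕ} (x : Fin s → R) :
    IsSOP R M x ↔ PSys T (List.ofFn x) := by
  have hspan : Ideal.span (Set.range x) = Ideal.ofList (List.ofFn x) := by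
    rw [Ideal.ofList]
    congr 1
    ext b
    simp
  rw [IsSOP, moduleDim_eq hπ hT, ← Module.length_ne_top_iff, ← (quotSmulEquiv hπ hT _).length_eq,
    Module.length_ne_top_iff, isFiniteLength_quot_iff, hspan]
  constructor
  · rintro ⟨h1, h2, h3⟩
    refine ⟨by simpa using h1, ?_, h3⟩
    intro a ha
    obtain ⟨i, rfl⟩ := (List.mem_ofFn' _ _).1 ha
    exact h2 i
  · intro h
    exact ⟨by simpa using h.dim, fun i => h.mem _ ((List.mem_ofFn' _ _).2 ⟨i, rfl⟩), h.rad⟩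

lemma bIdeal_eq (hπ : Function.Surjective π) (hT : LinearMap.ker π = T) :
    bIdeal R M = bT T := by
  have key : ∀ (c a : R) (J : Ideal R),
      c ∈ (Submodule.torsionBy R (M ⧸ (J • (⊤ : Submodule R M))) a).annihilator ↔
      ∀ v, a * v ∈ T ⊔ J → c * v ∈ T ⊔ J := by
    intro c a J
    have hk := ker_mkQ_smul_top_comp hπ hT J
    set φ := (J • (⊤ : Submodule R M)).mkQ ∘ₗ π with hφ
    have hs : Function.Surjective φ := surjective_mkQ_comp hπ _
    rw [Submodule.mem_annihilator]
    constructor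
    · intro h v hv
      rw [← hk, LinearMap.mem_ker, ← smul_eq_mul, map_smul] at hv ⊢
      exact h _ hv
    · intro h n hn
      obtain ⟨v, rfl⟩ := hs n
      have := h v
      rw [← hk, LinearMap.mem_ker, LinearMap.mem_ker, ← smul_eq_mul, ← smul_eq_mul,
        map_smul, map_smul] at this
      exact this hn
  ext c
  simp only [bIdeal, Submodule.mem_iInf, key]
  constructor
  · intro h p a q hP v hv
    set l := p ++ a :: q with hl
    have hl' : List.ofFn l.get = p ++ a :: q := by rw [List.ofFn_get]
    let i : Fin l.length := ⟨p.length, by simp [hl]⟩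
    obtain ⟨h1, h2, -⟩ := ofFn_split l.get i hl' rfl
    have := h l.length l.get ((isSOP_iff hπ hT _).2 (by rwa [hl'])) i v
    rw [← h1, h2] at this
    exact this hv
  · intro h s x hx i v hv
    obtain ⟨p, q, h1, h2⟩ := exists_ofFn_split x i
    obtain ⟨-, h3, -⟩ := ofFn_split x i h1 h2
    rw [h3] at hv ⊢
    exact h p (x i) q (h1 ▸ (isSOP_iff hπ hT _).1 hx) v hv

lemma isCSOP_iff {s : ℕ} (x : Fin s → R) : IsCSOP R R x ↔ CSys (List.ofFn x) := by
  have hid : Function.Surjective (LinearMap.id : R →ₗ[R] R) := Function.surjective_id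
  have hk : LinearMap.ker (LinearMap.id : R →ₗ[R] R) = ⊥ := LinearMap.ker_id
  have hb : ∀ J : Ideal R, bIdeal R (R ⧸ (J • (⊤ : Submodule R R))) = bT J := by
    intro J
    rw [bIdeal_eq (surjective_mkQ_comp hid _) (ker_mkQ_smul_top_comp hid hk J), bot_sup_eq]
  have hiff := isSOP_iff hid hk x
  simp only [IsCSOP, hb, hiff]
  constructor
  · rintro ⟨h1, h2⟩
    refine ⟨h1, cTail_iff.2 fun p a q hl => ?_⟩
    have hlt : p.length < s := by
      have := congrArg List.length hl
      simp at this
      omega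
    obtain ⟨h3, -, h4⟩ := ofFn_split x ⟨p.length, hlt⟩ hl rfl
    have := h2 ⟨p.length, hlt⟩
    rw [h4, ← h3] at this
    exact this
  · rintro ⟨h1, h2⟩
    refine ⟨h1, fun i => ?_⟩
    obtain ⟨p, q, h3, h4⟩ := exists_ofFn_split x i
    obtain ⟨-, -, h5⟩ := ofFn_split x i h3 h4
    rw [h5]
    exact cTail_iff.1 h2 p (x i) q h3

lemma isCParamIdeal_iff {q : Ideal R} :
    IsCParamIdeal R q ↔ ∃ l, CSys l ∧ q = Ideal.ofList l := by
  have hspan : ∀ {s : ℕ} (x : Fin s → R),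
      Ideal.span (Set.range x) = Ideal.ofList (List.ofFn x) := by
    intro s x
    rw [Ideal.ofList]
    congr 1
    ext b
    simp
  constructor
  · rintro ⟨s, x, hx, rfl⟩
    exact ⟨_, (isCSOP_iff x).1 hx, hspan x⟩
  · rintro ⟨l, hl, rfl⟩
    exact ⟨l.length, l.get, (isCSOP_iff _).2 (by rwa [List.ofFn_get]),
      by rw [hspan, List.ofFn_get]⟩

end Conversions

section HilbertCoefficients

variable {R : Type u} [CommRing R]

lemma moduleLength_eq_iff (M : Type u) [AddCommGroup M] [Module R M] (L : ℕ) :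
    moduleLength R M = (L : WithBot ℕ∞) ↔ Module.length R M = L := by
  rw [moduleLength, ← Module.coe_length]
  exact WithBot.coe_inj (b := (L : ℕ∞))

lemma isHilbCoeff_iff {I : Ideal R} {d : ℕ} {e : ℕ → ℤ} : IsHilbCoeff R I d e ↔
    ∃ N : ℕ, ∀ n ≥ N, ∃ L : ℕ, Module.length R (R ⧸ I ^ (n + 1)) = L ∧
      (L : ℤ) = binSum (fun i => (-1) ^ i * e i) d n := by
  have key : ∀ n : ℕ, Module.length R (R ⧸ (I ^ (n + 1) • (⊤ : Submodule R R))) =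
      Module.length R (R ⧸ I ^ (n + 1)) := fun n =>
    (Submodule.quotEquivOfEq _ _ (by rw [smul_eq_mul, Ideal.mul_top])).length_eq
  simp only [IsHilbCoeff, IsHilbCoeffMod, moduleLength_eq_iff, key, binSum]

/-- The Hilbert coefficients in the presence of a `HilbChain`. -/
lemma exists_hilbCoeff {I Q : Ideal R} {C b : ℕ} (hIQ : I ^ 2 ≤ Q) (hQI : Q ≤ I)
    (hQ : Module.length R (R ⧸ Q) ≠ ⊤) (hb : rlen Q I = b) {l : List R} {x : R}
    (hc : HilbChain I C ⊥ (l ++ [x])) (hQl : Q = Ideal.ofList (l ++ [x])) :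
    ∃ (e : ℕ → ℤ) (h : ℕ), IsHilbCoeff R I (l.length + 1) e ∧
      (∀ e', IsHilbCoeff R I (l.length + 1) e' → ∀ i ≤ l.length + 1, e' i = e i) ∧
      (∀ i, 1 ≤ i → i ≤ l.length + 1 → |e i| ≤ 3 * C + b) ∧
      rlen (Ideal.ofList l) (colon (Ideal.ofList l) x) = h ∧
      (h : ℤ) ≤ b + ∑ i ∈ Finset.range (l.length + 1), |e (i + 1)| := by
  have hadd := length_quot_add hQI
  rw [hb] at hadd
  obtain ⟨LQ, hLQ⟩ := ENat.ne_top_iff_exists.1 hQ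
  have hL₀ : Module.length R (R ⧸ I) ≠ ⊤ := by
    intro h
    rw [h, add_top] at hadd
    exact hQ hadd
  obtain ⟨L₀, hL₀⟩ := ENat.ne_top_iff_exists.1 hL₀
  have hLb : LQ = L₀ + b := by
    rw [← hLQ, ← hL₀] at hadd
    have : LQ = b + L₀ := by exact_mod_cast hadd
    omega
  obtain ⟨c, h, s, h1, h2, h3, h4, h5, h6, h7⟩ :=
    hilbChain_binSum hIQ hQI hL₀.symm hLQ.symm hLb l hc (by rw [hQl, bot_sup_eq])
  rw [bot_sup_eq] at h1
  have hsq : ∀ i : ℕ, (-1 : ℤ) ^ i * (-1) ^ i = 1 := fun i => by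
    rw [← mul_pow]; simp
  have habs : ∀ i : ℕ, |(-1 : ℤ) ^ i * c i| = |c i| := fun i => by
    rw [abs_mul, abs_pow, abs_neg, abs_one, one_pow, one_mul]
  refine ⟨fun i => (-1) ^ i * c i, h, ?_, ?_, ?_, h1, ?_⟩
  · rw [isHilbCoeff_iff]
    refine ⟨1, fun n hn => ?_⟩
    obtain ⟨n, rfl⟩ : ∃ m, n = m + 1 := ⟨n - 1, by omega⟩
    obtain ⟨L, hL, hL'⟩ := h7 n
    rw [sup_bot_eq] at hL
    refine ⟨L, hL, hL'.trans (binSum_congr (fun i _ => ?_) _)⟩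
    rw [← mul_assoc, hsq, one_mul]
  · intro e' he' i hi
    rw [isHilbCoeff_iff] at he'
    obtain ⟨N, hN⟩ := he'
    have := binSum_unique (l.length + 1) (c := fun i => (-1) ^ i * e' i) (c' := c) (N := N + 1)
      (fun n hn => by
        obtain ⟨n, rfl⟩ : ∃ m, n = m + 1 := ⟨n - 1, by omega⟩
        obtain ⟨L, hL, hL'⟩ := h7 n
        obtain ⟨L', hL1, hL1'⟩ := hN (n + 1) (by omega)
        rw [sup_bot_eq] at hL
        rw [← hL', ← hL1']
        have : (L : ℕ∞) = L' := hL.symm.trans hL1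
        exact_mod_cast this.symm) i hi
    simp only [← this]
    rw [← mul_assoc, hsq, one_mul]
  · intro i hi hi'
    rw [habs]
    rcases Nat.lt_or_eq_of_le hi' with hlt | rfl
    · exact h5 i hi (by omega)
    · refine h6.trans ?_
      have : (0 : ℤ) ≤ C := Int.natCast_nonneg _
      linarith
  · simp only [habs]
    have h8 : ∑ i ∈ Finset.range (l.length + 1), c (i + 1) ≤
        ∑ i ∈ Finset.range (l.length + 1), |c (i + 1)| :=
      Finset.sum_le_sum fun i _ => le_abs_self _
    rw [Finset.sum_range_succ'] at h4
    have : (0 : ℤ) ≤ s := Int.natCast_nonneg _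
    rw [hLb] at h3
    push_cast at h3
    linarith

variable [IsLocalRing R]

/-- A `Good` list satisfies `HilbChain` when `I ^ 2 = Q I`. -/
lemma Good.hilbChain {Q : Ideal R} (hQm : Q ≤ maximalIdeal R)
    (hI : colonIdeal R Q * colonIdeal R Q = Q * colonIdeal R Q) {C : ℕ} (l : List R) :
    ∀ {𝔞 : Ideal R}, Good 𝔞 l → Q = 𝔞 ⊔ Ideal.ofList l →
    (∀ p x s, l = p ++ x :: s →
      rlen (𝔞 ⊔ Ideal.ofList p) (colon (𝔞 ⊔ Ideal.ofList p) x) ≤ C) →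
    HilbChain (colonIdeal R Q) C 𝔞 l := by
  induction l with
  | nil => exact fun _ _ _ => trivial
  | cons x l ih =>
    intro 𝔞 hG hQ hC
    refine ⟨hG.colon_pow_colonIdeal hQm hQ hI, ?_, by simpa using hC [] x l rfl,
      ih hG.2.2 (by rw [hQ, sup_ofList_cons]) fun p y s hl => ?_⟩
    · refine le_trans (inf_le_inf le_rfl (sup_le ?_ le_sup_left)) hG.1
      rw [pow_two, hI, ← hQ]
      exact Ideal.mul_le_left
    · have := hC (x :: p) y s (by rw [hl]; rfl)
      rwa [sup_ofList_cons] at this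

variable [IsNoetherianRing R]

lemma CSys.length_quot_ne_top {l : List R} (h : CSys l) :
    Module.length R (R ⧸ Ideal.ofList l) ≠ ⊤ :=
  CParam.length_quot_ne_top (by simpa using h.sys.rad)

lemma Good.inf_le {l : List R} : ∀ {𝔞 : Ideal R}, Good 𝔞 l → ∀ {p x s}, l = p ++ x :: s →
    colon (𝔞 ⊔ Ideal.ofList p) x ⊓ (𝔞 ⊔ Ideal.ofList l) ≤ 𝔞 ⊔ Ideal.ofList p := by
  induction l with
  | nil => intro 𝔞 _ p x s h; simp at h
  | cons y l ih =>
    intro 𝔞 hG p x s h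
    rcases List.cons_eq_append_iff.1 h with ⟨rfl, h⟩ | ⟨p, rfl, h⟩
    · obtain ⟨rfl, rfl⟩ := List.cons.inj h
      simpa using hG.1
    · rw [sup_ofList_cons, sup_ofList_cons]
      exact ih hG.2.2 (List.cons.inj h).2

lemma CSys.rlen_colon_le {p : List R} {x : R} {s : List R} (h : CSys (p ++ x :: s)) :
    rlen (Ideal.ofList p) (colon (Ideal.ofList p) x) ≤
      Module.length R (R ⧸ Ideal.ofList (p ++ x :: s)) := by
  have := h.good.inf_le rfl
  rw [bot_sup_eq, bot_sup_eq] at this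
  rw [← rlen_top]
  exact rlen_le_of_inf_le le_top this

lemma CSys.le_maximalIdeal {l : List R} (h : CSys l) : Ideal.ofList l ≤ maximalIdeal R :=
  ofList_le.2 h.sys.mem

lemma CSys.exists_rlen_colonIdeal {l : List R} (h : CSys l) :
    ∃ b : ℕ, rlen (Ideal.ofList l) (colonIdeal R (Ideal.ofList l)) = b := by
  have : rlen (Ideal.ofList l) (colonIdeal R (Ideal.ofList l)) ≠ ⊤ := by
    refine ne_top_of_le_ne_top h.length_quot_ne_top ?_
    rw [← rlen_top]
    exact rlen_mono le_top
  obtain ⟨b, hb⟩ := ENat.ne_top_iff_exists.1 this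
  exact ⟨b, hb.symm⟩

/-- Hilbert coefficients of `Q : m` for a C-parameter ideal `Q` with `(Q : m)² = Q (Q : m)`. -/
lemma CSys.exists_hilbCoeff {l : List R} {x : R} (h : CSys (l ++ [x])) {Q : Ideal R}
    (hQ : Q = Ideal.ofList (l ++ [x])) (hI : colonIdeal R Q * colonIdeal R Q = Q * colonIdeal R Q)
    {C b : ℕ} (hC : ∀ p y s, l ++ [x] = p ++ y :: s →
      rlen (Ideal.ofList p) (colon (Ideal.ofList p) y) ≤ C)
    (hb : rlen Q (colonIdeal R Q) = b) :
    ∃ (e : ℕ → ℤ) (h : ℕ), IsHilbCoeff R (colonIdeal R Q) (l.length + 1) e ∧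
      (∀ e', IsHilbCoeff R (colonIdeal R Q) (l.length + 1) e' →
        ∀ i ≤ l.length + 1, e' i = e i) ∧
      (∀ i, 1 ≤ i → i ≤ l.length + 1 → |e i| ≤ 3 * C + b) ∧
      rlen (Ideal.ofList l) (colon (Ideal.ofList l) x) = h ∧
      (h : ℤ) ≤ b + ∑ i ∈ Finset.range (l.length + 1), |e (i + 1)| := by
  refine CParam.exists_hilbCoeff (C := C) ?_ (le_colonIdeal Q) ?_ hb ?_ hQ
  · rw [pow_two, hI]
    exact Ideal.mul_le_left
  · rw [hQ]
    exact h.length_quot_ne_top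
  · refine Good.hilbChain ?_ hI _ h.good (by rw [hQ, bot_sup_eq]) fun p y s hl => ?_
    · rw [hQ]
      exact h.le_maximalIdeal
    · rw [bot_sup_eq]
      exact hC p y s hl

end HilbertCoefficients

section SocleProduct

variable {R : Type u} [CommRing R] [IsLocalRing R]

lemma exists_unit_coeff (l : List R) : ∀ {q : R}, q ∈ Ideal.ofList l →
    q ∉ maximalIdeal R * Ideal.ofList l →
    ∃ A x s u, l = A ++ x :: s ∧ IsUnit u ∧ q - u * x ∈ Ideal.ofList (A ++ s) := by
  induction l with
  | nil =>
    intro q hq hq'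
    rw [Ideal.ofList_nil, Ideal.mem_bot] at hq
    exact absurd (hq ▸ zero_mem _) hq'
  | cons b l ih =>
    intro q hq hq'
    rw [Ideal.ofList_cons] at hq
    obtain ⟨u, hu, v, hv, rfl⟩ := Submodule.mem_sup.1 hq
    obtain ⟨c, rfl⟩ := Ideal.mem_span_singleton'.1 hu
    by_cases hc : IsUnit c
    · exact ⟨[], b, l, c, rfl, hc, by simpa using hv⟩
    · have h1 : c * b ∈ maximalIdeal R * Ideal.ofList (b :: l) :=
        Ideal.mul_mem_mul ((mem_maximalIdeal c).2 hc) (mem_ofList (by simp))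
      have h2 : v ∉ maximalIdeal R * Ideal.ofList l := fun h =>
        hq' (add_mem h1 (Ideal.mul_mono_right (ofList_mono (List.subset_cons_self b l)) h))
      obtain ⟨A, x, s, u, rfl, hu, h3⟩ := ih hv h2
      refine ⟨b :: A, x, s, u, rfl, hu, ?_⟩
      rw [add_sub_assoc]
      refine add_mem (Ideal.mul_mem_left _ _ (mem_ofList (by simp))) (ofList_mono ?_ h3)
      simp

/-- If `m (Q : m)` is not contained in `m Q`, some generator is a multiple of a socle element. -/
lemma exists_socle_factor {l : List R}
    (h : ¬ maximalIdeal R * colonIdeal R (Ideal.ofList l) ≤ maximalIdeal R * Ideal.ofList l) :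
    ∃ A x s y a, l = A ++ x :: s ∧ y ∈ maximalIdeal R ∧ a ∈ colonIdeal R (Ideal.ofList l) ∧
      x - y * a ∈ Ideal.ofList (A ++ s) := by
  rw [Ideal.mul_le] at h
  push Not at h
  obtain ⟨y, hy, a, ha, h⟩ := h
  obtain ⟨A, x, s, u, hl, ⟨u, rfl⟩, h1⟩ := exists_unit_coeff l (ha y hy) h
  refine ⟨A, x, s, y, ↑u⁻¹ * a, hl, hy, Ideal.mul_mem_left _ _ ha, ?_⟩
  have : x - y * (↑u⁻¹ * a) = -(↑u⁻¹ * (y * a - u * x)) := by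
    have hu : (↑u⁻¹ : R) * u = 1 := u.inv_mul
    linear_combination (-x) * hu
  rw [this]
  exact neg_mem (Ideal.mul_mem_left _ _ h1)

lemma not_pow_mem [IsNoetherianRing R] {c : List R} {z w : R} (hP : PSys ⊥ (c ++ [z, w])) {n : ℕ} :
    w ^ n ∉ Ideal.ofList c := by
  intro h
  have h1 : qdim (⊥ : Ideal R) ≤ (c ++ [z]).length := by
    refine qdim_le_length (fun a ha => hP.mem a ?_) ?_
    · simp only [List.mem_append, List.mem_cons, List.not_mem_nil, or_false] at ha ⊢
      tauto
    · refine hP.rad.trans ?_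
      rw [← Ideal.radical_idem (⊥ ⊔ Ideal.ofList (c ++ [z]))]
      refine Ideal.radical_mono (sup_le bot_le (ofList_le.2 fun a ha => ?_))
      simp only [List.mem_append, List.mem_cons, List.not_mem_nil, or_false] at ha
      rcases ha with ha | rfl | rfl
      · exact Ideal.le_radical (Ideal.mem_sup_right (mem_ofList (by simp [ha])))
      · exact Ideal.le_radical (Ideal.mem_sup_right (mem_ofList (by simp)))
      · exact ⟨n, Ideal.mem_sup_right (ofList_mono (List.subset_append_left c [z]) h)⟩
  rw [hP.dim] at h1
  have h2 : (c ++ [z, w]).length ≤ (c ++ [z]).length := by exact_mod_cast h1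
  simp at h2

/-- Two elements of a system of parameters, the second annihilating the colon ideals. -/
lemma socle_factor_aux [IsNoetherianRing R] {c : List R} {z w : R} (hP : PSys ⊥ (c ++ [z, w]))
    (hw : w ∈ bT (⊥ : Ideal R)) :
    w ∉ maximalIdeal R * colon (Ideal.ofList c ⊔ Ideal.span {w}) z ∧
    z ∉ maximalIdeal R * colon (Ideal.ofList c ⊔ Ideal.span {z}) w := by
  have hmz := hP.mem z (by simp)
  have hmw := hP.mem w (by simp)
  have hpow : ∀ i j : ℕ, PSys ⊥ (c ++ [z ^ (i + 1), w ^ (j + 1)]) := by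
    intro i j
    refine hP.of_rad (by simp) (fun a ha => ?_) (sup_le bot_le (ofList_le.2 fun a ha => ?_))
    · simp only [List.mem_append, List.mem_cons, List.not_mem_nil, or_false] at ha
      rcases ha with ha | rfl | rfl
      · exact hP.mem a (by simp [ha])
      · exact Ideal.pow_mem_of_mem _ hmz _ (Nat.succ_pos _)
      · exact Ideal.pow_mem_of_mem _ hmw _ (Nat.succ_pos _)
    · simp only [List.mem_append, List.mem_cons, List.not_mem_nil, or_false] at ha
      rcases ha with ha | rfl | rfl
      · exact Ideal.le_radical (Ideal.mem_sup_right (mem_ofList (by simp [ha])))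
      · exact ⟨i + 1, Ideal.mem_sup_right (mem_ofList (by simp))⟩
      · exact ⟨j + 1, Ideal.mem_sup_right (mem_ofList (by simp))⟩
  set 𝔠 := Ideal.ofList c with h𝔠
  set W := colon 𝔠 w with hW
  have f0 : ∀ {a t : R} {s : List R}, PSys ⊥ (c ++ a :: s) → a * t ∈ 𝔠 → w * t ∈ 𝔠 := by
    intro a t s hP' h
    have := bT_apply hw hP' (v := t)
    rw [bot_sup_eq] at this
    exact this h
  have f1 : ∀ t, w * t ∈ W → t ∈ W := by
    intro t ht
    have hP' : PSys ⊥ (c ++ w ^ 2 :: [z]) := by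
      have := (hpow 0 1)
      rw [pow_one] at this
      exact this.perm (List.Perm.append_left c (List.Perm.swap _ _ _))
    refine f0 hP' ?_
    rw [pow_two, mul_assoc]
    exact ht
  have f2 : ∀ t, z * t ∈ W → t ∈ W := by
    intro t ht
    refine f1 t ?_
    exact f0 hP (by
      have : z * (w * t) = w * (z * t) := by ring
      rw [this]; exact ht)
  have f3 : ∀ k t, z ^ k * t ∈ W → t ∈ W := by
    intro k
    induction k with
    | zero => intro t ht; simpa using ht
    | succ k ih => exact fun t ht => ih t (f2 _ (by rwa [← mul_assoc, ← pow_succ']))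
  let K : Ideal R :=
    { carrier := {t | ∃ k : ℕ, z ^ k * t ∈ Ideal.span {w ^ 2} ⊔ W}
      add_mem' := by
        rintro a b ⟨k, hk⟩ ⟨j, hj⟩
        refine ⟨k + j, ?_⟩
        have : z ^ (k + j) * (a + b) = z ^ j * (z ^ k * a) + z ^ k * (z ^ j * b) := by ring
        rw [this]
        exact add_mem (Ideal.mul_mem_left _ _ hk) (Ideal.mul_mem_left _ _ hj)
      zero_mem' := ⟨0, by simp⟩
      smul_mem' := by
        rintro r a ⟨k, hk⟩
        refine ⟨k, ?_⟩
        rw [smul_eq_mul, mul_left_comm]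
        exact Ideal.mul_mem_left _ _ hk }
  have hK : ∀ t, t ∈ K ↔ ∃ k : ℕ, z ^ k * t ∈ Ideal.span {w ^ 2} ⊔ W := fun t => Iff.rfl
  have hKW : ¬ K ≤ W := by
    intro h
    have h1 : w ^ 2 ∈ W := h ((hK _).2 ⟨0, by
      simpa using Ideal.mem_sup_left (Ideal.mem_span_singleton_self (w ^ 2))⟩)
    refine not_pow_mem hP (n := 3) ?_
    have : w ^ 3 = w * w ^ 2 := by ring
    rw [this]
    exact h1
  have hcW : 𝔠 ≤ W := le_colon _ _
  have dec : ∀ t ∈ K, ∃ τ, t - w * τ ∈ W ∧ ∃ k, z ^ k * τ ∈ Ideal.span {w} ⊔ W := by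
    rintro t ⟨k, hk⟩
    obtain ⟨u, hu, ω, hω, e⟩ := Submodule.mem_sup.1 hk
    obtain ⟨r, rfl⟩ := Ideal.mem_span_singleton'.1 hu
    have h1 : w * (w * t) ∈ 𝔠 ⊔ Ideal.ofList [w ^ 3] := by
      have hP' : PSys ⊥ ((c ++ [w ^ 3]) ++ z ^ (k + 1) :: []) := by
        refine (hpow k 2).perm ?_
        rw [List.append_assoc]
        exact List.Perm.append_left c (List.Perm.swap _ _ _)
      have := bT_apply hw hP' (v := w * t)
      rw [bot_sup_eq, Ideal.ofList_append, ← h𝔠] at this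
      refine this ?_
      have e2 : z ^ (k + 1) * (w * t) = z * (w * ω) + z * r * w ^ 3 := by
        linear_combination (-z * w) * e
      rw [e2]
      exact add_mem (Ideal.mem_sup_left (Ideal.mul_mem_left _ _ hω))
        (Ideal.mem_sup_right (Ideal.mul_mem_left _ _ (mem_ofList (by simp))))
    obtain ⟨γ, hγ, v, hv, e3⟩ := Submodule.mem_sup.1 h1
    rw [Ideal.ofList_singleton] at hv
    obtain ⟨τ, rfl⟩ := Ideal.mem_span_singleton'.1 hv
    have h2 : t - w * τ ∈ W := by
      refine f1 _ ?_
      change w * (w * (t - w * τ)) ∈ 𝔠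
      have : w * (w * (t - w * τ)) = γ := by linear_combination -e3
      rw [this]
      exact hγ
    refine ⟨τ, h2, k, ?_⟩
    have h3 : z ^ k * τ - r * w ∈ W := by
      refine f1 _ ?_
      have : w * (z ^ k * τ - r * w) = ω - z ^ k * (t - w * τ) := by linear_combination -e
      rw [this]
      exact sub_mem hω (Ideal.mul_mem_left _ _ h2)
    have : z ^ k * τ = r * w + (z ^ k * τ - r * w) := by ring
    rw [this]
    exact add_mem (Ideal.mem_sup_left (Ideal.mul_mem_left _ _ (Ideal.mem_span_singleton_self w)))
      (Ideal.mem_sup_right h3)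
  have mulmem : ∀ {α β : R}, α ∈ Ideal.span {w} ⊔ W → β ∈ Ideal.span {w} ⊔ W →
      α * β ∈ Ideal.span {w ^ 2} ⊔ W := by
    intro α β hα hβ
    obtain ⟨u, hu, ω, hω, rfl⟩ := Submodule.mem_sup.1 hα
    obtain ⟨r, rfl⟩ := Ideal.mem_span_singleton'.1 hu
    obtain ⟨u, hu, ω', hω', rfl⟩ := Submodule.mem_sup.1 hβ
    obtain ⟨r', rfl⟩ := Ideal.mem_span_singleton'.1 hu
    have : (r * w + ω) * (r' * w + ω') = r * r' * w ^ 2 + ((r * w + ω) * ω' + r' * w * ω) := by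
      ring
    rw [this]
    exact add_mem (Ideal.mem_sup_left (Ideal.mul_mem_left _ _ (Ideal.mem_span_singleton_self _)))
      (Ideal.mem_sup_right (add_mem (Ideal.mul_mem_left _ _ hω') (Ideal.mul_mem_left _ _ hω)))
  constructor
  · intro hmem
    refine hKW (Submodule.le_of_le_smul_of_le_jacobson_bot (I := maximalIdeal R)
      (IsNoetherian.noetherian K) (maximalIdeal_le_jacobson ⊥) fun t ht => ?_)
    obtain ⟨τ, h1, k, h2⟩ := dec t ht
    have h3 : w * τ ∈ maximalIdeal R * K := by
      refine Submodule.mul_induction_on hmem ?_ ?_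
      · intro m hm p hp
        rw [mul_assoc]
        refine Ideal.mul_mem_mul hm ((hK _).2 ⟨k + 1, ?_⟩)
        have : z ^ (k + 1) * (p * τ) = (z ^ k * τ) * (z * p) := by ring
        rw [this]
        refine mulmem h2 ?_
        have hp' : z * p ∈ 𝔠 ⊔ Ideal.span {w} := hp
        rw [sup_comm] at hp'
        exact (sup_le_sup_left hcW (Ideal.span {w}) : _ ≤ Ideal.span {w} ⊔ W) hp'
      · intro a b ha hb
        rw [add_mul]
        exact add_mem ha hb
    have : t = (t - w * τ) + w * τ := by ring
    rw [this]
    exact add_mem (Ideal.mem_sup_left h1) (Ideal.mem_sup_right h3)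
  · intro hmem
    set P' := colon (𝔠 ⊔ Ideal.span {z}) w with hP'
    have key : P' * K ≤ W := by
      refine Submodule.le_of_le_smul_of_le_jacobson_bot (I := maximalIdeal R)
        (IsNoetherian.noetherian _) (maximalIdeal_le_jacobson ⊥) (Ideal.mul_le.2 fun p hp t ht => ?_)
      obtain ⟨τ, h1, k, h2⟩ := dec t ht
      have hp' : w * p ∈ 𝔠 ⊔ Ideal.span {z} := hp
      obtain ⟨γ, hγ, u, hu, e⟩ := Submodule.mem_sup.1 hp'
      obtain ⟨α, rfl⟩ := Ideal.mem_span_singleton'.1 hu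
      have h3 : α * τ ∈ K := by
        refine (hK _).2 ⟨k + 1, ?_⟩
        have : z ^ (k + 1) * (α * τ) = (z ^ k * τ) * (w * p - γ) := by
          linear_combination (z ^ k * τ) * e
        rw [this]
        refine mulmem h2 (sub_mem ?_ (Ideal.mem_sup_right (hcW hγ)))
        exact Ideal.mem_sup_left (Ideal.mul_mem_right _ _ (Ideal.mem_span_singleton_self w))
      have h4 : z * (α * τ) ∈ maximalIdeal R * (P' * K) := by
        rw [← mul_assoc (maximalIdeal R)]
        exact Ideal.mul_mem_mul hmem h3
      have : p * t = (p * (t - w * τ) + τ * γ) + z * (α * τ) := by linear_combination (-τ) * e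
      rw [this]
      exact add_mem (Ideal.mem_sup_left (add_mem (Ideal.mul_mem_left _ _ h1)
        (Ideal.mul_mem_left _ _ (hcW hγ)))) (Ideal.mem_sup_right h4)
    refine hKW fun t ht => f2 t (key (Ideal.mul_mem_mul ?_ ht))
    exact le_colon _ _ (Ideal.mem_sup_right (Ideal.mem_span_singleton_self z))

lemma CSys.mul_colonIdeal_le [IsNoetherianRing R] {l : List R} (h : CSys l) (h2 : 2 ≤ l.length)
    (hm : ∀ a ∈ l, a ∈ maximalIdeal R ^ 2) :
    maximalIdeal R * colonIdeal R (Ideal.ofList l) ≤ maximalIdeal R * Ideal.ofList l := by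
  by_contra hnot
  obtain ⟨A, x, s, y, a, rfl, hy, ha, hx⟩ := exists_socle_factor hnot
  set J := Ideal.ofList (A ++ s) with hJ
  have hl : Ideal.ofList (A ++ x :: s) = J ⊔ Ideal.span {x} := by
    rw [hJ, ← ofList_concat]
    refine ofList_perm ?_
    simpa using (List.perm_middle (a := x) (l₁ := A) (l₂ := s)).trans
      (List.perm_append_singleton x (A ++ s)).symm
  have stab : ∀ v, x * (x * v) ∈ J → x * v ∈ J := by
    intro v hv
    have hb : x ∈ bT (Ideal.ofList s) := h.tail.mem'
    have h0 : PSys (Ideal.ofList s) (A ++ [x]) := PSys.tail (by simpa using h.sys)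
    have h1 : PSys (Ideal.ofList s) (A ++ x ^ 2 :: []) := by
      refine h0.of_rad (by simp) (fun b hb => ?_) (sup_le (le_sup_left.trans Ideal.le_radical)
        (ofList_le.2 fun b hb => ?_))
      · simp only [List.mem_append, List.mem_cons, List.not_mem_nil, or_false] at hb
        rcases hb with hb | rfl
        · exact h0.mem b (by simp [hb])
        · exact Ideal.pow_mem_of_mem _ (h0.mem x (by simp)) _ (by norm_num)
      · simp only [List.mem_append, List.mem_cons, List.not_mem_nil, or_false] at hb
        rcases hb with hb | rfl
        · exact Ideal.le_radical (Ideal.mem_sup_right (mem_ofList (by simp [hb])))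
        · exact ⟨2, Ideal.mem_sup_right (mem_ofList (by simp))⟩
    have := bT_apply hb h1 (v := v)
    rw [sup_comm, ← Ideal.ofList_append, ← hJ, pow_two, mul_assoc] at this
    exact this hv
  set P' := colon J x with hP'
  have hmP : ∀ r ∈ maximalIdeal R, ∃ β, r - β * y ∈ P' := by
    intro r hr
    have h1 := ha r hr
    rw [hl] at h1
    obtain ⟨j, hj, u, hu, e⟩ := Submodule.mem_sup.1 h1
    obtain ⟨β, rfl⟩ := Ideal.mem_span_singleton'.1 hu
    refine ⟨β, ?_⟩
    change x * (r - β * y) ∈ J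
    have e' : j + β * x = r * a := e
    have : x * (r - β * y) = (x - y * a) * (r - β * y) + y * j + y * β * (x - y * a) := by
      linear_combination (-y) * e'
    rw [this]
    exact add_mem (add_mem (Ideal.mul_mem_right _ _ hx) (Ideal.mul_mem_left _ _ hj))
      (Ideal.mul_mem_left _ _ hx)
  have hyP : ∀ t, y * t ∈ P' → t ∈ P' := by
    intro t ht
    refine stab t ?_
    have ht' : x * (y * t) ∈ J := ht
    have : x * (x * t) = (x - y * a) * (x * t) + a * (x * (y * t)) := by ring
    rw [this]
    exact add_mem (Ideal.mul_mem_right _ _ hx) (Ideal.mul_mem_left _ _ ht')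
  have hJP : J ≤ maximalIdeal R * P' := by
    intro j hj
    have hjm : j ∈ maximalIdeal R * maximalIdeal R := by
      rw [← pow_two]
      refine ofList_le.2 (fun b hb => hm b ?_) hj
      simp only [List.mem_append, List.mem_cons] at hb ⊢
      tauto
    have : ∃ r ∈ maximalIdeal R, j - y * r ∈ maximalIdeal R * P' := by
      refine Submodule.mul_induction_on hjm ?_ ?_
      · intro m₁ h₁ m₂ h₂
        obtain ⟨β, hβ⟩ := hmP m₂ h₂
        refine ⟨β * m₁, Ideal.mul_mem_left _ _ h₁, ?_⟩
        have : m₁ * m₂ - y * (β * m₁) = m₁ * (m₂ - β * y) := by ring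
        rw [this]
        exact Ideal.mul_mem_mul h₁ hβ
      · rintro b c ⟨r, hr, hb⟩ ⟨r', hr', hc⟩
        refine ⟨r + r', add_mem hr hr', ?_⟩
        have : b + c - y * (r + r') = (b - y * r) + (c - y * r') := by ring
        rw [this]
        exact add_mem hb hc
    obtain ⟨r, hr, h1⟩ := this
    have h3 : r ∈ P' := hyP r (by
      have : y * r = j - (j - y * r) := by ring
      rw [this]
      exact sub_mem (le_colon _ _ hj) (Ideal.mul_le_right h1))
    have : j = y * r + (j - y * r) := by ring
    rw [this]
    exact add_mem (Ideal.mul_mem_mul hy h3) h1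
  rcases List.eq_nil_or_concat s with rfl | ⟨B, w, rfl⟩
  · obtain ⟨z, c, rfl⟩ : ∃ z c, A = z :: c := by
      cases A with
      | nil => simp at h2
      | cons z c => exact ⟨z, c, rfl⟩
    have hP : PSys ⊥ (c ++ [z, x]) := h.sys.perm (by
      simpa using (List.perm_middle (a := z) (l₁ := c) (l₂ := [x])).symm)
    have hJc : J = Ideal.ofList c ⊔ Ideal.span {z} := by
      rw [hJ, List.append_nil, Ideal.ofList_cons, sup_comm]
    refine (socle_factor_aux hP ?_).2 ?_
    · have := h.tail.mem'
      rwa [Ideal.ofList_nil] at this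
    · rw [← hJc]
      exact hJP (mem_ofList (by simp))
  · have hP : PSys ⊥ ((A ++ B) ++ [x, w]) := h.sys.perm (by
      simp only [List.append_assoc]
      refine List.Perm.append_left A ?_
      simpa using (List.perm_middle (a := x) (l₁ := B) (l₂ := [w])).symm)
    have hJc : J = Ideal.ofList (A ++ B) ⊔ Ideal.span {w} := by
      rw [hJ, ← ofList_concat]
      simp
    refine (socle_factor_aux hP ?_).1 ?_
    · have := CTail.mem' (p := A ++ x :: B) (x := w) (s := []) (by simpa using h.tail)
      rwa [Ideal.ofList_nil] at this
    · rw [← hJc]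
      exact hJP (mem_ofList (by simp))

/-- The main multiplicative property of the socle ideal of a C-parameter ideal. -/
lemma CSys.colonIdeal_mul_self [IsNoetherianRing R] {l : List R} (h : CSys l) (hl : l ≠ [])
    (hI : colonIdeal R (Ideal.ofList l) ≤ maximalIdeal R)
    (hmI : maximalIdeal R * colonIdeal R (Ideal.ofList l) ≤ maximalIdeal R * Ideal.ofList l) :
    colonIdeal R (Ideal.ofList l) * colonIdeal R (Ideal.ofList l) =
      Ideal.ofList l * colonIdeal R (Ideal.ofList l) := by
  obtain ⟨x, s, rfl⟩ := List.exists_cons_of_ne_nil hl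
  exact h.good.colonIdeal_mul_self h.le_maximalIdeal rfl hI hmI

lemma CSys.colonIdeal_le [IsNoetherianRing R] {l : List R} (h : CSys l) (hl : l ≠ [])
    (hm : ∀ a ∈ l, a ∈ maximalIdeal R ^ 2) :
    colonIdeal R (Ideal.ofList l) ≤ maximalIdeal R := by
  refine IsLocalRing.le_maximalIdeal fun htop => ?_
  have h1 : (1 : R) ∈ colonIdeal R (Ideal.ofList l) := htop ▸ trivial
  have h2 : maximalIdeal R ≤ maximalIdeal R * maximalIdeal R := by
    rw [← pow_two]
    intro r hr
    exact ofList_le.2 hm (by simpa using h1 r hr)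
  have h3 : maximalIdeal R = ⊥ := le_bot_iff.1 (Submodule.le_of_le_smul_of_le_jacobson_bot
    (I := maximalIdeal R) (IsNoetherian.noetherian _) (maximalIdeal_le_jacobson ⊥)
    (by rw [bot_sup_eq]; exact h2))
  have h4 := h.sys.dim
  have h5 : qdim (⊥ : Ideal R) ≤ 0 := qdim_le_zero (by rw [h3]; exact bot_le)
  rw [h4] at h5
  have : l.length ≤ 0 := by exact_mod_cast h5
  exact hl (List.length_eq_zero_iff.1 (by omega))

end SocleProduct

section ColonSequences

variable {R : Type u} [CommRing R]

/-- The projection `R ⧸ 𝔞 → R ⧸ (𝔞 : x)`. -/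
def colonProj (𝔞 : Ideal R) (x : R) : (R ⧸ 𝔞) →ₗ[R] (R ⧸ colon 𝔞 x) :=
  Submodule.factor (le_colon 𝔞 x)

/-- Multiplication by `x` from `R ⧸ (𝔞 : x)` to `R ⧸ 𝔞`. -/
def colonMul (𝔞 : Ideal R) (x : R) : (R ⧸ colon 𝔞 x) →ₗ[R] (R ⧸ 𝔞) :=
  (colon 𝔞 x).mapQ 𝔞 (LinearMap.lsmul R R x) fun _ hv => mem_colon.1 hv

/-- The projection `R ⧸ 𝔞 → R ⧸ (𝔞 + (x))`. -/
def addProj (𝔞 : Ideal R) (x : R) : (R ⧸ 𝔞) →ₗ[R] (R ⧸ (𝔞 ⊔ Ideal.span {x})) :=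
  Submodule.factor le_sup_left

lemma colonProj_surjective (𝔞 : Ideal R) (x : R) : Function.Surjective (colonProj 𝔞 x) :=
  Submodule.factor_surjective (le_colon 𝔞 x)

lemma addProj_surjective (𝔞 : Ideal R) (x : R) : Function.Surjective (addProj 𝔞 x) :=
  Submodule.factor_surjective (le_sup_left)

lemma colonMul_colonProj (𝔞 : Ideal R) (x : R) (v : R ⧸ 𝔞) :
    colonMul 𝔞 x (colonProj 𝔞 x v) = x • v := by
  obtain ⟨v, rfl⟩ := Submodule.mkQ_surjective _ v
  rfl

lemma colonMul_injective (𝔞 : Ideal R) (x : R) : Function.Injective (colonMul 𝔞 x) := by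
  rw [injective_iff_map_eq_zero]
  intro v hv
  obtain ⟨v, rfl⟩ := Submodule.mkQ_surjective _ v
  have h : x * v ∈ 𝔞 := (Submodule.Quotient.mk_eq_zero _).1 hv
  exact (Submodule.Quotient.mk_eq_zero _).2 (mem_colon.2 h)

lemma colonMul_exact (𝔞 : Ideal R) (x : R) :
    Function.Exact (colonMul 𝔞 x) (addProj 𝔞 x) := by
  intro v
  obtain ⟨v, rfl⟩ := Submodule.mkQ_surjective _ v
  constructor
  · intro h
    have h : v ∈ 𝔞 ⊔ Ideal.span {x} := (Submodule.Quotient.mk_eq_zero _).1 h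
    obtain ⟨a, ha, y, hy, rfl⟩ := Submodule.mem_sup.1 h
    obtain ⟨c, rfl⟩ := Ideal.mem_span_singleton'.1 hy
    refine ⟨(colon 𝔞 x).mkQ c, ?_⟩
    refine (Submodule.Quotient.eq 𝔞).2 ?_
    have : x * c - (a + c * x) = -a := by ring
    change x * c - (a + c * x) ∈ 𝔞
    rw [this]
    exact neg_mem ha
  · rintro ⟨w, hw⟩
    obtain ⟨w, rfl⟩ := Submodule.mkQ_surjective _ w
    rw [← hw]
    refine (Submodule.Quotient.mk_eq_zero _).2 ?_
    exact Submodule.mem_sup_right (Ideal.mul_mem_right _ _ (Ideal.mem_span_singleton_self x))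

lemma mem_ker_colonProj {𝔞 : Ideal R} {x v : R} :
    𝔞.mkQ v ∈ LinearMap.ker (colonProj 𝔞 x) ↔ x * v ∈ 𝔞 := by
  rw [LinearMap.mem_ker]
  change (Submodule.Quotient.mk v : R ⧸ colon 𝔞 x) = 0 ↔ _
  rw [Submodule.Quotient.mk_eq_zero, mem_colon]

lemma length_ker_colonProj (𝔞 : Ideal R) (x : R) :
    Module.length R (LinearMap.ker (colonProj 𝔞 x)) = rlen 𝔞 (colon 𝔞 x) := by
  have : LinearMap.ker (colonProj 𝔞 x) = Submodule.map 𝔞.mkQ (colon 𝔞 x) := by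
    ext v
    obtain ⟨v, rfl⟩ := Submodule.mkQ_surjective _ v
    rw [mem_ker_colonProj, ← Submodule.mem_comap, Submodule.comap_map_mkQ,
      sup_eq_right.2 (le_colon 𝔞 x), mem_colon]
  rw [this, rlen]

/-- The short exact sequence `0 → (𝔞 : x) ⧸ 𝔞 → R ⧸ 𝔞 → R ⧸ (𝔞 : x) → 0`. -/
abbrev colonSeq (𝔞 : Ideal R) (x : R) : ShortComplex (ModuleCat.{u} R) :=
  ModuleCat.shortComplexOfCompEqZero (LinearMap.ker (colonProj 𝔞 x)).subtype (colonProj 𝔞 x)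
    (LinearMap.ext fun v => v.2)

/-- The short exact sequence `0 → R ⧸ (𝔞 : x) → R ⧸ 𝔞 → R ⧸ (𝔞 + (x)) → 0`. -/
abbrev mulSeq (𝔞 : Ideal R) (x : R) : ShortComplex (ModuleCat.{u} R) :=
  ModuleCat.shortComplexOfCompEqZero (colonMul 𝔞 x) (addProj 𝔞 x)
    (colonMul_exact 𝔞 x).linearMap_comp_eq_zero

lemma colonSeq_shortExact (𝔞 : Ideal R) (x : R) : (colonSeq 𝔞 x).ShortExact :=
  ModuleCat.shortComplex_shortExact _ (LinearMap.exact_subtype_ker_map _)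
    (Submodule.injective_subtype _) (colonProj_surjective 𝔞 x)

lemma mulSeq_shortExact (𝔞 : Ideal R) (x : R) : (mulSeq 𝔞 x).ShortExact :=
  ModuleCat.shortComplex_shortExact _ (colonMul_exact 𝔞 x)
    (colonMul_injective 𝔞 x) (addProj_surjective 𝔞 x)

lemma colonSeq_g_mulSeq_f (𝔞 : Ideal R) (x : R) :
    (colonSeq 𝔞 x).g ≫ (mulSeq 𝔞 x).f = x • 𝟙 (ModuleCat.of R (R ⧸ 𝔞)) :=
  ModuleCat.hom_ext (LinearMap.ext fun v => colonMul_colonProj 𝔞 x v)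

end ColonSequences

section ExtLengths

open CategoryTheory.Abelian

variable {R : Type u} [CommRing R]

lemma length_ext_le₂ (X : ModuleCat.{u} R) {S : ShortComplex (ModuleCat.{u} R)}
    (hS : S.ShortExact) (j : ℕ) :
    Module.length R (Ext.{u} X S.X₂ j) ≤
      Module.length R (Ext.{u} X S.X₁ j) + Module.length R (Ext.{u} X S.X₃ j) := by
  refine length_le_of_exact ((Ext.mk₀ S.f).postcompOfLinear R X (add_zero j))
    ((Ext.mk₀ S.g).postcompOfLinear R X (add_zero j)) fun b hb => ?_
  obtain ⟨a, ha⟩ := Ext.covariant_sequence_exact₂ X hS b hb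
  exact ⟨a, ha⟩

lemma length_ext_le₃ (X : ModuleCat.{u} R) {S : ShortComplex (ModuleCat.{u} R)}
    (hS : S.ShortExact) (j : ℕ) :
    Module.length R (Ext.{u} X S.X₃ j) ≤
      Module.length R (Ext.{u} X S.X₂ j) + Module.length R (Ext.{u} X S.X₁ (j + 1)) := by
  refine length_le_of_exact ((Ext.mk₀ S.g).postcompOfLinear R X (add_zero j))
    (hS.extClass.postcompOfLinear R X rfl) fun b hb => ?_
  obtain ⟨a, ha⟩ := Ext.covariant_sequence_exact₃ X hS b rfl hb
  exact ⟨a, ha⟩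

lemma length_ext_congr (X : ModuleCat.{u} R) {Y Y' : ModuleCat.{u} R} (e : Y ≅ Y') (j : ℕ) :
    Module.length R (Ext.{u} X Y j) = Module.length R (Ext.{u} X Y' j) := by
  have key : ∀ {Y Y' : ModuleCat.{u} R} (e : Y ≅ Y'),
      Module.length R (Ext.{u} X Y j) ≤ Module.length R (Ext.{u} X Y' j) := fun {Y Y'} e => by
    refine Module.length_le_of_injective
      ((Ext.mk₀ e.hom).postcompOfLinear R X (add_zero j)) fun a b hab => ?_
    have h := congrArg (fun z => Ext.comp z (Ext.mk₀ e.inv) (add_zero j)) hab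
    change (a.comp (Ext.mk₀ e.hom) (add_zero j)).comp (Ext.mk₀ e.inv) (add_zero j) =
      (b.comp (Ext.mk₀ e.hom) (add_zero j)).comp (Ext.mk₀ e.inv) (add_zero j) at h
    rwa [Ext.comp_assoc _ _ _ _ (zero_add 0) (by omega), Ext.mk₀_comp_mk₀, e.hom_inv_id,
      Ext.comp_mk₀_id, Ext.comp_assoc _ _ _ _ (zero_add 0) (by omega), Ext.mk₀_comp_mk₀, e.hom_inv_id,
      Ext.comp_mk₀_id] at h
  exact le_antisymm (key e) (key e.symm)

end ExtLengths

section Beta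

open CategoryTheory.Abelian

variable {R : Type u} [CommRing R] [IsLocalRing R]

/-- The residue field as an `R`-module. -/
abbrev resMod (R : Type u) [CommRing R] [IsLocalRing R] : ModuleCat.{u} R :=
  ModuleCat.of R (R ⧸ maximalIdeal R)

/-- The Bass numbers `ℓ(Ext^j(k, N))`. -/
noncomputable def bass (R : Type u) [CommRing R] [IsLocalRing R] (N : Type u) [AddCommGroup N] [Module R N] (j : ℕ) : ℕ∞ :=
  Module.length R (Ext.{u} (resMod R) (ModuleCat.of R N) j)

lemma bass_ne_top [IsNoetherianRing R] (N : Type u) [AddCommGroup N] [Module R N]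
    [Module.Finite R N] (j : ℕ) : bass R N j ≠ ⊤ := by
  refine length_ne_top_of_pow_smul _ (ModuleCat.finite_ext _ _ _ _) (t := 1) fun r hr y => ?_
  refine ext_smul_eq_zero_left (fun x => ?_) y
  obtain ⟨x, rfl⟩ := Submodule.mkQ_surjective _ x
  rw [← map_smul, Submodule.mkQ_apply, Submodule.Quotient.mk_eq_zero]
  exact Ideal.mul_mem_right _ _ (by simpa using hr)

lemma bass_le (N : Type u) [AddCommGroup N] [Module R N] (j n : ℕ)
    (h : Module.length R N ≤ n) :
    bass R N j ≤ n * bass R (R ⧸ maximalIdeal R) j := by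
  induction n generalizing N with
  | zero =>
    have hN : Subsingleton N := (Module.length_eq_zero_iff (R := R)).1 (by simpa using h)
    have : Subsingleton (Ext.{u} (resMod R) (ModuleCat.of R N) j) := by
      refine subsingleton_of_forall_eq 0 fun a => ?_
      rw [← one_smul R a]
      exact ext_smul_eq_zero_right (fun y => Subsingleton.elim _ _) a
    rw [bass, Module.length_eq_zero]
    simp
  | succ n ih =>
    rcases subsingleton_or_nontrivial N with hN | hN
    · refine (ih N ?_).trans (by gcongr; simp)
      rw [Module.length_eq_zero]; simp
    have hfl : IsFiniteLength R N := Module.length_ne_top_iff.1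
      (ne_top_of_le_ne_top (ENat.natCast_ne_top _) h)
    have hnoeth := (isFiniteLength_iff_isNoetherian_isArtinian.1 hfl).1
    obtain ⟨K, hK⟩ := IsCoatomic.exists_coatom (Submodule R N)
    have hadd := Module.length_eq_add_of_exact K.subtype K.mkQ K.subtype_injective
      K.mkQ_surjective (LinearMap.exact_subtype_mkQ K)
    have hs : IsSimpleModule R (N ⧸ K) := isSimpleModule_iff_isCoatom.2 hK
    obtain ⟨I, hI, ⟨e⟩⟩ := isSimpleModule_iff_quot_maximal.1 hs
    have hIm := IsLocalRing.eq_maximalIdeal hI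
    subst hIm
    have hle : Module.length R K ≤ n := by
      have h1 : Module.length R K + 1 ≤ (n : ℕ∞) + 1 := by
        rw [← (Module.length_eq_one_iff (R := R) (M := N ⧸ K)).2 hs, ← hadd]
        rw [(Module.length_eq_one_iff (R := R) (M := N ⧸ K)).2 hs]
        exact h.trans (by push_cast; rfl)
      exact (ENat.add_le_add_iff_right ENat.one_ne_top).1 h1
    have h2 := length_ext_le₂ (resMod R) (ModuleCat.shortComplex_shortExact
      (ModuleCat.shortComplexOfCompEqZero K.subtype K.mkQ
        (LinearMap.exact_subtype_mkQ K).linearMap_comp_eq_zero)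
      (LinearMap.exact_subtype_mkQ K) K.subtype_injective K.mkQ_surjective) j
    have h3 := length_ext_congr (resMod R) e.toModuleIso j
    calc bass R N j ≤ bass R K j + bass R (N ⧸ K) j := h2
      _ ≤ n * bass R (R ⧸ maximalIdeal R) j + bass R (R ⧸ maximalIdeal R) j :=
        add_le_add (ih K hle) h3.le
      _ = _ := by push_cast; ring

lemma bass_quot_sup_le (𝔞 : Ideal R) (x : R) (C i : ℕ) (hC : rlen 𝔞 (colon 𝔞 x) ≤ C) :
    bass R (R ⧸ (𝔞 ⊔ Ideal.span {x})) i ≤ bass R (R ⧸ 𝔞) i + bass R (R ⧸ 𝔞) (i + 1) +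
      C * bass R (R ⧸ maximalIdeal R) (i + 2) := by
  have h1 := length_ext_le₃ (resMod R) (mulSeq_shortExact 𝔞 x) i
  have h2 := length_ext_le₃ (resMod R) (colonSeq_shortExact 𝔞 x) (i + 1)
  have h3 := bass_le (LinearMap.ker (colonProj 𝔞 x)) (i + 2) C
    ((length_ker_colonProj 𝔞 x).trans_le hC)
  calc bass R (R ⧸ (𝔞 ⊔ Ideal.span {x})) i
      ≤ bass R (R ⧸ 𝔞) i + bass R (R ⧸ colon 𝔞 x) (i + 1) := h1
    _ ≤ bass R (R ⧸ 𝔞) i + (bass R (R ⧸ 𝔞) (i + 1) + bass R (LinearMap.ker (colonProj 𝔞 x)) (i + 2)) :=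
      add_le_add le_rfl h2
    _ ≤ _ := by rw [← add_assoc]; exact add_le_add le_rfl h3

lemma rlen_colonIdeal_eq_bass (Q : Ideal R) : rlen Q (colonIdeal R Q) = bass R (R ⧸ Q) 0 := by
  let ev : (R ⧸ maximalIdeal R →ₗ[R] R ⧸ Q) →ₗ[R] R ⧸ Q :=
    LinearMap.applyₗ (1 : R ⧸ maximalIdeal R)
  have hinj : Function.Injective ev := by
    rw [injective_iff_map_eq_zero]
    intro f hf
    refine LinearMap.ext fun x => ?_
    obtain ⟨x, rfl⟩ := Submodule.mkQ_surjective _ x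
    have h1 : (maximalIdeal R).mkQ x = x • (1 : R ⧸ maximalIdeal R) := by
      rw [Algebra.smul_def, mul_one]; rfl
    have hf : f 1 = 0 := hf
    rw [h1, map_smul, hf, smul_zero]
    rfl
  have hrange : LinearMap.range ev = Submodule.map Q.mkQ (colonIdeal R Q) := by
    ext v
    constructor
    · rintro ⟨f, rfl⟩
      obtain ⟨c, hc⟩ := Submodule.mkQ_surjective _ (f 1)
      refine ⟨c, fun r hr => ?_, hc⟩
      rw [← Submodule.Quotient.mk_eq_zero Q]
      have h1 : r • (1 : R ⧸ maximalIdeal R) = 0 := by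
        rw [Algebra.smul_def, mul_one]
        exact Ideal.Quotient.eq_zero_iff_mem.2 hr
      have : r • f 1 = 0 := by rw [← map_smul, h1, map_zero]
      rw [← hc] at this
      exact this
    · rintro ⟨c, hc, rfl⟩
      refine ⟨(maximalIdeal R).liftQ (LinearMap.toSpanSingleton R (R ⧸ Q) (Q.mkQ c)) fun r hr =>
        (Submodule.Quotient.mk_eq_zero _).2 (hc r hr), ?_⟩
      exact one_smul R (Q.mkQ c)
  have e : Ext.{u} (resMod R) (ModuleCat.of R (R ⧸ Q)) 0 ≃ₗ[R]
      (R ⧸ maximalIdeal R →ₗ[R] R ⧸ Q) :=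
    (Ext.linearEquiv₀ (R := R)).trans ModuleCat.homLinearEquiv
  rw [rlen, ← hrange, bass, e.length_eq, (LinearEquiv.ofInjective ev hinj).length_eq]

end Beta

section Parameters

variable {R : Type u} [CommRing R] [IsLocalRing R] [IsNoetherianRing R]

lemma one_le_qdim {P : Ideal R} (hP : P.IsPrime) (hne : P ≠ maximalIdeal R) : 1 ≤ qdim P := by
  by_contra hlt
  have h0 : ringKrullDim (R ⧸ P) ≤ 0 := by
    have h1 : qdim P < 1 := not_le.1 hlt
    rw [qdim] at h1
    generalize ringKrullDim (R ⧸ P) = a at h1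
    induction a with
    | bot => exact bot_le
    | coe a =>
      have : a < 1 := by exact_mod_cast h1
      rw [Order.lt_one_iff] at this
      rw [this]; rfl
  have : Ring.KrullDimLE 0 (R ⧸ P) := Ring.krullDimLE_iff.2 (by simpa using h0)
  have hf := Ring.KrullDimLE.isField_of_isDomain (R := R ⧸ P)
  exact hne (IsLocalRing.eq_maximalIdeal (Ideal.Quotient.maximal_of_isField P hf))

lemma maximalIdeal_le_radical_of_qdim {T : Ideal R} (h : qdim T ≤ 0) :
    maximalIdeal R ≤ T.radical := by
  rw [Ideal.radical_eq_sInf]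
  refine le_sInf fun P hP => ?_
  have : P = maximalIdeal R := by
    by_contra hne
    have h1 := (one_le_qdim hP.2 hne).trans ((qdim_anti hP.1).trans h)
    exact absurd h1 (by decide)
  exact this.ge

/-- Prime avoidance: an ideal not contained in a prime of maximal dimension contains a
parameter. -/
lemma exists_param {T 𝔟 : Ideal R} {s : ℕ} (h : qdim T = (s + 1 : ℕ))
    (h𝔟 : ∀ P : Ideal R, P.IsPrime → T ≤ P → (s + 1 : ℕ) ≤ qdim P → ¬ 𝔟 ≤ P) :
    ∃ x ∈ 𝔟, x ∈ maximalIdeal R ∧ qdim (T ⊔ Ideal.span {x}) = s := by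
  obtain ⟨x, hx, hxP⟩ : ∃ x ∈ 𝔟 * maximalIdeal R,
      ∀ P : Ideal R, P.IsPrime → T ≤ P → (s + 1 : ℕ) ≤ qdim P → x ∉ P := by
    by_contra hcon
    push Not at hcon
    have hsub : ((𝔟 * maximalIdeal R : Ideal R) : Set R) ⊆
        ⋃ P ∈ {P : Ideal R | P.IsPrime ∧ T ≤ P ∧ ((s + 1 : ℕ) : WithBot ℕ∞) ≤ qdim P},
          (P : Set R) := by
      intro x hx
      obtain ⟨P, h1, h2, h3, h4⟩ := hcon x hx
      exact Set.mem_biUnion (show P ∈ _ from ⟨h1, h2, h3⟩) h4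
    obtain ⟨P, ⟨h1, h2, h3⟩, hle⟩ := (Ideal.subset_union_prime_finite (finite_primes_of_qdim h.le)
      ⊥ ⊥ fun P hP _ _ => hP.1).1 hsub
    rcases h1.mul_le.1 hle with h4 | h4
    · exact h𝔟 P h1 h2 h3 h4
    · have h5 : maximalIdeal R ≤ P.radical := h4.trans Ideal.le_radical
      have h6 := h3.trans (qdim_le_zero h5)
      have : s + 1 ≤ 0 := by exact_mod_cast h6
      omega
  refine ⟨x, Ideal.mul_le_left hx, Ideal.mul_le_right hx, le_antisymm (qdim_sup_span_le hxP) ?_⟩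
  have h1 := qdim_le_add_one (T := T) (x := x) (Ideal.mul_le_right hx)
  rw [h] at h1
  generalize qdim (T ⊔ Ideal.span {x}) = a at h1
  induction a with
  | bot => exact absurd h1 (by simp)
  | coe a =>
    induction a using ENat.recTopCoe with
    | top => exact le_top
    | coe a =>
      have : s + 1 ≤ a + 1 := by exact_mod_cast h1
      exact_mod_cast (by omega : s ≤ a)

lemma PSys.cons {T : Ideal R} {x : R} {l : List R} (hx : x ∈ maximalIdeal R)
    (h : PSys (T ⊔ Ideal.span {x}) l) (hd : qdim T = (l.length + 1 : ℕ)) : PSys T (x :: l) where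
  dim := by rw [hd, List.length_cons]
  mem := by
    intro a ha
    rcases List.mem_cons.1 ha with rfl | ha
    · exact hx
    · exact h.mem a ha
  rad := by
    rw [Ideal.ofList_cons, ← sup_assoc]
    exact h.rad

lemma exists_pSys (s : ℕ) : ∀ T : Ideal R, qdim T = (s : ℕ) → ∃ l, PSys T l := by
  induction s with
  | zero =>
    intro T h
    exact ⟨[], by simpa using h, by simp, by
      simpa using maximalIdeal_le_radical_of_qdim (T := T) (by simpa using h.le)⟩
  | succ s ih =>
    intro T h
    obtain ⟨x, -, hx, hd⟩ := exists_param (𝔟 := ⊤) h fun P hP _ _ => by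
      rw [top_le_iff]; exact hP.ne_top
    obtain ⟨l, hl⟩ := ih _ hd
    refine ⟨x :: l, PSys.cons hx hl ?_⟩
    have : l.length = s := by
      have := hl.dim.symm.trans hd
      exact_mod_cast this
    rw [h, this]

lemma bT_le_bT_sup {T : Ideal R} {x : R} {s : ℕ} (hx : x ∈ maximalIdeal R)
    (hd : qdim T = (s + 1 : ℕ)) (hd' : qdim (T ⊔ Ideal.span {x}) = s) :
    bT T ≤ bT (T ⊔ Ideal.span {x}) := by
  intro c hc p a q hP v hv
  have hlen : (p ++ a :: q).length = s := by
    have := hP.dim.symm.trans hd'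
    exact_mod_cast this
  have h1 : PSys T ((x :: p) ++ a :: q) := by
    refine PSys.cons hx hP ?_
    rw [hd]
    exact congrArg (fun n : ℕ => ((n + 1 : ℕ) : WithBot ℕ∞)) hlen.symm
  have e : T ⊔ Ideal.span {x} ⊔ Ideal.ofList p = T ⊔ Ideal.ofList (x :: p) := by
    rw [Ideal.ofList_cons, sup_assoc]
  rw [e] at hv ⊢
  exact bT_apply hc h1 hv

end Parameters

section LocalCohomFacts

variable {R : Type u} [CommRing R] [IsLocalRing R] [IsNoetherianRing R]

/-- The local cohomology of `R ⧸ T` at the maximal ideal. -/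
abbrev LQ (T : Ideal R) (i : ℕ) : Type u := LC (maximalIdeal R) (ModuleCat.of R (R ⧸ T)) i

lemma bT_smul_ker_colonProj {T : Ideal R} {y : R} {l : List R} (h : PSys T (y :: l)) {c : R}
    (hc : c ∈ bT T) (u : LinearMap.ker (colonProj T y)) : c • u = 0 := by
  obtain ⟨u, hu⟩ := u
  obtain ⟨v, rfl⟩ := Submodule.mkQ_surjective _ u
  rw [mem_ker_colonProj] at hu
  have h1 : c * v ∈ T := by simpa using bT_apply hc (p := []) h (by simpa using hu)
  exact Subtype.ext ((Submodule.Quotient.mk_eq_zero _).2 h1)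

lemma bT_pow_smul_LQ (i : ℕ) : ∀ (T : Ideal R) (s : ℕ), qdim T = (s : ℕ) → i < s →
    ∀ c ∈ bT T ^ (i + 1), ∀ z : LQ T i, c • z = 0 := by
  induction i with
  | zero =>
    intro T s hs his c hc z
    obtain ⟨s, rfl⟩ : ∃ s', s = s' + 1 := ⟨s - 1, by omega⟩
    obtain ⟨t, ht⟩ := z.torsion
    obtain ⟨y, hy, hym, hd⟩ := exists_param (𝔟 := maximalIdeal R ^ t) hs fun P hP _ h3 hle => by
      have h5 : maximalIdeal R ≤ P.radical := (hP.le_of_pow_le hle).trans Ideal.le_radical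
      have h6 := h3.trans (qdim_le_zero h5)
      have : s + 1 ≤ 0 := by exact_mod_cast h6
      omega
    obtain ⟨l, hl⟩ := exists_pSys s _ hd
    have hP : PSys T (y :: l) := PSys.cons hym hl (by
      rw [hs]
      have := hl.dim.symm.trans hd
      have : l.length = s := by exact_mod_cast this
      rw [this])
    rw [zero_add, pow_one] at hc
    have h1 : LC.map (mulSeq T y).f 0 (LC.map (colonSeq T y).g 0 z) = 0 := by
      rw [LC.map_map, colonSeq_g_mulSeq_f, LC.map_smul_id]
      exact ht y hy
    have h2 := LC.injective_zero (mulSeq_shortExact T y) _ h1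
    obtain ⟨u, rfl⟩ := LC.exact₂ (colonSeq_shortExact T y) z h2
    rw [← map_smul, LC.smul_eq_zero (fun w => bT_smul_ker_colonProj hP hc w), map_zero]
  | succ i ih =>
    intro T s hs his c hc z
    obtain ⟨s, rfl⟩ : ∃ s', s = s' + 1 := ⟨s - 1, by omega⟩
    obtain ⟨t, ht⟩ := z.torsion
    obtain ⟨y, hy, hym, hd⟩ := exists_param (𝔟 := maximalIdeal R ^ t) hs fun P hP _ h3 hle => by
      have h5 : maximalIdeal R ≤ P.radical := (hP.le_of_pow_le hle).trans Ideal.le_radical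
      have h6 := h3.trans (qdim_le_zero h5)
      have : s + 1 ≤ 0 := by exact_mod_cast h6
      omega
    obtain ⟨l, hl⟩ := exists_pSys s _ hd
    have hP : PSys T (y :: l) := PSys.cons hym hl (by
      rw [hs]
      have := hl.dim.symm.trans hd
      have : l.length = s := by exact_mod_cast this
      rw [this])
    have h1 : LC.map (mulSeq T y).f (i + 1) (LC.map (colonSeq T y).g (i + 1) z) = 0 := by
      rw [LC.map_map, colonSeq_g_mulSeq_f, LC.map_smul_id]
      exact ht y hy
    obtain ⟨η, hη⟩ := LC.exact₁ (mulSeq_shortExact T y) _ h1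
    have key : ∀ b ∈ bT T ^ (i + 1), ∀ c ∈ bT T, (b * c) • z = 0 := by
      intro b hb c hc
      have h2 : b • η = 0 := ih _ s hd (by omega) b
        (Ideal.pow_right_mono (bT_le_bT_sup hym hs hd) _ hb) η
      have h3 : LC.map (colonSeq T y).g (i + 1) (b • z) = 0 := by
        rw [map_smul, ← hη, ← map_smul, h2, map_zero]
      obtain ⟨u, hu⟩ := LC.exact₂ (colonSeq_shortExact T y) _ h3
      rw [mul_comm, mul_smul, ← hu, ← map_smul,
        LC.smul_eq_zero (fun w => bT_smul_ker_colonProj hP hc w), map_zero]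
    rw [pow_succ] at hc
    induction hc using Submodule.mul_induction_on' with
    | mem_mul_mem a ha b hb => exact key a ha b hb
    | add a _ b _ h1 h2 => rw [add_smul, h1, h2, add_zero]

lemma pow_smul_ker_colonProj {𝔞 : Ideal R} {x : R} {t : ℕ}
    (h : maximalIdeal R ^ t * colon 𝔞 x ≤ 𝔞) :
    ∀ r ∈ maximalIdeal R ^ t, ∀ u : LinearMap.ker (colonProj 𝔞 x), r • u = 0 := by
  rintro r hr ⟨u, hu⟩
  obtain ⟨v, rfl⟩ := Submodule.mkQ_surjective _ u
  rw [mem_ker_colonProj] at hu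
  exact Subtype.ext ((Submodule.Quotient.mk_eq_zero _).2
    (h (Ideal.mul_mem_mul hr (mem_colon.2 hu))))

lemma rlen_colon_le_length_LQ {𝔞 : Ideal R} {x : R} {t : ℕ}
    (h : maximalIdeal R ^ t * colon 𝔞 x ≤ 𝔞) :
    rlen 𝔞 (colon 𝔞 x) ≤ Module.length R (LQ 𝔞 0) := by
  rw [← length_ker_colonProj]
  exact length_le_length_LC (M := ModuleCat.of R (R ⧸ 𝔞)) (t := t) fun u hu r hr =>
    congrArg Subtype.val (pow_smul_ker_colonProj h r hr ⟨u, hu⟩)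

lemma length_LQ_sup_le {𝔞 : Ideal R} {x : R} {t : ℕ}
    (h : maximalIdeal R ^ t * colon 𝔞 x ≤ 𝔞) (i : ℕ) :
    Module.length R (LQ (𝔞 ⊔ Ideal.span {x}) i) ≤
      Module.length R (LQ 𝔞 i) + Module.length R (LQ 𝔞 (i + 1)) := by
  have h1 := length_le_of_exact (LC.map (J := maximalIdeal R) (mulSeq 𝔞 x).g i)
    (LC.comp (mulSeq_shortExact 𝔞 x).extClass (rfl : i + 1 = i + 1))
    fun b hb => LC.exact₃ (mulSeq_shortExact 𝔞 x) b hb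
  refine h1.trans (add_le_add le_rfl ?_)
  refine Module.length_le_of_surjective (LC.map (J := maximalIdeal R) (colonSeq 𝔞 x).g (i + 1))
    fun b => ?_
  refine LC.exact₃ (colonSeq_shortExact 𝔞 x) b ?_
  exact LC.eq_zero_of_pow_smul (pow_smul_ker_colonProj h) _

lemma map_colonSeq_injective {T : Ideal R} {x : R} {t : ℕ}
    (h : maximalIdeal R ^ t * colon T x ≤ T) (j : ℕ) :
    Function.Injective (LC.map (J := maximalIdeal R) (colonSeq T x).g (j + 1)) := by
  rw [injective_iff_map_eq_zero]
  intro z hz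
  obtain ⟨u, rfl⟩ := LC.exact₂ (colonSeq_shortExact T x) _ hz
  rw [LC.eq_zero_of_pow_smul (N := (colonSeq T x).X₁) (pow_smul_ker_colonProj h) u, map_zero]

/-- If `x` annihilates `H^{j+1}(R ⧸ T)`, this module embeds into a quotient of
`H^j(R ⧸ (T + (x)))`. -/
lemma length_LQ_succ_le {T : Ideal R} {x : R} {t : ℕ}
    (h : maximalIdeal R ^ t * colon T x ≤ T) (j : ℕ) (hx : ∀ z : LQ T (j + 1), x • z = 0) :
    Module.length R (LQ T (j + 1)) ≤ Module.length R (LQ (T ⊔ Ideal.span {x}) j) := by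
  let δ := LC.comp (J := maximalIdeal R) (mulSeq_shortExact T x).extClass (rfl : j + 1 = j + 1)
  have hmem : ∀ z : LQ T (j + 1), LC.map (colonSeq T x).g (j + 1) z ∈ LinearMap.range δ := by
    intro z
    obtain ⟨η, hη⟩ := LC.exact₁ (mulSeq_shortExact T x) (LC.map (colonSeq T x).g (j + 1) z) (by
      rw [LC.map_map, colonSeq_g_mulSeq_f, LC.map_smul_id]
      exact hx z)
    exact ⟨η, hη⟩
  refine (Module.length_le_of_injective ((LC.map (colonSeq T x).g (j + 1)).codRestrict
    (LinearMap.range δ) hmem) fun a b hab => ?_).trans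
    (Module.length_le_of_surjective _ (LinearMap.surjective_rangeRestrict δ))
  exact map_colonSeq_injective h j (congrArg Subtype.val hab)

end LocalCohomFacts

section ExtAnnihilation

open CategoryTheory.Abelian

variable {R : Type u} [CommRing R]

lemma ext_smul_eq_zero₂ {X : ModuleCat.{u} R} {S : ShortComplex (ModuleCat.{u} R)}
    (hS : S.ShortExact) {i : ℕ} {c c' : R} (h₁ : ∀ a : Ext.{u} X S.X₁ i, c • a = 0)
    (h₃ : ∀ a : Ext.{u} X S.X₃ i, c' • a = 0) (a : Ext.{u} X S.X₂ i) : (c * c') • a = 0 := by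
  obtain ⟨b, hb⟩ := Ext.covariant_sequence_exact₂ X hS (c' • a)
    (by rw [Ext.smul_comp]; exact h₃ _)
  rw [mul_smul, ← hb, ← Ext.smul_comp, h₁, Ext.zero_comp]

lemma ext_smul_eq_zero₃ {X : ModuleCat.{u} R} {S : ShortComplex (ModuleCat.{u} R)}
    (hS : S.ShortExact) {i : ℕ} {c c' : R} (h₂ : ∀ a : Ext.{u} X S.X₂ i, c • a = 0)
    (h₁ : ∀ a : Ext.{u} X S.X₁ (i + 1), c' • a = 0) (a : Ext.{u} X S.X₃ i) :
    (c * c') • a = 0 := by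
  obtain ⟨b, hb⟩ := Ext.covariant_sequence_exact₃ X hS (c' • a) rfl
    (by rw [Ext.smul_comp]; exact h₁ _)
  rw [mul_smul, ← hb, ← Ext.smul_comp, h₂, Ext.zero_comp]

lemma ext_smul_eq_zero₁ {X : ModuleCat.{u} R} {S : ShortComplex (ModuleCat.{u} R)}
    (hS : S.ShortExact) {i : ℕ} {c c' : R} (h₃ : ∀ a : Ext.{u} X S.X₃ i, c • a = 0)
    (h₂ : ∀ a : Ext.{u} X S.X₂ (i + 1), c' • a = 0) (a : Ext.{u} X S.X₁ (i + 1)) :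
    (c * c') • a = 0 := by
  obtain ⟨b, hb⟩ := Ext.covariant_sequence_exact₁ X hS (c' • a)
    (by rw [Ext.smul_comp]; exact h₂ _) rfl
  rw [mul_smul, ← hb, ← Ext.smul_comp, h₃, Ext.zero_comp]

lemma ext_zero_eq_zero₁ {X : ModuleCat.{u} R} {S : ShortComplex (ModuleCat.{u} R)}
    (hS : S.ShortExact) (h₂ : ∀ a : Ext.{u} X S.X₂ 0, a = 0) (a : Ext.{u} X S.X₁ 0) :
    a = 0 := by
  have := hS.mono_f
  refine Ext.postcomp_mk₀_injective_of_mono X S.f ?_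
  change a.comp (Ext.mk₀ S.f) (add_zero 0) = (0 : Ext X S.X₁ 0).comp (Ext.mk₀ S.f) (add_zero 0)
  rw [h₂ (a.comp (Ext.mk₀ S.f) (add_zero 0)), Ext.zero_comp]

lemma ext_eq_zero_contra₂ {Y : ModuleCat.{u} R} {S : ShortComplex (ModuleCat.{u} R)}
    (hS : S.ShortExact) {i : ℕ} (h₁ : ∀ a : Ext.{u} S.X₁ Y i, a = 0)
    (h₃ : ∀ a : Ext.{u} S.X₃ Y i, a = 0) (a : Ext.{u} S.X₂ Y i) : a = 0 := by
  obtain ⟨b, rfl⟩ := Ext.contravariant_sequence_exact₂ hS Y a (h₁ _)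
  rw [h₃ b, Ext.comp_zero]

lemma ext_eq_zero_of_iso_left {X X' Y : ModuleCat.{u} R} (e : X ≅ X') {i : ℕ}
    (h : ∀ a : Ext.{u} X Y i, a = 0) (a : Ext.{u} X' Y i) : a = 0 := by
  have h1 := h ((Ext.mk₀ e.hom).comp a (zero_add i))
  have h2 : (Ext.mk₀ e.inv).comp ((Ext.mk₀ e.hom).comp a (zero_add i)) (zero_add i) = a := by
    rw [← Ext.comp_assoc _ _ _ (zero_add 0) _ (by omega), Ext.mk₀_comp_mk₀, e.inv_hom_id,
      Ext.mk₀_id_comp]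
  rw [← h2, h1, Ext.comp_zero]

lemma ext_smul_eq_zero_of_iso_right {X Y Y' : ModuleCat.{u} R} (e : Y ≅ Y') {i : ℕ} {c : R}
    (h : ∀ a : Ext.{u} X Y i, c • a = 0) (a : Ext.{u} X Y' i) : c • a = 0 := by
  have h1 := h (a.comp (Ext.mk₀ e.inv) (add_zero i))
  have h2 : (a.comp (Ext.mk₀ e.inv) (add_zero i)).comp (Ext.mk₀ e.hom) (add_zero i) = a := by
    rw [Ext.comp_assoc _ _ _ _ (zero_add 0) (by omega), Ext.mk₀_comp_mk₀, e.inv_hom_id,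
      Ext.comp_mk₀_id]
  rw [← h2, ← Ext.smul_comp, h1, Ext.zero_comp]

/-- Vanishing of local cohomology below `n` gives vanishing of `Ext` from modules of finite
length. -/
lemma ext_eq_zero_of_LC [IsLocalRing R] [IsNoetherianRing R] {N : ModuleCat.{u} R} {n : ℕ}
    (hN : ∀ i < n, ∀ z : LC (maximalIdeal R) N i, z = 0) (i : ℕ) (hi : i < n) :
    ∀ (X : Type u) [AddCommGroup X] [Module R X], Module.Finite R X →
      ∀ t, (∀ r ∈ maximalIdeal R ^ t, ∀ y : X, r • y = 0) →
      ∀ a : Ext.{u} (ModuleCat.of R X) N i, a = 0 := by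
  induction i with
  | zero => ?_
  | succ i ih => ?_
  all_goals
    intro X _ _ hX t
    induction hX using IsNoetherianRing.induction_on_isQuotientEquivQuotientPrime R with
    | subsingleton X =>
      intro _ a
      rw [← one_smul R a]
      exact ext_smul_eq_zero_left (fun y => Subsingleton.elim _ _) a
    | exact N₁ N₂ N₃ f g hf hg hfg h₁ h₃ =>
      intro h
      have h1 := h₁ fun r hr y => hf (by rw [map_smul, h r hr, map_zero])
      have h3 := h₃ fun r hr y => by
        obtain ⟨y, rfl⟩ := hg y
        rw [← map_smul, h r hr, map_zero]
      exact ext_eq_zero_contra₂ (ModuleCat.shortComplex_shortExact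
        (ModuleCat.shortComplexOfCompEqZero f g hfg.linearMap_comp_eq_zero) hfg hf hg) h1 h3
    | quotient X p f => ?_
  all_goals
    intro h
    have hp : p.1 = maximalIdeal R := by
      refine le_antisymm (le_maximalIdeal p.2.ne_top) ?_
      have : maximalIdeal R ^ t ≤ p.1 := by
        intro r hr
        rw [← Ideal.Quotient.eq_zero_iff_mem]
        have h1 := h r hr (f.symm 1)
        rw [← map_smul, LinearEquiv.map_eq_zero_iff, Algebra.smul_def, mul_one] at h1
        exact h1
      exact p.2.le_of_pow_le this
    have e : (R ⧸ maximalIdeal R ^ 1) ≃ₗ[R] X :=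
      (Submodule.quotEquivOfEq _ _ (by rw [hp, pow_one])).trans f.symm
    refine ext_eq_zero_of_iso_left e.toModuleIso fun a => ?_
    have ha0 : LC.of (maximalIdeal R) N _ 1 a = 0 := hN _ hi _
    obtain ⟨m, hm, ha⟩ := LC.of_eq_zero ha0
  · have : Epi (powProj (maximalIdeal R) hm) := (ModuleCat.epi_iff_surjective _).2
      (Submodule.factor_surjective (Ideal.pow_le_pow_right hm))
    refine Ext.precomp_mk₀_injective_of_epi N (powProj (maximalIdeal R) hm) ?_
    change (Ext.mk₀ (powProj (maximalIdeal R) hm)).comp a (zero_add 0) =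
      (Ext.mk₀ (powProj (maximalIdeal R) hm)).comp 0 (zero_add 0)
    rw [Ext.comp_zero]
    exact ha
  · let π : (R ⧸ maximalIdeal R ^ m) →ₗ[R] (R ⧸ maximalIdeal R ^ 1) :=
      Submodule.factor (Ideal.pow_le_pow_right hm)
    have hπ : Function.Surjective π := Submodule.factor_surjective (Ideal.pow_le_pow_right hm)
    obtain ⟨b, rfl⟩ := Ext.contravariant_sequence_exact₃ (ModuleCat.shortComplex_shortExact
      (ModuleCat.shortComplexOfCompEqZero (LinearMap.ker π).subtype π
        (LinearMap.ext fun v => v.2)) (LinearMap.exact_subtype_ker_map π)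
        (Submodule.injective_subtype _) hπ) N a ha (n₀ := i) (by omega)
    have hb := ih (by omega) (LinearMap.ker π) inferInstance m (by
      rintro r hr ⟨y, hy⟩
      refine Subtype.ext ?_
      change r • y = 0
      obtain ⟨y, rfl⟩ := Submodule.mkQ_surjective _ y
      rw [← map_smul, Submodule.mkQ_apply, Submodule.Quotient.mk_eq_zero]
      exact Ideal.mul_mem_right _ _ hr) b
    rw [hb, Ext.comp_zero]

end ExtAnnihilation

section ExtKill

open CategoryTheory.Abelian

variable {R : Type u} [CommRing R]

/-- `c` annihilates `Ext^i(X, N)` for all finite `X` with `dim X + i < e`. -/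
def ExtKillAt (c : R) (N : Type u) [AddCommGroup N] [Module R N] (e i : ℕ) : Prop :=
  ∀ (D : ℕ) (X : Type u) [AddCommGroup X] [Module R X], Module.Finite R X →
    qdim (Module.annihilator R X) ≤ D → i + D < e →
      ∀ a : Ext.{u} (ModuleCat.of R X) (ModuleCat.of R N) i, c • a = 0

/-- `c` annihilates `Ext^i(X, N)` for all `i` and all finite `X` with `dim X + i < e`. -/
def ExtKill (c : R) (N : Type u) [AddCommGroup N] [Module R N] (e : ℕ) : Prop :=
  ∀ i, ExtKillAt c N e i

variable [IsLocalRing R] [IsNoetherianRing R]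

lemma annihilator_eq_of_equiv_quotient {X : Type u} [AddCommGroup X] [Module R X] {p : Ideal R}
    (f : X ≃ₗ[R] R ⧸ p) : Module.annihilator R X = p := by
  rw [f.annihilator_eq, Ideal.annihilator_quotient]

lemma ext_subsingleton_of_surjective_smul {X N : ModuleCat.{u} R} [Module.Finite R X]
    [Module.Finite R N] {i : ℕ} {y : R} (hy : y ∈ maximalIdeal R)
    (h : ∀ a : Ext.{u} X N i, ∃ b, y • b = a) (a : Ext.{u} X N i) : a = 0 := by
  have hfin : Module.Finite R (Ext.{u} X N i) := ModuleCat.finite_ext _ _ _ _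
  have := Submodule.eq_bot_of_le_smul_of_le_jacobson_bot (maximalIdeal R)
    (⊤ : Submodule R (Ext.{u} X N i)) hfin.1 (fun a _ => by
      obtain ⟨b, rfl⟩ := h a
      exact Submodule.smul_mem_smul hy trivial) (maximalIdeal_le_jacobson ⊥)
  have ha : a ∈ (⊤ : Submodule R (Ext.{u} X N i)) := trivial
  rwa [this, Submodule.mem_bot] at ha

/-- Ischebeck's theorem: vanishing of `Ext^i` from modules of finite length for `i < n` implies
vanishing of `Ext^i(X, N)` for `i + dim X < n`. -/
lemma extKill_one {N : Type u} [AddCommGroup N] [Module R N] [Module.Finite R N] {n : ℕ}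
    (hN : ∀ i < n, ∀ a : Ext.{u} (ModuleCat.of R (R ⧸ maximalIdeal R)) (ModuleCat.of R N) i,
      a = 0) : ExtKill (1 : R) N n := by
  suffices h : ∀ (D i : ℕ) (X : Type u) [AddCommGroup X] [Module R X], Module.Finite R X →
    qdim (Module.annihilator R X) ≤ D → i + D < n →
      ∀ a : Ext.{u} (ModuleCat.of R X) (ModuleCat.of R N) i, a = 0 from
    fun i D X _ _ hX h1 h2 a => by rw [one_smul]; exact h D i X hX h1 h2 a
  intro D
  induction D using Nat.strong_induction_on with
  | _ D ih =>
    intro i X _ _ hX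
    induction hX using IsNoetherianRing.induction_on_isQuotientEquivQuotientPrime R with
    | subsingleton X =>
      intro _ _ a
      rw [← one_smul R a]
      exact ext_smul_eq_zero_left (fun y => Subsingleton.elim _ _) a
    | exact N₁ N₂ N₃ f g hf hg hfg h₁ h₃ =>
      intro h hi
      have h1 := h₁ ((qdim_anti (LinearMap.annihilator_le_of_injective f hf)).trans h) hi
      have h3 := h₃ ((qdim_anti (LinearMap.annihilator_le_of_surjective g hg)).trans h) hi
      exact ext_eq_zero_contra₂ (ModuleCat.shortComplex_shortExact
        (ModuleCat.shortComplexOfCompEqZero f g hfg.linearMap_comp_eq_zero) hfg hf hg) h1 h3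
    | quotient X p f =>
      intro h hi
      rw [annihilator_eq_of_equiv_quotient f] at h
      refine ext_eq_zero_of_iso_left f.symm.toModuleIso fun a => ?_
      have hp := p.2
      by_cases hpm : p.1 = maximalIdeal R
      · exact ext_eq_zero_of_iso_left
          (Submodule.quotEquivOfEq _ _ hpm.symm).toModuleIso (hN i (by omega)) a
      have h1 := (one_le_qdim hp hpm).trans h
      obtain ⟨D, rfl⟩ : ∃ D', D = D' + 1 := ⟨D - 1, by
        have : 1 ≤ D := by exact_mod_cast h1
        omega⟩
      obtain ⟨y, hy, hyp⟩ : ∃ y ∈ maximalIdeal R, y ∉ p.1 := by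
        by_contra hcon
        push Not at hcon
        exact hpm (le_antisymm (le_maximalIdeal hp.ne_top) hcon)
      have hq : qdim (p.1 ⊔ Ideal.span {y}) ≤ D := qdim_sup_span_le fun P hP hpP hd hyP => by
        have := mem_minimalPrimes_of_qdim h hP hpP hd
        exact hyp (this.2 ⟨hp, le_rfl⟩ hpP hyP)
      refine ext_subsingleton_of_surjective_smul hy (fun a => ?_) a
      have hexact : Function.Exact (y • (LinearMap.id : (R ⧸ p.1) →ₗ[R] R ⧸ p.1))
          (addProj p.1 y) := by
        intro v
        rw [colonMul_exact p.1 y v]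
        constructor
        · rintro ⟨w, rfl⟩
          obtain ⟨w, rfl⟩ := colonProj_surjective p.1 y w
          exact ⟨w, (colonMul_colonProj _ _ _).symm⟩
        · rintro ⟨w, rfl⟩
          exact ⟨colonProj p.1 y w, colonMul_colonProj _ _ _⟩
      have hinj : Function.Injective (y • (LinearMap.id : (R ⧸ p.1) →ₗ[R] R ⧸ p.1)) := by
        rw [injective_iff_map_eq_zero]
        intro v hv
        obtain ⟨v, rfl⟩ := Submodule.mkQ_surjective _ v
        have hv : y * v ∈ p.1 := (Submodule.Quotient.mk_eq_zero _).1 hv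
        exact (Submodule.Quotient.mk_eq_zero _).2 ((hp.mem_or_mem hv).resolve_left hyp)
      obtain ⟨b, hb⟩ := Ext.contravariant_sequence_exact₁ (ModuleCat.shortComplex_shortExact
        (ModuleCat.shortComplexOfCompEqZero _ _ hexact.linearMap_comp_eq_zero) hexact hinj
        (addProj_surjective _ _)) (ModuleCat.of R N) a (n₁ := i + 1) (by omega)
        (ih D (by omega) (i + 1) (R ⧸ (p.1 ⊔ Ideal.span {y})) inferInstance
          (by rwa [Ideal.annihilator_quotient]) (by omega) _)
      refine ⟨b, ?_⟩
      rw [← hb]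
      have : ModuleCat.ofHom (y • (LinearMap.id : (R ⧸ p.1) →ₗ[R] R ⧸ p.1)) = y • 𝟙 _ := rfl
      change y • b = (Ext.mk₀ (ModuleCat.ofHom (y • LinearMap.id))).comp b (zero_add i)
      rw [this, Ext.mk₀_smul, Ext.smul_comp, Ext.mk₀_id_comp]

lemma ExtKill.colon_le {c : R} {𝔠 : Ideal R} {e : ℕ} (h : ExtKill c (R ⧸ 𝔠) (e + 1)) {y : R}
    (hy : qdim (𝔠 ⊔ Ideal.span {y}) ≤ e) {v : R} (hv : y * v ∈ 𝔠) : c * v ∈ 𝔠 := by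
  let f : (R ⧸ (𝔠 ⊔ Ideal.span {y})) →ₗ[R] (R ⧸ 𝔠) :=
    (𝔠 ⊔ Ideal.span {y}).mapQ 𝔠 (LinearMap.lsmul R R v) (sup_le
      (fun a ha => Ideal.mul_mem_left _ v ha)
      ((Ideal.span_singleton_le_iff_mem _).2 (by
        change v * y ∈ 𝔠
        rwa [mul_comm])))
  have h0 := h 0 e (R ⧸ (𝔠 ⊔ Ideal.span {y})) inferInstance
    (by rwa [Ideal.annihilator_quotient]) (by omega) (Ext.mk₀ (ModuleCat.ofHom f))
  rw [← Ext.mk₀_smul, Ext.mk₀_eq_zero_iff] at h0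
  have h1 : c • f (Submodule.mkQ _ 1) = 0 := congrArg
    (fun g : ModuleCat.of R (R ⧸ (𝔠 ⊔ Ideal.span {y})) ⟶ ModuleCat.of R (R ⧸ 𝔠) =>
      g.hom (Submodule.mkQ _ 1)) h0
  have h2 : c * (v * 1) ∈ 𝔠 := (Submodule.Quotient.mk_eq_zero 𝔠).1 h1
  rwa [mul_one] at h2

lemma ExtKill.sup_span {c : R} {𝔠 : Ideal R} {e : ℕ} (h : ExtKill c (R ⧸ 𝔠) (e + 1)) {y : R}
    (hy : qdim (𝔠 ⊔ Ideal.span {y}) ≤ e) : ExtKill (c ^ 3) (R ⧸ (𝔠 ⊔ Ideal.span {y})) e := by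
  intro i D X _ _ hX hD hi a
  have hU : ∀ u : LinearMap.ker (colonProj 𝔠 y), c • u = 0 := by
    rintro ⟨u, hu⟩
    obtain ⟨v, rfl⟩ := Submodule.mkQ_surjective _ u
    rw [mem_ker_colonProj] at hu
    exact Subtype.ext ((Submodule.Quotient.mk_eq_zero _).2 (h.colon_le hy hu))
  have h1 : ∀ a : Ext.{u} (ModuleCat.of R X) (colonSeq 𝔠 y).X₃ (i + 1), (c * c) • a = 0 :=
    ext_smul_eq_zero₃ (colonSeq_shortExact 𝔠 y)
      (h (i + 1) D X hX hD (by omega)) (fun a => ext_smul_eq_zero_right hU a)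
  have h2 := ext_smul_eq_zero₃ (mulSeq_shortExact 𝔠 y) (h i D X hX hD (by omega)) h1 a
  rwa [← pow_two, ← pow_succ'] at h2

lemma ExtKill.mem_bT {c : R} {s : ℕ} : ∀ {𝔠 : Ideal R}, qdim 𝔠 = s →
    ExtKill c (R ⧸ 𝔠) s → c ^ 3 ^ s ∈ bT 𝔠 := by
  suffices hmain : ∀ (p : List R) (c : R) (𝔠 : Ideal R) (s n : ℕ), s ≤ n → qdim 𝔠 = s →
      ExtKill c (R ⧸ 𝔠) s → ∀ (a : R) (q : List R), PSys 𝔠 (p ++ a :: q) → ∀ v,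
        a * v ∈ 𝔠 ⊔ Ideal.ofList p → c ^ 3 ^ n * v ∈ 𝔠 ⊔ Ideal.ofList p from
    fun {𝔠} hs h p a q hP v hv => hmain p c 𝔠 s s le_rfl hs h a q hP v hv
  intro p
  induction p with
  | nil =>
    intro c 𝔠 s n hn hs h a q hP v hv
    rw [Ideal.ofList_nil, sup_bot_eq] at hv ⊢
    obtain ⟨s, rfl⟩ : ∃ s', s = s' + 1 := ⟨q.length, by
      have := hP.dim.symm.trans hs
      have : ((a :: q).length : ℕ) = s := by exact_mod_cast this
      simpa using this.symm⟩
    have hd : qdim (𝔠 ⊔ Ideal.span {a}) ≤ s := by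
      have h1 := (PSys.right (p := [a]) (q := q) hP).dim
      have := hP.dim.symm.trans hs
      have : ((a :: q).length : ℕ) = s + 1 := by exact_mod_cast this
      rw [Ideal.ofList_singleton] at h1
      rw [h1]
      have h2 : q.length ≤ s := by simpa using this.le
      exact_mod_cast h2
    have hmem := h.colon_le hd hv
    have : c ^ 3 ^ n * v = c ^ (3 ^ n - 1) * (c * v) := by
      rw [← mul_assoc, ← pow_succ, Nat.sub_add_cancel (Nat.one_le_pow _ _ (by norm_num))]
    rw [this]
    exact Ideal.mul_mem_left _ _ hmem
  | cons y p ih =>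
    intro c 𝔠 s n hn hs h a q hP v hv
    obtain ⟨s, rfl⟩ : ∃ s', s = s' + 1 := ⟨(p ++ a :: q).length, by
      have := hP.dim.symm.trans hs
      have : ((y :: p ++ a :: q).length : ℕ) = s := by exact_mod_cast this
      simpa using this.symm⟩
    have hP' : PSys (𝔠 ⊔ Ideal.span {y}) (p ++ a :: q) := by
      have := PSys.right (p := [y]) (q := p ++ a :: q) hP
      rwa [Ideal.ofList_singleton] at this
    have hd : qdim (𝔠 ⊔ Ideal.span {y}) = s := by
      have := hP.dim.symm.trans hs
      have : ((y :: p ++ a :: q).length : ℕ) = s + 1 := by exact_mod_cast this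
      have : (p ++ a :: q).length = s := by simpa using this
      rw [hP'.dim, this]
    obtain ⟨n, rfl⟩ : ∃ n', n = n' + 1 := ⟨n - 1, by omega⟩
    rw [Ideal.ofList_cons, ← sup_assoc] at hv ⊢
    have := ih (c ^ 3) _ s n (by omega) hd (h.sup_span hd.le) a q hP' v hv
    rwa [← pow_mul, ← pow_succ'] at this

end ExtKill

section CMExistence

open CategoryTheory.Abelian

variable {R : Type u} [CommRing R] [IsLocalRing R] [IsNoetherianRing R]

lemma exists_extKill_one_le {𝔠 : Ideal R} {s : ℕ} (hs : qdim 𝔠 = s) (k : ℕ) :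
    ∀ {𝔞 : Ideal R}, 𝔞 ≤ 𝔠 → qdim 𝔞 = (s + k : ℕ) → ExtKill (1 : R) (R ⧸ 𝔞) (s + k) →
      ∃ 𝔞' ≤ 𝔠, qdim 𝔞' = s ∧ ExtKill (1 : R) (R ⧸ 𝔞') s := by
  induction k with
  | zero => exact fun {𝔞} h1 h2 h3 => ⟨𝔞, h1, h2, h3⟩
  | succ k ih =>
    intro 𝔞 h1 h2 h3
    obtain ⟨x, hx, hxm, hd⟩ := exists_param (T := 𝔞) (𝔟 := 𝔠) (s := s + k) h2
      fun P hP hTP hd hle => by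
        have := hd.trans ((qdim_anti hle).trans hs.le)
        have : s + k + 1 ≤ s := by exact_mod_cast this
        omega
    refine ih (sup_le h1 ((Ideal.span_singleton_le_iff_mem _).2 hx)) hd ?_
    have := ExtKill.sup_span (e := s + k) h3 hd.le
    rwa [one_pow] at this

/-- At a prime `P` of maximal dimension over an ideal `𝔞` with `R ⧸ 𝔞` Cohen–Macaulay, the
relevant `Ext` modules are annihilated by an element outside `P`. -/
lemma exists_extKillAt {𝔞 P : Ideal R} {s : ℕ} (h𝔞 : qdim 𝔞 ≤ s) (hP : P.IsPrime) (h𝔞P : 𝔞 ≤ P)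
    (hd : (s : WithBot ℕ∞) ≤ qdim P) (hk : ExtKill (1 : R) (R ⧸ 𝔞) s) (i : ℕ) :
    ∀ (N : Type u) [AddCommGroup N] [Module R N], Module.Finite R N →
      (∀ r ∈ 𝔞, ∀ y : N, r • y = 0) → ∃ c, c ∉ P ∧ ExtKillAt c N s i := by
  have hmin := mem_minimalPrimes_of_qdim h𝔞 hP h𝔞P hd
  obtain ⟨-, φ, hφ⟩ := (isAssociatedPrime_iff_exists_injective_linearMap P (R ⧸ 𝔞)).1
    (Module.associatedPrimes.minimalPrimes_annihilator_subset_associatedPrimes R (R ⧸ 𝔞)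
      (by rwa [Ideal.annihilator_quotient]))
  have hS : (ModuleCat.shortComplexOfCompEqZero φ (LinearMap.range φ).mkQ
      (LinearMap.range_mkQ_comp φ)).ShortExact := ModuleCat.shortComplex_shortExact _
    (LinearMap.exact_map_mkQ_range φ) hφ (Submodule.mkQ_surjective _)
  have reduce : ∀ i, (∃ c, c ∉ P ∧ ExtKillAt c (R ⧸ P) s i) →
      ∀ (N : Type u) [AddCommGroup N] [Module R N], Module.Finite R N →
      (∀ r ∈ 𝔞, ∀ y : N, r • y = 0) → ∃ c, c ∉ P ∧ ExtKillAt c N s i := by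
    rintro i ⟨c, hc, hcP⟩ N _ _ hN
    induction hN using IsNoetherianRing.induction_on_isQuotientEquivQuotientPrime R with
    | subsingleton N =>
      exact fun _ => ⟨1, hP.one_notMem, fun D X _ _ _ _ _ a =>
        ext_smul_eq_zero_right (fun y => Subsingleton.elim _ _) a⟩
    | exact N₁ N₂ N₃ f g hf hg hfg h₁ h₃ =>
      intro h
      obtain ⟨c₁, hc₁, h1⟩ := h₁ fun r hr y => hf (by rw [map_smul, h r hr, map_zero])
      obtain ⟨c₃, hc₃, h3⟩ := h₃ fun r hr y => by
        obtain ⟨y, rfl⟩ := hg y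
        rw [← map_smul, h r hr, map_zero]
      refine ⟨c₁ * c₃, fun hmem => (hP.mem_or_mem hmem).elim hc₁ hc₃, ?_⟩
      intro D X _ _ hX hD hi
      exact ext_smul_eq_zero₂ (ModuleCat.shortComplex_shortExact
        (ModuleCat.shortComplexOfCompEqZero f g hfg.linearMap_comp_eq_zero) hfg hf hg)
        (h1 D X hX hD hi) (h3 D X hX hD hi)
    | quotient N p f =>
      intro h
      by_cases hp : p.1 ≤ P
      · have h𝔞p : 𝔞 ≤ p.1 := by
          rw [← annihilator_eq_of_equiv_quotient f]
          exact fun r hr => Module.mem_annihilator.2 (h r hr)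
        have hpP : p.1 = P := le_antisymm hp (hmin.2 ⟨p.2, h𝔞p⟩ hp)
        refine ⟨c, hc, fun D X _ _ hX hD hi => ?_⟩
        exact ext_smul_eq_zero_of_iso_right
          ((Submodule.quotEquivOfEq _ _ hpP.symm).trans f.symm).toModuleIso
          (hcP D X hX hD hi)
      · obtain ⟨c, hc, hcP⟩ := SetLike.not_le_iff_exists.1 hp
        refine ⟨c, hcP, fun D X _ _ hX hD hi => ext_smul_eq_zero_right fun y => ?_⟩
        rw [← annihilator_eq_of_equiv_quotient f] at hc
        exact Module.mem_annihilator.1 hc y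
  induction i with
  | zero =>
    refine reduce 0 ⟨1, hP.one_notMem, fun D X _ _ hX hD hi a => ?_⟩
    rw [one_smul]
    refine ext_zero_eq_zero₁ hS (fun a => ?_) a
    have := hk 0 D X hX hD hi a
    rwa [one_smul] at this
  | succ i ih =>
    obtain ⟨c, hc, hcN⟩ := ih ((R ⧸ 𝔞) ⧸ LinearMap.range φ) inferInstance fun r hr y => by
      obtain ⟨y, rfl⟩ := Submodule.mkQ_surjective _ y
      obtain ⟨y, rfl⟩ := Submodule.mkQ_surjective _ y
      rw [← map_smul, ← map_smul, Submodule.mkQ_apply 𝔞,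
        (Submodule.Quotient.mk_eq_zero 𝔞).2 (show r • y ∈ 𝔞 from Ideal.mul_mem_right _ _ hr), map_zero]
    refine reduce (i + 1) ⟨c, hc, fun D X _ _ hX hD hi a => ?_⟩
    have := ext_smul_eq_zero₁ hS (hcN D X hX hD (by omega)) (hk (i + 1) D X hX hD hi) a
    rwa [mul_one] at this

lemma exists_mem_bT_not_mem_of_extKill {n : ℕ} (hn : qdim (⊥ : Ideal R) = n)
    (hk : ExtKill (1 : R) (R ⧸ (⊥ : Ideal R)) n) {T P : Ideal R} {s : ℕ} (hT : qdim T = s)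
    (hP : P.IsPrime) (hTP : T ≤ P) (hd : (s : WithBot ℕ∞) ≤ qdim P) : ∃ c ∈ bT T, c ∉ P := by
  have hsn : s ≤ n := by
    have := hT.ge.trans ((qdim_anti (bot_le : ⊥ ≤ T)).trans hn.le)
    exact_mod_cast this
  obtain ⟨k, rfl⟩ := Nat.exists_eq_add_of_le hsn
  obtain ⟨𝔞, h𝔞T, h𝔞, hk𝔞⟩ := exists_extKill_one_le hT k (bot_le : ⊥ ≤ T) hn hk
  have hall : ∀ m, ∃ c, c ∉ P ∧ ∀ i < m, ExtKillAt c (R ⧸ T) s i := by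
    intro m
    induction m with
    | zero => exact ⟨1, hP.one_notMem, fun i hi => absurd hi (Nat.not_lt_zero i)⟩
    | succ m ih =>
      obtain ⟨c, hc, hck⟩ := ih
      obtain ⟨c', hc', hck'⟩ := exists_extKillAt h𝔞.le hP (h𝔞T.trans hTP) hd hk𝔞 m (R ⧸ T)
        inferInstance fun r hr y => by
          obtain ⟨y, rfl⟩ := Submodule.mkQ_surjective _ y
          rw [← map_smul, Submodule.mkQ_apply,
            (Submodule.Quotient.mk_eq_zero T).2 (show r • y ∈ T from Ideal.mul_mem_right _ _ (h𝔞T hr))]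
      refine ⟨c * c', fun hmem => (hP.mem_or_mem hmem).elim hc hc', fun i hi D X _ _ hX hD hi' a => ?_⟩
      rcases Nat.lt_succ_iff_lt_or_eq.1 hi with hi | rfl
      · rw [mul_comm, mul_smul, hck i hi D X hX hD hi', smul_zero]
      · rw [mul_smul, hck' D X hX hD hi', smul_zero]
  obtain ⟨c, hc, hck⟩ := hall s
  have hcT : ExtKill c (R ⧸ T) s := fun i D X _ _ hX hD hi =>
    hck i (by omega) D X hX hD hi
  exact ⟨_, hcT.mem_bT hT, fun h => hc (hP.mem_of_pow_mem _ h)⟩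

lemma extKill_one_of_isCMLocal (h : IsCMLocal R) {n : ℕ} (hn : ringKrullDim R = n) :
    ExtKill (1 : R) (R ⧸ (⊥ : Ideal R)) n := by
  refine extKill_one fun i hi a => ?_
  rw [← one_smul R a]
  refine ext_smul_eq_zero_of_iso_right (Submodule.quotEquivOfEqBot ⊥ rfl).symm.toModuleIso
    (fun a => ?_) a
  rw [one_smul]
  refine ext_eq_zero_of_LC (N := ModuleCat.of R R) (n := n) (fun i hi z => ?_) i hi _ inferInstance 1
    (fun r hr y => ?_) a
  · have := h i (by rw [hn]; exact_mod_cast hi)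
    exact (hmodEquiv R i).injective (Subsingleton.elim _ _)
  · obtain ⟨y, rfl⟩ := Submodule.mkQ_surjective _ y
    rw [pow_one] at hr
    rw [← map_smul, Submodule.mkQ_apply,
      (Submodule.Quotient.mk_eq_zero _).2
        (show r • y ∈ maximalIdeal R from Ideal.mul_mem_right _ _ hr)]

section Transfer

variable {A : Type u} [CommRing A] [IsLocalRing A] [IsNoetherianRing A] {f : A →+* R}

lemma comap_sup_ofList (hf : Function.Surjective f) (T : Ideal R) (l : List A) :
    (T ⊔ Ideal.ofList (l.map f)).comap f = T.comap f ⊔ Ideal.ofList l := by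
  have : (T.comap f ⊔ Ideal.ofList l).map f = T ⊔ Ideal.ofList (l.map f) := by
    rw [Ideal.map_sup, Ideal.map_comap_of_surjective f hf, Ideal.map_ofList]
  rw [← this, Ideal.comap_map_of_surjective f hf, sup_eq_left]
  exact (Ideal.comap_mono bot_le).trans le_sup_left

lemma qdim_comap (hf : Function.Surjective f) (T : Ideal R) : qdim (T.comap f) = qdim T := by
  have h1 : RingHom.ker ((Ideal.Quotient.mk T).comp f) = T.comap f := by
    ext a
    simp [RingHom.mem_ker, Ideal.Quotient.eq_zero_iff_mem]
  rw [qdim, ← h1]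
  exact ringKrullDim_eq_of_ringEquiv (RingHom.quotientKerEquivOfSurjective
    (f := (Ideal.Quotient.mk T).comp f) (Ideal.Quotient.mk_surjective.comp hf))

lemma PSys.comap (hf : Function.Surjective f) {T : Ideal R} {l : List A}
    (h : PSys T (l.map f)) : PSys (T.comap f) l where
  dim := by rw [qdim_comap hf, h.dim, List.length_map]
  mem a ha := by
    have := h.mem (f a) (List.mem_map_of_mem ha)
    rw [mem_maximalIdeal, mem_nonunits_iff] at this ⊢
    exact fun hu => this (hu.map f)
  rad a ha := by
    have := Function.Surjective.isLocalHom f hf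
    have h1 : f a ∈ maximalIdeal R := by
      rw [mem_maximalIdeal, mem_nonunits_iff] at ha ⊢
      exact fun hu => ha (isUnit_of_map_unit f a hu)
    obtain ⟨n, hn⟩ := h.rad h1
    refine ⟨n, ?_⟩
    rw [← comap_sup_ofList hf, Ideal.mem_comap, map_pow]
    exact hn

lemma map_mem_bT (hf : Function.Surjective f) {T : Ideal R} {c : A} (hc : c ∈ bT (T.comap f)) :
    f c ∈ bT T := by
  intro p a s hP v hv
  obtain ⟨p, rfl⟩ := List.map_surjective_iff.2 hf p
  obtain ⟨s, rfl⟩ := List.map_surjective_iff.2 hf s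
  obtain ⟨a, rfl⟩ := hf a
  obtain ⟨v, rfl⟩ := hf v
  have hP' : PSys (T.comap f) (p ++ a :: s) := PSys.comap hf (by simpa using hP)
  rw [← map_mul, ← Ideal.mem_comap, comap_sup_ofList hf] at hv ⊢
  exact bT_apply hc hP' hv

end Transfer

/-- If `R` is a homomorphic image of a Cohen–Macaulay local ring, then `bT T` is not contained in
the primes of maximal dimension over `T`. -/
lemma exists_mem_bT_not_mem (hres : IsHomImageOfCM R) {T P : Ideal R} {s : ℕ} (hT : qdim T = s)
    (hP : P.IsPrime) (hTP : T ≤ P) (hd : (s : WithBot ℕ∞) ≤ qdim P) : ∃ c ∈ bT T, c ∉ P := by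
  obtain ⟨A, _, _, _, hA, f, hf⟩ := hres
  obtain ⟨n, hn⟩ : ∃ n : ℕ, ringKrullDim A = n := by
    obtain ⟨n, hn⟩ := WithBot.ne_bot_iff_exists.1 (ringKrullDim_ne_bot (R := A))
    have hn' : n ≠ ⊤ := fun h => ringKrullDim_ne_top (R := A) (by rw [← hn, h]; rfl)
    obtain ⟨n, rfl⟩ := ENat.ne_top_iff_exists.1 hn'
    exact ⟨n, hn.symm⟩
  obtain ⟨c, hc, hcP⟩ := exists_mem_bT_not_mem_of_extKill (R := A) (n := n)
    (by rw [qdim, ← hn]; exact ringKrullDim_eq_of_ringEquiv (RingEquiv.quotientBot A))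
    (extKill_one_of_isCMLocal hA hn) (T := T.comap f) (P := P.comap f)
    (by rw [qdim_comap hf, hT]) (hP.comap f) (Ideal.comap_mono hTP) (by rwa [qdim_comap hf])
  exact ⟨f c, map_mem_bT hf hc, hcP⟩

end CMExistence

section Extensions

variable {R : Type u} [CommRing R] [IsLocalRing R] [IsNoetherianRing R]

/-- Krull's intersection theorem modulo an ideal. -/
lemma mem_of_forall_mem_pow_sup {I T : Ideal R} (hI : I ≠ ⊤) {v : R}
    (h : ∀ n, v ∈ I ^ n ⊔ T) : v ∈ T := by
  rw [← Submodule.Quotient.mk_eq_zero T, ← Submodule.mem_bot R,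
    ← Ideal.iInf_pow_smul_eq_bot_of_isLocalRing I (M := R ⧸ T) hI, Submodule.mem_iInf]
  intro n
  have hker := ker_mkQ_smul_top_comp (Submodule.mkQ_surjective T) (Submodule.ker_mkQ T) (I ^ n)
  have hv : v ∈ LinearMap.ker ((I ^ n • (⊤ : Submodule R (R ⧸ T))).mkQ ∘ₗ T.mkQ) := by
    rw [hker, sup_comm]
    exact h n
  exact (Submodule.Quotient.mk_eq_zero _).1 hv

/-- `l` is the final part of a system of parameters, with `k` entries missing, satisfying the
conditions on a `C`-system of parameters. -/
structure CPart (l : List R) (k : ℕ) : Prop where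
  tail : CTail l
  mem : ∀ a ∈ l, a ∈ maximalIdeal R
  dim : qdim (Ideal.ofList l) = k
  dim_bot : qdim (⊥ : Ideal R) = (l.length + k : ℕ)

lemma CPart.cSys {l : List R} (h : CPart l 0) : CSys l where
  sys := ⟨h.dim_bot, h.mem, by
    rw [bot_sup_eq]
    exact maximalIdeal_le_radical_of_qdim h.dim.le⟩
  tail := h.tail

lemma CSys.cPart {p s : List R} (h : CSys (p ++ s)) : CPart s p.length where
  tail := h.tail.tail
  mem a ha := h.sys.mem a (List.mem_append_right _ ha)
  dim := h.sys.tail.dim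
  dim_bot := by rw [h.sys.dim, List.length_append, add_comm]

lemma exists_cPart_cons (hres : IsHomImageOfCM R) {s : List R} {k : ℕ} (h : CPart s (k + 1))
    {𝔮 : Ideal R} (h𝔮 : ∀ P : Ideal R, P.IsPrime → Ideal.ofList s ≤ P →
      (k + 1 : ℕ) ≤ qdim P → ¬ 𝔮 ≤ P) : ∃ x ∈ 𝔮, CPart (x :: s) k := by
  obtain ⟨x, hx, hxm, hd⟩ := exists_param (T := Ideal.ofList s)
    (𝔟 := bT (Ideal.ofList s) ^ 3 ⊓ 𝔮) h.dim fun P hP hTP hd hle => by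
      rcases hP.inf_le.1 hle with h1 | h1
      · obtain ⟨c, hc, hcP⟩ := exists_mem_bT_not_mem hres h.dim hP hTP hd
        exact hcP (hP.le_of_pow_le h1 hc)
      · exact h𝔮 P hP hTP hd h1
  refine ⟨x, hx.2, ⟨hx.1, h.tail⟩, ?_, ?_, ?_⟩
  · intro a ha
    rcases List.mem_cons.1 ha with rfl | ha
    · exact hxm
    · exact h.mem a ha
  · rw [Ideal.ofList_cons, sup_comm, hd]
  · rw [h.dim_bot, List.length_cons, add_assoc, add_comm 1 k]

lemma exists_cPart_append (hres : IsHomImageOfCM R) {s : List R} {k : ℕ} {𝔮 : Ideal R}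
    (h𝔮 : ∀ P : Ideal R, P.IsPrime → Ideal.ofList s ≤ P → (k + 1 : ℕ) ≤ qdim P → ¬ 𝔮 ≤ P)
    (j : ℕ) (h : CPart s (k + j)) :
    ∃ w : List R, w.length = j ∧ (∀ a ∈ w, a ∈ 𝔮) ∧ CPart (w ++ s) k := by
  induction j generalizing k with
  | zero => exact ⟨[], rfl, by simp, h⟩
  | succ j ih =>
    obtain ⟨w, hw, hw𝔮, hws⟩ := ih (k := k + 1) (fun P hP hTP hd => h𝔮 P hP hTP
      (le_trans (by exact_mod_cast Nat.le_succ (k + 1)) hd)) (by rwa [add_assoc, add_comm 1 j])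
    obtain ⟨x, hx, hxs⟩ := exists_cPart_cons hres hws (𝔮 := 𝔮) fun P hP hTP hd =>
      h𝔮 P hP (le_trans (by rw [Ideal.ofList_append]; exact le_sup_right) hTP) hd
    refine ⟨x :: w, by rw [List.length_cons, hw], ?_, hxs⟩
    intro a ha
    rcases List.mem_cons.1 ha with rfl | ha
    · exact hx
    · exact hw𝔮 a ha

lemma not_maximalIdeal_pow_le {P : Ideal R} (hP : P.IsPrime) {k n : ℕ}
    (hd : (k + 1 : ℕ) ≤ qdim P) : ¬ maximalIdeal R ^ n ≤ P := by
  intro hle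
  have h := hd.trans (qdim_le_zero ((hP.le_of_pow_le hle).trans Ideal.le_radical))
  have : k + 1 ≤ 0 := by exact_mod_cast h
  omega

/-- A uniform finiteness condition for the `C`-systems of parameters extending `x :: t` implies
that `(t : x) / t` has finite length. -/
lemma exists_pow_mul_colon_le (hres : IsHomImageOfCM R) {x : R} {t : List R} {k : ℕ}
    (hxt : CPart (x :: t) (k + 1))
    (H : ∀ (y : R) (w : List R), CSys (y :: (w ++ x :: t)) →
      (∀ a ∈ y :: w, a ∈ maximalIdeal R ^ 2) → ∃ C : ℕ, ∀ n : ℕ, n ≠ 0 →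
        maximalIdeal R ^ C * colon (Ideal.ofList (y ^ n :: (w ++ t))) x ≤
          Ideal.ofList (y ^ n :: (w ++ t))) :
    ∃ C : ℕ, maximalIdeal R ^ C * colon (Ideal.ofList t) x ≤ Ideal.ofList t := by
  have step : ∀ w : List R, CPart (w ++ x :: t) 1 → (∀ a ∈ w, a ∈ maximalIdeal R ^ 2) →
      ∃ C : ℕ, maximalIdeal R ^ C * colon (Ideal.ofList t) x ≤ Ideal.ofList (w ++ t) := by
    intro w hw hw2
    obtain ⟨y, hy, hyw⟩ := exists_cPart_cons hres (k := 0) hw (𝔮 := maximalIdeal R ^ 2)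
      fun P hP _ hd => not_maximalIdeal_pow_le hP hd
    have hym : y ∈ maximalIdeal R := hyw.mem y (by simp)
    obtain ⟨C, hC⟩ := H y w hyw.cSys (by
      intro a ha
      rcases List.mem_cons.1 ha with rfl | ha
      · exact hy
      · exact hw2 a ha)
    refine ⟨C, fun v hv => mem_of_forall_mem_pow_sup (I := maximalIdeal R)
      (Ideal.IsPrime.ne_top inferInstance) fun n => ?_⟩
    have hle : Ideal.ofList t ≤ Ideal.ofList (y ^ (n + 1) :: (w ++ t)) := by
      rw [Ideal.ofList_cons, Ideal.ofList_append, ← sup_assoc]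
      exact le_sup_right
    have hv' := hC (n + 1) n.succ_ne_zero (Ideal.mul_mono le_rfl (colon_mono hle x) hv)
    rw [Ideal.ofList_cons] at hv'
    refine sup_le_sup (a := Ideal.span {y ^ (n + 1)}) (b := maximalIdeal R ^ n)
      ((Ideal.span_singleton_le_iff_mem _).2 ?_) le_rfl hv'
    exact Ideal.pow_le_pow_right (Nat.le_succ n) (Ideal.pow_mem_pow hym _)
  by_contra hcon
  push Not at hcon
  set E := colon (Ideal.ofList t) x with hE
  set J : Ideal R := Submodule.colon (Ideal.ofList t) (E : Set R) with hJ
  have memJ : ∀ {e : R}, e ∈ J ↔ ∀ v ∈ E, e * v ∈ Ideal.ofList t := by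
    intro e
    rw [hJ, Submodule.mem_colon]
    rfl
  have hne : {P : Ideal R | P.IsPrime ∧ J ≤ P ∧ P ≠ maximalIdeal R}.Nonempty := by
    by_contra hemp
    have hrad : maximalIdeal R ≤ J.radical := by
      rw [Ideal.radical_eq_sInf]
      refine le_sInf fun P ⟨hJP, hP⟩ => ?_
      by_contra hnot
      exact hemp ⟨P, hP, hJP, fun h => hnot h.ge⟩
    obtain ⟨C, hC⟩ := Ideal.exists_pow_le_of_le_radical_of_fg hrad (IsNoetherian.noetherian _)
    refine hcon C (Ideal.mul_le.2 fun e he v hv => memJ.1 (hC he) v hv)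
  obtain ⟨𝔔, ⟨h𝔔, hJ𝔔, h𝔔m⟩, hmax⟩ : ∃ 𝔔 : Ideal R, (𝔔.IsPrime ∧ J ≤ 𝔔 ∧ 𝔔 ≠ maximalIdeal R) ∧
      ∀ P ∈ {P : Ideal R | P.IsPrime ∧ J ≤ P ∧ P ≠ maximalIdeal R}, ¬ 𝔔 < P :=
    set_has_maximal_iff_noetherian.2 (inferInstance : IsNoetherian R R) _ hne
  have hdim : qdim 𝔔 ≤ 1 := by
    obtain ⟨y, hy, hy𝔔⟩ : ∃ y ∈ maximalIdeal R, y ∉ 𝔔 := by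
      by_contra hnot
      push Not at hnot
      exact h𝔔m (le_antisymm (le_maximalIdeal h𝔔.ne_top) hnot)
    have h0 : qdim (𝔔 ⊔ Ideal.span {y}) ≤ 0 := by
      refine qdim_le_zero ?_
      rw [Ideal.radical_eq_sInf]
      refine le_sInf fun P ⟨hP1, hP⟩ => ?_
      by_contra hnot
      refine hmax P ⟨hP, hJ𝔔.trans (le_sup_left.trans hP1), fun h => hnot h.ge⟩
        (lt_of_le_of_ne (le_sup_left.trans hP1) ?_)
      rintro rfl
      exact hy𝔔 (hP1 (Ideal.mem_sup_right (Ideal.mem_span_singleton_self y)))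
    calc qdim 𝔔 ≤ qdim (𝔔 ⊔ Ideal.span {y}) + 1 := qdim_le_add_one 𝔔 hy
      _ ≤ 0 + 1 := add_le_add h0 le_rfl
      _ = 1 := zero_add 1
  have hloc : ∀ r, ∀ v ∈ E, ∃ e, e ∉ 𝔔 ∧ e * v ∈ 𝔔 ^ r ⊔ Ideal.ofList t := by
    intro r v hv
    obtain ⟨w, hw, hw𝔮, hws⟩ := exists_cPart_append hres (k := 1) (𝔮 := 𝔔 ^ r ⊓ maximalIdeal R ^ 2)
      (fun P hP _ hd hle => by
        rcases hP.inf_le.1 hle with h1 | h1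
        · have h2 := hd.trans ((qdim_anti (hP.le_of_pow_le h1)).trans hdim)
          have : 2 ≤ 1 := by exact_mod_cast h2
          omega
        · exact not_maximalIdeal_pow_le hP hd h1) k (by rwa [add_comm 1 k])
    obtain ⟨C, hC⟩ := step w hws fun a ha => (hw𝔮 a ha).2
    obtain ⟨e, he, he𝔔⟩ : ∃ e ∈ maximalIdeal R ^ C, e ∉ 𝔔 := by
      by_contra hnot
      push Not at hnot
      exact h𝔔m (le_antisymm (le_maximalIdeal h𝔔.ne_top) (h𝔔.le_of_pow_le hnot))
    refine ⟨e, he𝔔, ?_⟩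
    have h1 := hC (Ideal.mul_mem_mul he hv)
    rw [Ideal.ofList_append] at h1
    exact sup_le_sup_right (ofList_le.2 fun a ha => (hw𝔮 a ha).1) _ h1
  have hloc' : ∀ v ∈ E, ∃ e, e ∉ 𝔔 ∧ e * v ∈ Ideal.ofList t := by
    intro v hv
    let A := Localization.AtPrime 𝔔
    have hA : IsNoetherianRing A := IsLocalization.isNoetherianRing 𝔔.primeCompl A inferInstance
    have h1 : algebraMap R A v ∈ (Ideal.ofList t).map (algebraMap R A) := by
      refine mem_of_forall_mem_pow_sup (I := maximalIdeal A)
        (Ideal.IsPrime.ne_top inferInstance) fun n => ?_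
      obtain ⟨e, he, hev⟩ := hloc n v hv
      have h2 : algebraMap R A v ∈ (𝔔 ^ n ⊔ Ideal.ofList t).map (algebraMap R A) :=
        (IsLocalization.algebraMap_mem_map_algebraMap_iff 𝔔.primeCompl A _ _).2 ⟨e, he, hev⟩
      rw [Ideal.map_sup, Ideal.map_pow] at h2
      rwa [Localization.AtPrime.map_eq_maximalIdeal] at h2
    obtain ⟨e, he, hev⟩ :=
      (IsLocalization.algebraMap_mem_map_algebraMap_iff 𝔔.primeCompl A _ _).1 h1
    exact ⟨e, he, hev⟩
  obtain ⟨e, he, heE⟩ : ∃ e, e ∉ 𝔔 ∧ ∀ v ∈ E, e * v ∈ Ideal.ofList t := by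
    obtain ⟨S, hS⟩ := (IsNoetherian.noetherian E : E.FG)
    have hSE : ∀ v ∈ S, v ∈ E := fun v hv => hS ▸ Submodule.subset_span hv
    choose! f hf𝔔 hf using hloc'
    refine ⟨∏ v ∈ S, f v, fun hmem => ?_, fun v hv => ?_⟩
    · obtain ⟨v, hv, hfv⟩ := (Ideal.IsPrime.prod_mem_iff (hp := h𝔔)).1 hmem
      exact hf𝔔 v (hSE v hv) hfv
    · have hle : E ≤ colon (Ideal.ofList t) (∏ v ∈ S, f v) := by
        rw [← hS, Submodule.span_le]
        intro v hv
        refine mem_colon.2 ?_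
        obtain ⟨c, hc⟩ := Finset.dvd_prod_of_mem f hv
        rw [hc, mul_comm (f v) c, mul_assoc]
        exact Ideal.mul_mem_left _ _ (hf v (hSE v hv))
      exact mem_colon.1 (hle hv)
  exact he (hJ𝔔 (memJ.2 heE))

end Extensions

section FiniteLength

variable {R : Type u} [CommRing R] [IsLocalRing R] [IsNoetherianRing R]

lemma pow_mul_colon_le_of_rlen {𝔞 : Ideal R} {x : R} {t : ℕ} (h : rlen 𝔞 (colon 𝔞 x) ≤ t) :
    maximalIdeal R ^ t * colon 𝔞 x ≤ 𝔞 := by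
  rw [← length_ker_colonProj] at h
  refine Ideal.mul_le.2 fun r hr v hv => ?_
  have := congrArg Subtype.val
    (pow_smul_of_length_le _ h r hr ⟨𝔞.mkQ v, mem_ker_colonProj.2 (mem_colon.1 hv)⟩)
  exact (Submodule.Quotient.mk_eq_zero 𝔞).1 this

lemma exists_pow_mul_colon_le_of_rad {T : Ideal R} {x : R}
    (h : maximalIdeal R ≤ (T ⊔ Ideal.span {x}).radical) :
    ∃ t : ℕ, maximalIdeal R ^ t * colon T x ≤ T := by
  obtain ⟨t, ht⟩ := Ideal.exists_pow_le_of_le_radical_of_fg h (IsNoetherian.noetherian _)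
  refine ⟨t, Ideal.mul_le.2 fun r hr v hv => ?_⟩
  obtain ⟨a, ha, b, hb, rfl⟩ := Submodule.mem_sup.1 (ht hr)
  obtain ⟨c, rfl⟩ := Ideal.mem_span_singleton'.1 hb
  rw [add_mul, mul_assoc]
  exact add_mem (Ideal.mul_mem_right _ _ ha) (Ideal.mul_mem_left _ _ (mem_colon.1 hv))

lemma CSys.exists_pow_mul_colon_le {p : List R} {x : R} {s : List R} (h : CSys (p ++ x :: s)) :
    ∃ t : ℕ, maximalIdeal R ^ t * colon (Ideal.ofList p) x ≤ Ideal.ofList p := by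
  obtain ⟨n, hn⟩ := ENat.ne_top_iff_exists.1 h.length_quot_ne_top
  exact ⟨n, pow_mul_colon_le_of_rlen (h.rlen_colon_le.trans hn.symm.le)⟩

lemma rlen_colon_ne_top {T : Ideal R} {x : R} {t : ℕ} (h : maximalIdeal R ^ t * colon T x ≤ T) :
    rlen T (colon T x) ≠ ⊤ :=
  ne_top_of_le_ne_top LC.length_zero_ne_top (rlen_colon_le_length_LQ h)

/-- The indices of reducibility of the ideals generated by `y ^ n :: s` are bounded. -/
lemma CSys.exists_rlen_colonIdeal_pow_le {y : R} {s : List R} (h : CSys (y :: s)) :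
    ∃ b : ℕ, ∀ n : ℕ, n ≠ 0 →
      rlen (Ideal.ofList (y ^ n :: s)) (colonIdeal R (Ideal.ofList (y ^ n :: s))) ≤ b := by
  set T := Ideal.ofList s with hT
  have hcol : ∀ n : ℕ, n ≠ 0 → colon T (y ^ n) ≤ colon T y := by
    intro n hn v hv
    have hP : PSys T ([] ++ y ^ n :: []) := (h.pow hn).sys.tail (p := [y ^ n])
    refine mem_colon.2 ?_
    have hy : y ∈ bT T := CTail.mem' (p := []) h.tail
    simpa using bT_apply hy hP (v := v) (by simpa using mem_colon.1 hv)
  obtain ⟨t, ht⟩ := exists_pow_mul_colon_le_of_rad (T := T) (x := y) (by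
    simpa [Ideal.ofList_cons, sup_comm] using h.sys.rad)
  obtain ⟨C, hC⟩ := ENat.ne_top_iff_exists.1 (rlen_colon_ne_top ht)
  have hne : bass R (R ⧸ T) 0 + bass R (R ⧸ T) 1 + C * bass R (R ⧸ maximalIdeal R) 2 ≠ ⊤ :=
    WithTop.add_ne_top.2 ⟨WithTop.add_ne_top.2 ⟨bass_ne_top _ _, bass_ne_top _ _⟩,
      WithTop.mul_ne_top (ENat.natCast_ne_top _) (bass_ne_top _ _)⟩
  obtain ⟨b, hb⟩ := ENat.ne_top_iff_exists.1 hne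
  refine ⟨b, fun n hn => ?_⟩
  rw [rlen_colonIdeal_eq_bass, Ideal.ofList_cons, sup_comm, hb]
  exact bass_quot_sup_le T (y ^ n) C 0 ((rlen_mono (hcol n hn)).trans hC.symm.le)

/-- A uniform bound on the last colon lengths of the `C`-systems of parameters extending `x :: t`
implies that `(t : x) / t` has finite length. -/
lemma CPart.exists_pow_mul_colon_le (hres : IsHomImageOfCM R) {x : R} {t : List R} {k : ℕ}
    (hxt : CPart (x :: t) k)
    (H : ∀ (y : R) (w : List R), CSys (y :: (w ++ x :: t)) →
      (∀ a ∈ y :: w, a ∈ maximalIdeal R ^ 2) → ∃ C : ℕ, ∀ n : ℕ, n ≠ 0 → ∀ l z,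
        y ^ n :: (w ++ x :: t) = l ++ [z] →
        rlen (Ideal.ofList l) (colon (Ideal.ofList l) z) ≤ C) :
    ∃ C : ℕ, maximalIdeal R ^ C * colon (Ideal.ofList t) x ≤ Ideal.ofList t := by
  cases k with
  | zero =>
    refine exists_pow_mul_colon_le_of_rad ?_
    simpa [Ideal.ofList_cons, sup_comm] using hxt.cSys.sys.rad
  | succ k =>
    refine CParam.exists_pow_mul_colon_le hres hxt fun y w hyw hm => ?_
    obtain ⟨C, hC⟩ := H y w hyw hm
    refine ⟨C, fun n hn => pow_mul_colon_le_of_rlen ?_⟩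
    obtain ⟨p', x', e, hle⟩ := CSys.hLen_le_last (p := y ^ n :: w) (x := x) t (hyw.pow hn)
    refine hle.trans ?_
    have := hC n hn p' x' e
    rwa [hLen, List.append_nil]

lemma CPart.length_LQ_ne_top (hres : IsHomImageOfCM R)
    (H : ∀ (x : R) (t : List R) (k : ℕ), CPart (x :: t) k →
      (∀ a ∈ x :: t, a ∈ maximalIdeal R ^ 2) →
      ∃ C : ℕ, maximalIdeal R ^ C * colon (Ideal.ofList t) x ≤ Ideal.ofList t) (k : ℕ) :
    ∀ t : List R, CPart t k → (∀ a ∈ t, a ∈ maximalIdeal R ^ 2) → ∀ j < k,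
      Module.length R (LQ (Ideal.ofList t) j) ≠ ⊤ := by
  induction k with
  | zero => intro t _ _ j hj; omega
  | succ k ih =>
    intro t ht hm j hj
    cases j with
    | zero => exact LC.length_zero_ne_top
    | succ j =>
      obtain ⟨x, hx, hxt⟩ := exists_cPart_cons hres ht
        (𝔮 := maximalIdeal R ^ 2 ⊓ bT (Ideal.ofList t) ^ (j + 1 + 1)) fun P hP hTP hd hle => by
          rcases hP.inf_le.1 hle with h1 | h1
          · exact not_maximalIdeal_pow_le hP hd h1
          · obtain ⟨c, hc, hcP⟩ := exists_mem_bT_not_mem hres ht.dim hP hTP hd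
            exact hcP (hP.le_of_pow_le h1 hc)
      have hm' : ∀ a ∈ x :: t, a ∈ maximalIdeal R ^ 2 := by
        intro a ha
        rcases List.mem_cons.1 ha with rfl | ha
        · exact hx.1
        · exact hm a ha
      obtain ⟨C, hC⟩ := H x t k hxt hm'
      refine ne_top_of_le_ne_top ?_
        (length_LQ_succ_le hC j (bT_pow_smul_LQ (j + 1) _ _ ht.dim hj x hx.2))
      have := ih (x :: t) hxt hm' j (by omega)
      rwa [Ideal.ofList_cons, sup_comm] at this

end FiniteLength

section Transfer

variable {R : Type u} [CommRing R] [IsLocalRing R] [IsNoetherianRing R]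

lemma length_Hmod_eq (i : ℕ) :
    Module.length R (Hmod R R i) = Module.length R (LQ (⊥ : Ideal R) i) := by
  rw [← (hmodEquiv R i).length_eq]
  let e : R ≃ₗ[R] (R ⧸ (⊥ : Ideal R)) := (Submodule.quotEquivOfEqBot ⊥ rfl).symm
  have he : e.toModuleIso.hom ≫ e.toModuleIso.inv = 𝟙 _ := e.toModuleIso.hom_inv_id
  have he' : e.toModuleIso.inv ≫ e.toModuleIso.hom = 𝟙 _ := e.toModuleIso.inv_hom_id
  refine (LinearEquiv.ofLinearMap (LC.map e.toModuleIso.hom i) (LC.map e.toModuleIso.inv i)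
    ?_ ?_).length_eq
  · ext z
    simp only [LinearMap.comp_apply, LC.map_map, he', LC.map_id, LinearMap.id_apply]
  · ext z
    simp only [LinearMap.comp_apply, LC.map_map, he, LC.map_id, LinearMap.id_apply]

lemma qdim_bot_eq : qdim (⊥ : Ideal R) = ringKrullDim R :=
  ringKrullDim_eq_of_ringEquiv (RingEquiv.quotientBot R)

lemma isGeneralizedCM_iff {d : ℕ} (hdim : ringKrullDim R = (d : WithBot ℕ∞)) :
    IsGeneralizedCM R ↔ ∀ i < d, Module.length R (LQ (⊥ : Ideal R) i) ≠ ⊤ := by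
  have key : ∀ i : ℕ, IsFiniteLength R (Hmod R R i) ↔
      Module.length R (LQ (⊥ : Ideal R) i) ≠ ⊤ := fun i => by
    rw [← length_Hmod_eq, Module.length_ne_top_iff]
  rw [IsGeneralizedCM, hdim]
  refine forall_congr' fun i => ?_
  rw [← key]
  exact imp_congr_left (by exact_mod_cast Iff.rfl)

end Transfer

section Sufficiency

variable {R : Type u} [CommRing R] [IsLocalRing R] [IsNoetherianRing R]

lemma CSys.exists_coeff_of_mem_sq {l : List R} {x : R} (h : CSys (l ++ [x])) (hl : l ≠ [])
    (hm : ∀ a ∈ l ++ [x], a ∈ maximalIdeal R ^ 2) {K b : ℕ}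
    (hK : ∀ q, IsCParamIdeal R q → ∀ e, IsHilbCoeff R (colonIdeal R q) (l.length + 1) e →
      ∀ i, 1 ≤ i → i ≤ l.length + 1 → |e i| ≤ K)
    (hb : rlen (Ideal.ofList (l ++ [x])) (colonIdeal R (Ideal.ofList (l ++ [x]))) ≤ b) :
    rlen (Ideal.ofList l) (colon (Ideal.ofList l) x) ≤ (b + (l.length + 1) * K : ℕ) := by
  have h2 : 2 ≤ (l ++ [x]).length := by
    have := List.length_pos_of_ne_nil hl
    rw [List.length_append, List.length_singleton]
    omega
  have hne : l ++ [x] ≠ [] := by simp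
  obtain ⟨C, hC⟩ := ENat.ne_top_iff_exists.1 h.length_quot_ne_top
  obtain ⟨b', hb'⟩ := h.exists_rlen_colonIdeal
  have hbb : b' ≤ b := by
    rw [hb'] at hb
    exact_mod_cast hb
  obtain ⟨e, n, he, -, -, hn, hle⟩ := h.exists_hilbCoeff rfl
    (h.colonIdeal_mul_self hne (h.colonIdeal_le hne hm) (h.mul_colonIdeal_le h2 hm))
    (C := C) (fun p y s hp => by
      rw [hC, hp]
      exact CSys.rlen_colon_le (hp ▸ h)) hb'
  rw [hn]
  have hsum : ∑ i ∈ Finset.range (l.length + 1), |e (i + 1)| ≤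
      ∑ i ∈ Finset.range (l.length + 1), (K : ℤ) :=
    Finset.sum_le_sum fun i hi => hK _ (isCParamIdeal_iff.2 ⟨_, h, rfl⟩) e he (i + 1) (by omega)
      (by have := Finset.mem_range.1 hi; omega)
  rw [Finset.sum_const, Finset.card_range, nsmul_eq_mul] at hsum
  have hfin : n ≤ b + (l.length + 1) * K := by
    have : (n : ℤ) ≤ b' + (l.length + 1 : ℕ) * K := hle.trans (by linarith)
    zify
    push_cast at this
    have : (b' : ℤ) ≤ b := by exact_mod_cast hbb
    linarith
  exact_mod_cast hfin

lemma isGeneralizedCM_of_bounded (hres : IsHomImageOfCM R) {d : ℕ} (hd : 2 ≤ d)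
    (hdim : ringKrullDim R = (d : WithBot ℕ∞)) {K : ℕ}
    (hK : ∀ q, IsCParamIdeal R q → ∀ e, IsHilbCoeff R (colonIdeal R q) d e →
      ∀ i, 1 ≤ i → i ≤ d → |e i| ≤ K) : IsGeneralizedCM R := by
  have hbot : qdim (⊥ : Ideal R) = (d : ℕ) := qdim_bot_eq.trans hdim
  have hlast : ∀ {l : List R} {z : R} {b : ℕ}, CSys (l ++ [z]) →
      (∀ a ∈ l ++ [z], a ∈ maximalIdeal R ^ 2) →
      rlen (Ideal.ofList (l ++ [z])) (colonIdeal R (Ideal.ofList (l ++ [z]))) ≤ b →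
      rlen (Ideal.ofList l) (colon (Ideal.ofList l) z) ≤ (b + d * K : ℕ) := by
    intro l z b h hm hb
    have hlen : l.length + 1 = d := by
      have := h.sys.dim.symm.trans hbot
      rw [List.length_append, List.length_singleton] at this
      exact_mod_cast this
    have hl : l ≠ [] := by
      rintro rfl
      simp only [List.length_nil] at hlen
      omega
    subst hlen
    exact h.exists_coeff_of_mem_sq hl hm hK hb
  rw [isGeneralizedCM_iff hdim]
  have hnil : CPart ([] : List R) d :=
    ⟨trivial, by simp, by simpa using hbot, by simpa using hbot⟩
  have := CPart.length_LQ_ne_top hres (fun x t k hxt hm => ?_) d [] hnil (by simp)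
  · rwa [Ideal.ofList_nil] at this
  · refine hxt.exists_pow_mul_colon_le hres fun y w hyw hm' => ?_
    obtain ⟨b, hb⟩ := hyw.exists_rlen_colonIdeal_pow_le
    refine ⟨b + d * K, fun n hn l z e => ?_⟩
    have hsys := hyw.pow hn
    have hb := hb n hn
    have hmem : ∀ a ∈ y ^ n :: (w ++ x :: t), a ∈ maximalIdeal R ^ 2 := by
      intro a ha
      rcases List.mem_cons.1 ha with rfl | ha
      · exact Ideal.pow_mem_of_mem _ (hm' y (by simp)) n (Nat.pos_of_ne_zero hn)
      · rcases List.mem_append.1 ha with ha | ha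
        · exact hm' a (List.mem_cons_of_mem _ ha)
        · exact hm a ha
    rw [e] at hsys hb hmem
    exact hlast hsys hmem hb

end Sufficiency

section Regular

variable {R : Type u} [CommRing R]

lemma hilbChain_of_regular {I : Ideal R} (l : List R) : ∀ {𝔞 : Ideal R}, I = 𝔞 ⊔ Ideal.ofList l →
    (∀ p x s, l = p ++ x :: s → colon (𝔞 ⊔ Ideal.ofList p) x ≤ 𝔞 ⊔ Ideal.ofList p) →
    WChain 𝔞 l ∧ HilbChain I 0 𝔞 l := by
  induction l with
  | nil => exact fun _ _ => ⟨trivial, trivial⟩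
  | cons x l ih =>
    intro 𝔞 hI hreg
    obtain ⟨hW, hH⟩ := ih (𝔞 := 𝔞 ⊔ Ideal.span {x}) (by rw [hI, sup_ofList_cons])
      fun p y s hl => by
        have := hreg (x :: p) y s (by rw [hl]; rfl)
        rwa [sup_ofList_cons] at this
    have hx : colon 𝔞 x ≤ 𝔞 := by simpa using hreg [] x l rfl
    have hW' : WChain 𝔞 (x :: l) := ⟨inf_le_left.trans hx, hW⟩
    have hxI : x ∈ I := by
      rw [hI, sup_ofList_cons]
      exact Ideal.mem_sup_left (Ideal.mem_sup_right (Ideal.mem_span_singleton_self x))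
    refine ⟨hW', fun n => le_antisymm (fun a ha => hW'.mem_pow_sup_colon hI (mem_colon.1 ha))
      (sup_le (fun a ha => mem_colon.2 (Ideal.mem_sup_left ?_)) (colon_mono le_sup_right x)),
      inf_le_left.trans hx, (rlen_eq_zero_of_le hx).le, hH⟩
    rw [pow_succ' I (n + 1)]
    exact Ideal.mul_mem_mul hxI ha

variable [IsLocalRing R] [IsNoetherianRing R]

lemma PSys.colon_le (h1 : (1 : R) ∈ bT (⊥ : Ideal R)) {p : List R} {x : R} {s : List R}
    (h : PSys ⊥ (p ++ x :: s)) : colon (Ideal.ofList p) x ≤ Ideal.ofList p := fun v hv => by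
  simpa using bT_apply h1 h (v := v) (by simpa using mem_colon.1 hv)

/-- The higher Hilbert coefficients of a parameter ideal of a Cohen-Macaulay ring vanish. -/
lemma hilbCoeff_eq_zero_of_regular (h1 : (1 : R) ∈ bT (⊥ : Ideal R)) {l : List R} {x : R}
    (h : PSys ⊥ (l ++ [x])) {e : ℕ → ℤ}
    (he : IsHilbCoeff R (Ideal.ofList (l ++ [x])) (l.length + 1) e) {i : ℕ} (hi : 1 ≤ i)
    (hi' : i ≤ l.length + 1) : e i = 0 := by
  obtain ⟨-, hH⟩ := hilbChain_of_regular (I := Ideal.ofList (l ++ [x])) (l ++ [x]) (𝔞 := ⊥)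
    (by simp) fun p y s hp => by
      have := PSys.colon_le h1 (hp ▸ h)
      simpa using this
  obtain ⟨e', -, -, huniq, hb, -⟩ := exists_hilbCoeff (b := 0) (Ideal.pow_le_self two_ne_zero)
    le_rfl (length_quot_ne_top (by simpa using h.rad)) (by simp [rlen_self]) hH rfl
  rw [huniq e he i hi']
  simpa using hb i hi hi'

lemma hilbCoeff_top_eq_zero {d : ℕ} {e : ℕ → ℤ} (he : IsHilbCoeff R (⊤ : Ideal R) d e) {i : ℕ}
    (hi : i ≤ d) : e i = 0 := by
  obtain ⟨N, hN⟩ := isHilbCoeff_iff.1 he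
  have h0 : ∀ n ≥ N, binSum (fun i => (-1) ^ i * e i) d n = binSum (fun _ => 0) d n := by
    intro n hn
    obtain ⟨L, hL, hL'⟩ := hN n hn
    rw [← hL', Ideal.top_pow, (Module.length_eq_zero_iff (R := R)).2 inferInstance] at *
    have : L = 0 := by exact_mod_cast hL.symm
    simp [this, binSum]
  simpa using binSum_unique d h0 i hi

end Regular

section Bounds

variable {R : Type u} [CommRing R] [IsLocalRing R] [IsNoetherianRing R]

/-- Bounds for the lengths of the local cohomology of `R` modulo `j` parameters. -/
noncomputable def lcBound (R : Type u) [CommRing R] [IsLocalRing R] : ℕ → ℕ → ℕ∞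
  | 0, i => Module.length R (LQ (⊥ : Ideal R) i)
  | j + 1, i => lcBound R j i + lcBound R j (i + 1)

/-- Bounds for the Bass numbers of `R` modulo `j` parameters. -/
noncomputable def bassBound (R : Type u) [CommRing R] [IsLocalRing R] (C : ℕ) : ℕ → ℕ → ℕ∞
  | 0, i => bass R (R ⧸ (⊥ : Ideal R)) i
  | j + 1, i => bassBound R C j i + bassBound R C j (i + 1) +
      C * bass R (R ⧸ maximalIdeal R) (i + 2)

lemma lcBound_ne_top {d : ℕ} (h : ∀ i < d, Module.length R (LQ (⊥ : Ideal R) i) ≠ ⊤) (j : ℕ) :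
    ∀ i, j + i < d → lcBound R j i ≠ ⊤ := by
  induction j with
  | zero => exact fun i hi => h i (by omega)
  | succ j ih => exact fun i hi => WithTop.add_ne_top.2 ⟨ih i (by omega), ih (i + 1) (by omega)⟩

lemma bassBound_ne_top (C j : ℕ) : ∀ i, bassBound R C j i ≠ ⊤ := by
  induction j with
  | zero => exact fun i => bass_ne_top _ _
  | succ j ih =>
    exact fun i => WithTop.add_ne_top.2 ⟨WithTop.add_ne_top.2 ⟨ih i, ih (i + 1)⟩,
      WithTop.mul_ne_top (ENat.natCast_ne_top _) (bass_ne_top _ _)⟩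

lemma CSys.length_LQ_le (p : List R) : ∀ {s : List R}, CSys (p ++ s) → ∀ i,
    Module.length R (LQ (Ideal.ofList p) i) ≤ lcBound R p.length i := by
  induction p using List.reverseRecOn with
  | nil =>
    intro s _ i
    rw [Ideal.ofList_nil]
    exact le_rfl
  | append_singleton p x ih =>
    intro s h i
    rw [List.append_assoc] at h
    obtain ⟨t, ht⟩ := CSys.exists_pow_mul_colon_le (p := p) (x := x) (s := s) h
    rw [List.length_append, List.length_singleton, ofList_concat]
    exact (length_LQ_sup_le ht i).trans (add_le_add (ih h i) (ih h (i + 1)))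

lemma exists_rlen_colon_le {d : ℕ} (hbot : qdim (⊥ : Ideal R) = (d : ℕ))
    (h : ∀ i < d, Module.length R (LQ (⊥ : Ideal R) i) ≠ ⊤) :
    ∃ C : ℕ, ∀ (p : List R) (x : R) (s : List R), CSys (p ++ x :: s) →
      rlen (Ideal.ofList p) (colon (Ideal.ofList p) x) ≤ C := by
  have hne : ∑ j ∈ Finset.range d, lcBound R j 0 ≠ ⊤ := by
    intro htop
    obtain ⟨j, hj, hj'⟩ := WithTop.sum_eq_top.1 htop
    exact lcBound_ne_top h j 0 (Finset.mem_range.1 hj) hj'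
  obtain ⟨C, hC⟩ := ENat.ne_top_iff_exists.1 hne
  refine ⟨C, fun p x s hs => ?_⟩
  have hlen : p.length < d := by
    have := hs.sys.dim.symm.trans hbot
    rw [List.length_append, List.length_cons] at this
    have : p.length + (s.length + 1) = d := by exact_mod_cast this
    omega
  obtain ⟨t, ht⟩ := hs.exists_pow_mul_colon_le
  rw [hC]
  exact (rlen_colon_le_length_LQ ht).trans ((CSys.length_LQ_le p hs 0).trans
    (Finset.single_le_sum (f := fun j => lcBound R j 0) (fun _ _ => zero_le)
      (Finset.mem_range.2 hlen)))

lemma CSys.bass_le {C : ℕ} (hC : ∀ (p : List R) (x : R) (s : List R), CSys (p ++ x :: s) →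
    rlen (Ideal.ofList p) (colon (Ideal.ofList p) x) ≤ C) (p : List R) :
    ∀ {s : List R}, CSys (p ++ s) → ∀ i,
      bass R (R ⧸ Ideal.ofList p) i ≤ bassBound R C p.length i := by
  induction p using List.reverseRecOn with
  | nil =>
    intro s _ i
    rw [Ideal.ofList_nil]
    exact le_rfl
  | append_singleton p x ih =>
    intro s h i
    rw [List.append_assoc] at h
    rw [List.length_append, List.length_singleton, ofList_concat]
    exact (bass_quot_sup_le _ x C i (hC p x s h)).trans
      (add_le_add (add_le_add (ih h i) (ih h (i + 1))) le_rfl)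

end Bounds

section Ascent

variable {R : Type u} [CommRing R] [IsLocalRing R] [IsNoetherianRing R]

lemma LC.eq_zero_of_smul_injective {M : ModuleCat.{u} R} {i : ℕ} {x : R} (hx : x ∈ maximalIdeal R)
    (h : ∀ z : LC (maximalIdeal R) M i, x • z = 0 → z = 0) (z : LC (maximalIdeal R) M i) :
    z = 0 := by
  obtain ⟨t, ht⟩ := z.torsion
  have key : ∀ n, x ^ n • z = 0 → z = 0 := by
    intro n
    induction n with
    | zero => simp
    | succ n ih =>
      intro hn
      rw [pow_succ', mul_smul] at hn
      exact ih (h _ hn)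
  exact key t (ht _ (Ideal.pow_mem_pow hx t))

/-- If `(T : x) / T` has finite length, vanishing of the local cohomology of
`R ⧸ (T + (x))` below degree `k` implies vanishing for `R ⧸ T` up to degree `k`. -/
lemma LQ_eq_zero_of_sup {T : Ideal R} {x : R} (hx : x ∈ maximalIdeal R) {t : ℕ}
    (h : maximalIdeal R ^ t * colon T x ≤ T) {k : ℕ} (hk : 1 ≤ k)
    (hz : ∀ i < k, ∀ z : LQ (T ⊔ Ideal.span {x}) i, z = 0) :
    ∀ i < k + 1, ∀ z : LQ T i, z = 0 := by
  intro i hi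
  cases i with
  | zero =>
    have hsurj : ∀ z : LQ T 0, ∃ z', x • z' = z := by
      intro z
      obtain ⟨w, rfl⟩ := LC.exact₂ (mulSeq_shortExact T x) z (hz 0 hk _)
      obtain ⟨z', rfl⟩ := LC.exact₃ (colonSeq_shortExact T x) w
        (LC.eq_zero_of_pow_smul (N := (colonSeq T x).X₁) (pow_smul_ker_colonProj h) _)
      refine ⟨z', ?_⟩
      rw [LC.map_map, colonSeq_g_mulSeq_f, LC.map_smul_id]
    have hsurj' : ∀ n : ℕ, ∀ z : LQ T 0, ∃ z', x ^ n • z' = z := by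
      intro n
      induction n with
      | zero => exact fun z => ⟨z, by simp⟩
      | succ n ih =>
        intro z
        obtain ⟨z₁, rfl⟩ := ih z
        obtain ⟨z₂, rfl⟩ := hsurj z₁
        exact ⟨z₂, by rw [pow_succ, mul_smul]⟩
    obtain ⟨n, hn⟩ := ENat.ne_top_iff_exists.1
      (LC.length_zero_ne_top (R := R) (M := ModuleCat.of R (R ⧸ T)))
    intro z
    obtain ⟨z', rfl⟩ := hsurj' n z
    exact pow_smul_of_length_le _ hn.symm.le _ (Ideal.pow_mem_pow hx n) z'
  | succ i =>
    refine LC.eq_zero_of_smul_injective hx fun z hxz => ?_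
    obtain ⟨η, hη⟩ := LC.exact₁ (mulSeq_shortExact T x) (LC.map (colonSeq T x).g (i + 1) z) (by
      rw [LC.map_map, colonSeq_g_mulSeq_f, LC.map_smul_id]
      exact hxz)
    rw [hz i (by omega) η, map_zero] at hη
    exact map_colonSeq_injective h i (by rw [← hη, map_zero])

/-- Vanishing of the local cohomology modulo the end of a `C`-system of parameters ascends to
the ring when all colon lengths are uniformly bounded. -/
lemma CSys.LQ_eq_zero (hres : IsHomImageOfCM R) {C : ℕ}
    (hC : ∀ (p : List R) (x : R) (s : List R), CSys (p ++ x :: s) →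
      rlen (Ideal.ofList p) (colon (Ideal.ofList p) x) ≤ C) (s : List R) :
    ∀ {p : List R}, p ≠ [] → CSys (p ++ s) →
      (∀ i < p.length, ∀ z : LQ (Ideal.ofList s) i, z = 0) →
      ∀ i < (p ++ s).length, ∀ z : LQ (⊥ : Ideal R) i, z = 0 := by
  induction s with
  | nil =>
    intro p _ _ h
    rw [Ideal.ofList_nil] at h
    rwa [List.append_nil]
  | cons x t ih =>
    intro p hp hs h
    have hx : x ∈ maximalIdeal R := hs.sys.mem x (by simp)
    obtain ⟨n, hn⟩ := hs.cPart.exists_pow_mul_colon_le hres fun y w hyw _ =>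
      ⟨C, fun m hm l z e => hC l z [] (e ▸ hyw.pow hm)⟩
    have h' : ∀ i < p.length, ∀ z : LQ (Ideal.ofList t ⊔ Ideal.span {x}) i, z = 0 := by
      rw [sup_comm, ← Ideal.ofList_cons]
      exact h
    have := ih (p := p ++ [x]) (by simp) (by simpa using hs) (by
      rw [List.length_append, List.length_singleton]
      exact LQ_eq_zero_of_sup hx hn (List.length_pos_of_ne_nil hp) h')
    simpa using this

lemma CSys.mem_sq_of_LQ_ne_zero (hres : IsHomImageOfCM R) {C : ℕ}
    (hC : ∀ (p : List R) (x : R) (s : List R), CSys (p ++ x :: s) →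
      rlen (Ideal.ofList p) (colon (Ideal.ofList p) x) ≤ C) {l : List R} (h : CSys l)
    (hne : ¬ ∀ i < l.length, ∀ z : LQ (⊥ : Ideal R) i, z = 0) :
    ∀ a ∈ l, a ∈ maximalIdeal R ^ 2 := by
  intro a ha
  obtain ⟨p, s, rfl⟩ := List.append_of_mem ha
  by_contra hna
  have htop : bT (Ideal.ofList s) = ⊤ := by
    by_contra hlt
    have h1 : a ∈ maximalIdeal R ^ 3 :=
      Ideal.pow_right_mono (IsLocalRing.le_maximalIdeal hlt) 3 (CTail.mem h.tail)
    exact hna (Ideal.pow_le_pow_right (by norm_num) h1)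
  have h2 : CSys ((p ++ [a]) ++ s) := by simpa using h
  refine hne ?_
  have := CSys.LQ_eq_zero hres hC s (p := p ++ [a]) (by simp) h2 fun i hi z => by
    rw [← one_smul R z]
    exact bT_pow_smul_LQ i _ _ h2.cPart.dim hi 1 (by rw [htop, Ideal.top_pow]; trivial) z
  simpa using this

lemma one_mem_bT_of_LQ_eq_zero {d : ℕ} (hdim : ringKrullDim R = (d : WithBot ℕ∞))
    (h : ∀ i < d, ∀ z : LQ (⊥ : Ideal R) i, z = 0) : (1 : R) ∈ bT (⊥ : Ideal R) := by
  have hCM : IsCMLocal R := by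
    intro i hi
    rw [hdim] at hi
    have : Subsingleton (LQ (⊥ : Ideal R) i) :=
      ⟨fun a b => by rw [h i (by exact_mod_cast hi) a, h i (by exact_mod_cast hi) b]⟩
    rw [← Module.length_eq_zero_iff (R := R), length_Hmod_eq, Module.length_eq_zero_iff]
    exact this
  simpa using ExtKill.mem_bT (qdim_bot_eq.trans hdim) (extKill_one_of_isCMLocal hCM hdim)

end Ascent

section Necessity

variable {R : Type u} [CommRing R] [IsLocalRing R] [IsNoetherianRing R]

/-- In a Cohen-Macaulay ring, the higher Hilbert coefficients of `Q : m` vanish unless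
`m * (Q : m) = m * Q`. -/
lemma PSys.hilbCoeff_colonIdeal_eq_zero (h1 : (1 : R) ∈ bT (⊥ : Ideal R)) {l : List R}
    (h : PSys ⊥ l)
    (hI : ¬ (colonIdeal R (Ideal.ofList l) ≤ maximalIdeal R ∧
      maximalIdeal R * colonIdeal R (Ideal.ofList l) ≤ maximalIdeal R * Ideal.ofList l))
    {e : ℕ → ℤ} (he : IsHilbCoeff R (colonIdeal R (Ideal.ofList l)) l.length e) {i : ℕ}
    (hi : 1 ≤ i) (hi' : i ≤ l.length) : e i = 0 := by
  by_cases hIm : colonIdeal R (Ideal.ofList l) ≤ maximalIdeal R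
  swap
  · have htop : colonIdeal R (Ideal.ofList l) = ⊤ := by
      by_contra hne
      exact hIm (IsLocalRing.le_maximalIdeal hne)
    rw [htop] at he
    exact hilbCoeff_top_eq_zero he hi'
  obtain ⟨A, x, s, y, a, rfl, hy, ha, hx⟩ := exists_socle_factor fun hmI => hI ⟨hIm, hmI⟩
  set J := Ideal.ofList (A ++ s) with hJ
  have hl : Ideal.ofList (A ++ x :: s) = J ⊔ Ideal.span {x} := by
    rw [hJ, ofList_perm (List.perm_middle (a := x) (l₁ := A) (l₂ := s)), Ideal.ofList_cons,
      sup_comm]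
  have hPx : PSys (⊥ : Ideal R) ((A ++ s) ++ x :: []) :=
    h.perm (List.perm_middle.trans (List.perm_append_singleton x (A ++ s)).symm)
  have hxJa : x ∈ J ⊔ Ideal.span {a} := by
    rw [← sub_add_cancel x (y * a)]
    exact add_mem (Ideal.mem_sup_left hx)
      (Ideal.mem_sup_right (Ideal.mul_mem_left _ _ (Ideal.mem_span_singleton_self a)))
  have hQ : Ideal.ofList (A ++ x :: s) ≤ J ⊔ Ideal.span {a} := by
    rw [hl]
    exact sup_le le_sup_left ((Ideal.span_singleton_le_iff_mem _).2 hxJa)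
  have hcol : colonIdeal R (Ideal.ofList (A ++ x :: s)) = J ⊔ Ideal.span {a} := by
    refine le_antisymm (fun v hv => ?_) (sup_le ?_ ((Ideal.span_singleton_le_iff_mem _).2 ha))
    · have hyv : y * v ∈ J ⊔ Ideal.span {x} := hl ▸ hv y hy
      obtain ⟨j, hj, w, hw, hjw⟩ := Submodule.mem_sup.1 hyv
      obtain ⟨c, rfl⟩ := Ideal.mem_span_singleton'.1 hw
      have hyJ : y * (v - c * a) ∈ J := by
        have : y * (v - c * a) = j + c * (x - y * a) := by
          rw [mul_sub, ← hjw]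
          ring
        rw [this]
        exact add_mem hj (Ideal.mul_mem_left _ _ hx)
      have hxv : x * (v - c * a) ∈ J := by
        have : x * (v - c * a) = (x - y * a) * (v - c * a) + a * (y * (v - c * a)) := by ring
        rw [this]
        exact add_mem (Ideal.mul_mem_right _ _ hx) (Ideal.mul_mem_left _ _ hyJ)
      have := PSys.colon_le h1 hPx (mem_colon.2 hxv)
      rw [← sub_add_cancel v (c * a)]
      exact add_mem (Ideal.mem_sup_left this)
        (Ideal.mem_sup_right (Ideal.mul_mem_left _ _ (Ideal.mem_span_singleton_self a)))
    · refine le_trans ?_ (le_colonIdeal _)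
      rw [hl]
      exact le_sup_left
  have ham : a ∈ maximalIdeal R := hIm ha
  have hPa : PSys (⊥ : Ideal R) ((A ++ s) ++ [a]) := by
    refine h.of_rad (by simp) (fun b hb => ?_) ?_
    · rcases List.mem_append.1 hb with hb | hb
      · exact hPx.mem b (List.mem_append_left _ hb)
      · rwa [List.mem_singleton.1 hb]
    · rw [bot_sup_eq, bot_sup_eq, ofList_concat]
      exact hQ.trans Ideal.le_radical
  have hlen : (A ++ x :: s).length = (A ++ s).length + 1 := by simp; omega
  rw [hcol, hJ, ← ofList_concat, hlen] at he
  exact hilbCoeff_eq_zero_of_regular h1 hPa he hi (hlen ▸ hi')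

lemma exists_hilbCoeff_bound (hres : IsHomImageOfCM R) {d : ℕ} (hd : 2 ≤ d)
    (hdim : ringKrullDim R = (d : WithBot ℕ∞)) (h : IsGeneralizedCM R) :
    ∃ K : ℕ, ∀ q, IsCParamIdeal R q → ∀ e, IsHilbCoeff R (colonIdeal R q) d e →
      ∀ i, 1 ≤ i → i ≤ d → |e i| ≤ K := by
  have hbot : qdim (⊥ : Ideal R) = (d : ℕ) := qdim_bot_eq.trans hdim
  rw [isGeneralizedCM_iff hdim] at h
  obtain ⟨C, hC⟩ := exists_rlen_colon_le hbot h
  obtain ⟨B, hB⟩ := ENat.ne_top_iff_exists.1 (bassBound_ne_top (R := R) C d 0)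
  refine ⟨3 * C + B, fun q hq e he i hi hid => ?_⟩
  obtain ⟨l, hl, rfl⟩ := isCParamIdeal_iff.1 hq
  have hlen : l.length = d := by
    have := hl.sys.dim.symm.trans hbot
    exact_mod_cast this
  have hne : l ≠ [] := by
    rintro rfl
    simp only [List.length_nil] at hlen
    omega
  by_cases hI : colonIdeal R (Ideal.ofList l) ≤ maximalIdeal R ∧
      maximalIdeal R * colonIdeal R (Ideal.ofList l) ≤ maximalIdeal R * Ideal.ofList l
  · have hII := hl.colonIdeal_mul_self hne hI.1 hI.2
    obtain ⟨b, hb⟩ := hl.exists_rlen_colonIdeal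
    have hbB : b ≤ B := by
      have := CSys.bass_le hC l (s := []) (by simpa using hl) 0
      rw [← rlen_colonIdeal_eq_bass, hb, hlen, ← hB] at this
      exact_mod_cast this
    obtain ⟨l, x, rfl⟩ : ∃ l' x, l = l' ++ [x] :=
      ⟨l.dropLast, l.getLast hne, (List.dropLast_append_getLast hne).symm⟩
    obtain ⟨e', -, -, huniq, hb', -⟩ := hl.exists_hilbCoeff rfl hII (C := C)
      (fun p y s hp => hC p y s (hp ▸ hl)) hb
    have hlen' : d = l.length + 1 := by
      rw [← hlen, List.length_append, List.length_singleton]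
    subst hlen'
    rw [huniq e he i hid]
    refine (hb' i hi hid).trans ?_
    have : (b : ℤ) ≤ B := by exact_mod_cast hbB
    push_cast
    linarith
  · have hz : ∀ i < l.length, ∀ z : LQ (⊥ : Ideal R) i, z = 0 := by
      by_contra hz
      have hm := hl.mem_sq_of_LQ_ne_zero hres hC hz
      exact hI ⟨hl.colonIdeal_le hne hm, hl.mul_colonIdeal_le (by omega) hm⟩
    subst hlen
    rw [hl.sys.hilbCoeff_colonIdeal_eq_zero (one_mem_bT_of_LQ_eq_zero hdim hz) hI he hi hid,
      abs_zero]
    positivity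

end Necessity

end CParam

/-- For `dim R = d ≥ 2`, `R` is generalized Cohen-Macaulay iff the sets
`Ξ_i(R) = {e_i(q :_R m, R) : q a C-parameter ideal of R}` are finite for `i = 1, ..., d`. -/
theorem statement_14 {R : Type u} [CommRing R] [IsLocalRing R] [IsNoetherianRing R]
    (hres : IsHomImageOfCM R)
    (d : ℕ) (hd : 2 ≤ d) (hdim : ringKrullDim R = (d : WithBot ℕ∞)) :
    IsGeneralizedCM R ↔
      ∀ i : ℕ, 1 ≤ i → i ≤ d →
        {z : ℤ | ∃ q : Ideal R, IsCParamIdeal R q ∧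
          ∃ e : ℕ → ℤ, IsHilbCoeff R (colonIdeal R q) d e ∧ z = e i}.Finite := by
  constructor
  · intro h i h1 hi
    obtain ⟨K, hK⟩ := CParam.exists_hilbCoeff_bound hres hd hdim h
    refine (Set.finite_Icc (-(K : ℤ)) K).subset ?_
    rintro z ⟨q, hq, e, he, rfl⟩
    exact abs_le.1 (hK q hq e he i h1 hi)
  · intro h
    have hfin : (⋃ i ∈ Set.Icc 1 d, {z : ℤ | ∃ q : Ideal R, IsCParamIdeal R q ∧
        ∃ e : ℕ → ℤ, IsHilbCoeff R (colonIdeal R q) d e ∧ z = e i}).Finite :=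
      (Set.finite_Icc 1 d).biUnion fun i hi => h i hi.1 hi.2
    obtain ⟨K, hK⟩ := (hfin.image Int.natAbs).bddAbove
    refine CParam.isGeneralizedCM_of_bounded hres hd hdim (K := K)
      fun q hq e he i h1 hi => ?_
    have hle : (e i).natAbs ≤ K :=
      hK ⟨e i, Set.mem_biUnion (Set.mem_Icc.2 ⟨h1, hi⟩) ⟨q, hq, e, he, rfl⟩, rfl⟩
    rw [Int.abs_eq_natAbs]
    exact_mod_cast hle
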